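/- arXiv:2405.08147 — 2 statements merged into one kernel-verified Lean document; each statement's English description precedes it below -/
import Mathlib

section
/- Let n ≥ 1 and let U be a 3^n × 3^n unitary matrix all of whose entries lie in ℤ[1/3, ω]. Then there exist an element W of the (n+1)-qutrit Clifford+T group and a nonzero vector w ∈ ℂ³ such that for every v ∈ ℂ^{3^n}, W(v ⊗ w) = (U v) ⊗ w. That is, U can be exactly represented by a quantum circuit over the Clifford+T gate set using at most one ancilla. -/
/-- `ω = e^{2πi/3}`. -/
noncomputable def ω : ℂ := Complex.exp (2 * Real.pi * Complex.I / 3)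

/-- `ζ = e^{2πi/9}`. -/
noncomputable def ζ : ℂ := Complex.exp (2 * Real.pi * Complex.I / 9)

/-- The qutrit gate `H = (1/(i√3))·[[1,1,1],[1,ω,ω²],[1,ω²,ω]]`. -/
noncomputable def H3 : Matrix (Fin 3) (Fin 3) ℂ :=
  (Complex.I * (Real.sqrt 3 : ℂ))⁻¹ • !![1, 1, 1; 1, ω, ω ^ 2; 1, ω ^ 2, ω]

/-- The qutrit gate `S = diag(1, 1, ω)`. -/
noncomputable def S3 : Matrix (Fin 3) (Fin 3) ℂ := !![1, 0, 0; 0, 1, 0; 0, 0, ω]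

/-- The qutrit gate `T = diag(1, ζ, ζ⁻¹)`. -/
noncomputable def T3 : Matrix (Fin 3) (Fin 3) ℂ := !![1, 0, 0; 0, ζ, 0; 0, 0, ζ⁻¹]

/-- The operator on `(ℂ³)^{⊗n}` (standard basis indexed by words `x : Fin n → Fin 3`)
acting as the single-qutrit gate `g` on tensor factor `j` and as the identity on the other
factors. -/
def wireGate (n : ℕ) (g : Matrix (Fin 3) (Fin 3) ℂ) (j : Fin n) :
    Matrix (Fin n → Fin 3) (Fin n → Fin 3) ℂ :=
  Matrix.of fun x y => if ∀ i, i ≠ j → x i = y i then g (x j) (y j) else 0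

/-- The operator on `(ℂ³)^{⊗n}` acting as the two-qutrit gate
`CX : e_x ⊗ e_y ↦ e_x ⊗ e_{x + y mod 3}` on the ordered pair of tensor factors `(j, l)`
and as the identity on the other factors. -/
def cxGate (n : ℕ) (j l : Fin n) : Matrix (Fin n → Fin 3) (Fin n → Fin 3) ℂ :=
  Matrix.of fun x y =>
    if x j = y j ∧ x l = y j + y l ∧ ∀ i, i ≠ j → i ≠ l → x i = y i then 1 else 0

/-- The generators of the `n`-qutrit Clifford+`T` group: `H`, `S` or `T` on one wire, and
`CX` on an ordered pair of distinct wires. -/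
def cliffordTGens (n : ℕ) : Set (Matrix (Fin n → Fin 3) (Fin n → Fin 3) ℂ) :=
  {G | ∃ j, G = wireGate n H3 j ∨ G = wireGate n S3 j ∨ G = wireGate n T3 j} ∪
    {G | ∃ j l, j ≠ l ∧ G = cxGate n j l}

/-- The `n`-qutrit Clifford+`T` group: the subgroup of the unitary group `U(3^n, ℂ)`
generated by the gates `H`, `S`, `T` on single wires and `CX` on ordered pairs of wires. -/
def CliffordT (n : ℕ) : Subgroup (Matrix.unitaryGroup (Fin n → Fin 3) ℂ) :=
  Subgroup.closure {W | (W : Matrix (Fin n → Fin 3) (Fin n → Fin 3) ℂ) ∈ cliffordTGens n}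

namespace MQ

lemma zeta_pow9 : ζ ^ 9 = 1 := by
  unfold ζ
  rw [← Complex.exp_nat_mul, ← Complex.exp_two_pi_mul_I]
  congr 1; push_cast; ring

lemma omega_eq : ω = ζ ^ 3 := by
  unfold ζ ω
  rw [← Complex.exp_nat_mul]
  congr 1; push_cast; ring

lemma omega_val : ω = -(1/2) + (Real.sqrt 3 : ℂ) / 2 * Complex.I := by
  unfold ω
  have : (2 * Real.pi * Complex.I / 3 : ℂ) = ((2 * Real.pi / 3 : ℝ) : ℂ) * Complex.I := by
    push_cast; ring
  rw [this, Complex.exp_mul_I, ← Complex.ofReal_cos, ← Complex.ofReal_sin]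
  have h : 2 * Real.pi / 3 = Real.pi - Real.pi / 3 := by ring
  rw [h, Real.cos_pi_sub, Real.sin_pi_sub, Real.cos_pi_div_three, Real.sin_pi_div_three]
  push_cast; ring

lemma sqrt3_sq : (Real.sqrt 3 : ℂ) ^ 2 = 3 := by
  rw [← Complex.ofReal_pow, Real.sq_sqrt (by norm_num)]; norm_num

lemma omega_quad : ω ^ 2 + ω + 1 = 0 := by
  rw [omega_val]
  linear_combination (-1/4 : ℂ) * sqrt3_sq + (Real.sqrt 3 : ℂ)^2 / 4 * Complex.I_sq

lemma omega_cube : ω ^ 3 = 1 := by linear_combination (ω - 1) * omega_quad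

lemma zeta_min : ζ ^ 6 + ζ ^ 3 + 1 = 0 := by
  have := omega_quad
  rw [omega_eq] at this
  linear_combination this

lemma zeta_inv : ζ⁻¹ = ζ ^ 8 := by
  apply inv_eq_of_mul_eq_one_right
  linear_combination zeta_pow9

lemma conj_zeta : (starRingEnd ℂ) ζ = ζ ^ 8 := by
  rw [← zeta_inv]
  unfold ζ
  rw [← Complex.exp_conj, ← Complex.exp_neg]
  congr 1
  simp [map_ofNat]; ring

lemma conj_omega : (starRingEnd ℂ) ω = ω ^ 2 := by
  rw [omega_eq, map_pow, conj_zeta]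
  linear_combination (ζ ^ 15 + ζ^6) * zeta_pow9

lemma h_scal : (Complex.I * (Real.sqrt 3 : ℂ))⁻¹ = -(1 + 2 * ω) / 3 := by
  apply inv_eq_of_mul_eq_one_right
  rw [omega_val]
  linear_combination (-Complex.I ^2 / 3) * sqrt3_sq - Complex.I_sq

abbrev U3 := Matrix.unitaryGroup (Fin 3) ℂ

noncomputable def Z3 : Matrix (Fin 3) (Fin 3) ℂ := !![1, 0, 0; 0, ω, 0; 0, 0, ω ^ 2]
noncomputable def X3 : Matrix (Fin 3) (Fin 3) ℂ := !![0, 0, 1; 1, 0, 0; 0, 1, 0]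
noncomputable def P3 : Matrix (Fin 3) (Fin 3) ℂ := !![ζ, 0, 0; 0, ζ, 0; 0, 0, ζ ^ 7]
noncomputable def W3 : Matrix (Fin 3) (Fin 3) ℂ := !![ω, 0, 0; 0, ω, 0; 0, 0, ω]

lemma H3_eq : H3 = !![-(1 + 2 * ζ^3) / 3, -(1 + 2 * ζ^3) / 3, -(1 + 2 * ζ^3) / 3;
    -(1 + 2 * ζ^3) / 3, (2 + ζ^3) / 3, (-1 + ζ^3) / 3;
    -(1 + 2 * ζ^3) / 3, (-1 + ζ^3) / 3, (2 + ζ^3) / 3] := by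
  have hz := zeta_min
  unfold H3
  rw [h_scal, omega_eq]
  ext i j
  fin_cases i <;> fin_cases j <;> simp <;> grind

lemma H3_mem : H3 ∈ Matrix.unitaryGroup (Fin 3) ℂ := by
  have hz := zeta_min
  rw [Matrix.mem_unitaryGroup_iff, H3_eq]
  ext i j
  fin_cases i <;> fin_cases j <;>
    simp [Matrix.mul_apply, Fin.sum_univ_three, Matrix.star_apply, conj_zeta, map_ofNat] <;> grind

lemma T3_mem : T3 ∈ Matrix.unitaryGroup (Fin 3) ℂ := by
  have hz := zeta_min
  have h9 := zeta_pow9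
  rw [Matrix.mem_unitaryGroup_iff, T3, zeta_inv]
  ext i j
  fin_cases i <;> fin_cases j <;>
    simp [Matrix.mul_apply, Fin.sum_univ_three, Matrix.star_apply, conj_zeta, map_ofNat] <;> grind

lemma Z3_mem : Z3 ∈ Matrix.unitaryGroup (Fin 3) ℂ := by
  have hz := omega_quad
  rw [Matrix.mem_unitaryGroup_iff, Z3]
  ext i j
  fin_cases i <;> fin_cases j <;>
    simp [Matrix.mul_apply, Fin.sum_univ_three, Matrix.star_apply, conj_omega] <;> grind

lemma X3_mem : X3 ∈ Matrix.unitaryGroup (Fin 3) ℂ := by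
  rw [Matrix.mem_unitaryGroup_iff, X3]
  ext i j
  fin_cases i <;> fin_cases j <;>
    simp [Matrix.mul_apply, Fin.sum_univ_three, Matrix.star_apply]

lemma P3_mem : P3 ∈ Matrix.unitaryGroup (Fin 3) ℂ := by
  have hz := zeta_min
  have h9 := zeta_pow9
  rw [Matrix.mem_unitaryGroup_iff, P3]
  ext i j
  fin_cases i <;> fin_cases j <;>
    simp [Matrix.mul_apply, Fin.sum_univ_three, Matrix.star_apply, conj_zeta, map_ofNat] <;> grind

lemma W3_mem : W3 ∈ Matrix.unitaryGroup (Fin 3) ℂ := by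
  have hz := omega_quad
  rw [Matrix.mem_unitaryGroup_iff, W3]
  ext i j
  fin_cases i <;> fin_cases j <;>
    simp [Matrix.mul_apply, Fin.sum_univ_three, Matrix.star_apply, conj_omega] <;> grind

noncomputable def Hu : U3 := ⟨H3, H3_mem⟩
noncomputable def Tu : U3 := ⟨T3, T3_mem⟩
noncomputable def Zu : U3 := ⟨Z3, Z3_mem⟩
noncomputable def Xu : U3 := ⟨X3, X3_mem⟩
noncomputable def Pu : U3 := ⟨P3, P3_mem⟩
noncomputable def Wu : U3 := ⟨W3, W3_mem⟩

lemma rel_X : Xu ^ 3 = 1 := by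
  apply Subtype.ext
  simp only [pow_succ, pow_zero, one_mul, Submonoid.coe_mul, Submonoid.coe_one, Xu]
  ext i j
  fin_cases i <;> fin_cases j <;>
    simp [X3, Matrix.mul_apply, Fin.sum_univ_three]

lemma rel_TZ : Tu ^ 3 = Zu := by
  have hz := zeta_min
  apply Subtype.ext
  simp only [pow_succ, pow_zero, one_mul, Submonoid.coe_mul, Zu, Tu]
  rw [T3, Z3, zeta_inv, omega_eq]
  ext i j
  fin_cases i <;> fin_cases j <;>
    simp [Matrix.mul_apply, Fin.sum_univ_three] <;> grind

lemma rel_HX : Hu * Xu = Zu * Hu := by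
  have hz := zeta_min
  apply Subtype.ext
  simp only [Submonoid.coe_mul, Zu, Hu, Xu]
  rw [H3_eq, Z3, X3, omega_eq]
  ext i j
  fin_cases i <;> fin_cases j <;>
    simp [Matrix.mul_apply, Fin.sum_univ_three] <;> grind

lemma rel_TX : Tu * Xu * Tu * Xu * Tu * Xu = 1 := by
  have hz := zeta_min
  apply Subtype.ext
  simp only [Submonoid.coe_mul, Submonoid.coe_one, Tu, Xu]
  rw [T3, X3, zeta_inv]
  ext i j
  fin_cases i <;> fin_cases j <;>
    simp [Matrix.mul_apply, Fin.sum_univ_three] <;> grind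

lemma rel_P : Tu * Xu = Pu * Xu * Tu := by
  have hz := zeta_min
  apply Subtype.ext
  simp only [Submonoid.coe_mul, Tu, Xu, Pu]
  rw [T3, X3, P3, zeta_inv]
  ext i j
  fin_cases i <;> fin_cases j <;>
    simp [Matrix.mul_apply, Fin.sum_univ_three] <;> grind

lemma rel_PX : Pu * Xu = Wu * Zu ^ 2 * Xu * Pu := by
  have hz := zeta_min
  apply Subtype.ext
  simp only [pow_succ, pow_zero, one_mul, Submonoid.coe_mul, Zu, Xu, Pu, Wu]
  rw [W3, X3, P3, Z3, omega_eq]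
  ext i j
  fin_cases i <;> fin_cases j <;>
    simp [Matrix.mul_apply, Fin.sum_univ_three] <;> grind

lemma rel_ZX : Zu * Xu = Wu * Xu * Zu := by
  have hz := zeta_min
  apply Subtype.ext
  simp only [Submonoid.coe_mul, Zu, Xu, Wu]
  rw [W3, X3, Z3, omega_eq]
  ext i j
  fin_cases i <;> fin_cases j <;>
    simp [Matrix.mul_apply, Fin.sum_univ_three] <;> grind

lemma rel_Z : Zu ^ 3 = 1 := by
  have hz := omega_quad
  apply Subtype.ext
  simp only [pow_succ, pow_zero, one_mul, Submonoid.coe_mul, Submonoid.coe_one, Zu]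
  rw [Z3]
  ext i j
  fin_cases i <;> fin_cases j <;>
    simp [Matrix.mul_apply, Fin.sum_univ_three] <;> grind

lemma rel_H : Pu * Xu * Hu * Pu * Hu * Pu = Hu := by
  have hz := zeta_min
  apply Subtype.ext
  simp only [Submonoid.coe_mul, Hu, Xu, Pu]
  rw [X3, P3, H3_eq]
  ext i j
  fin_cases i <;> fin_cases j <;>
    simp [Matrix.mul_apply, Fin.sum_univ_three] <;> grind

section Wires
variable {m : ℕ}

abbrev Rest (j : Fin m) := {i : Fin m // i ≠ j} → Fin 3

/-- restriction of a word away from `j` -/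
abbrev rst (j : Fin m) (x : Fin m → Fin 3) : Rest j := fun i => x i

noncomputable def phiMat (j : Fin m) (F : Rest j → Matrix (Fin 3) (Fin 3) ℂ) :
    Matrix (Fin m → Fin 3) (Fin m → Fin 3) ℂ :=
  (Matrix.blockDiagonal F).submatrix (Equiv.funSplitAt j (Fin 3)) (Equiv.funSplitAt j (Fin 3))

lemma phiMat_apply (j : Fin m) (F : Rest j → Matrix (Fin 3) (Fin 3) ℂ) (x y : Fin m → Fin 3) :
    phiMat j F x y = if rst j x = rst j y then F (rst j x) (x j) (y j) else 0 := by
  simp [phiMat, Matrix.blockDiagonal_apply, Equiv.funSplitAt, Equiv.piSplitAt]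

lemma rst_eq_iff (j : Fin m) (x y : Fin m → Fin 3) :
    rst j x = rst j y ↔ ∀ i, i ≠ j → x i = y i := by
  constructor
  · intro h i hi
    exact congrFun h ⟨i, hi⟩
  · intro h
    funext i
    exact h i i.2

lemma phiMat_mul (j : Fin m) (F G : Rest j → Matrix (Fin 3) (Fin 3) ℂ) :
    phiMat j (fun r => F r * G r) = phiMat j F * phiMat j G := by
  rw [phiMat, phiMat, phiMat, Matrix.blockDiagonal_mul, Matrix.submatrix_mul_equiv]

lemma phiMat_one (j : Fin m) : phiMat j (fun _ => 1) = 1 := by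
  have : (fun _ => 1 : Rest j → Matrix (Fin 3) (Fin 3) ℂ) = 1 := rfl
  rw [phiMat, this, Matrix.blockDiagonal_one, Matrix.submatrix_one_equiv]

lemma phiMat_star (j : Fin m) (F : Rest j → Matrix (Fin 3) (Fin 3) ℂ) :
    star (phiMat j F) = phiMat j (fun r => star (F r)) := by
  rw [phiMat, phiMat, Matrix.star_eq_conjTranspose, Matrix.conjTranspose_submatrix,
    Matrix.blockDiagonal_conjTranspose]
  rfl

lemma phiMat_mem (j : Fin m) (F : Rest j → U3) :
    phiMat j (fun r => (F r : Matrix (Fin 3) (Fin 3) ℂ)) ∈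
      Matrix.unitaryGroup (Fin m → Fin 3) ℂ := by
  rw [Matrix.mem_unitaryGroup_iff, phiMat_star, ← phiMat_mul]
  have : (fun r => (F r : Matrix (Fin 3) (Fin 3) ℂ) * star (F r : Matrix (Fin 3) (Fin 3) ℂ))
      = fun _ => 1 := by
    funext r
    exact Matrix.mem_unitaryGroup_iff.1 (F r).2
  rw [this, phiMat_one]

noncomputable def phi (j : Fin m) :
    (Rest j → U3) →* Matrix.unitaryGroup (Fin m → Fin 3) ℂ where
  toFun F := ⟨phiMat j (fun r => (F r : Matrix (Fin 3) (Fin 3) ℂ)), phiMat_mem j F⟩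
  map_one' := Subtype.ext (phiMat_one j)
  map_mul' F G := Subtype.ext (phiMat_mul j _ _)

lemma phi_coe (j : Fin m) (F : Rest j → U3) :
    (phi j F : Matrix (Fin m → Fin 3) (Fin m → Fin 3) ℂ) =
      phiMat j (fun r => (F r : Matrix (Fin 3) (Fin 3) ℂ)) := rfl

lemma phi_mulVec (j : Fin m) (F : Rest j → U3) (v : (Fin m → Fin 3) → ℂ) (x : Fin m → Fin 3) :
    (phi j F : Matrix (Fin m → Fin 3) (Fin m → Fin 3) ℂ).mulVec v x =
      ∑ b, (F (rst j x) : Matrix (Fin 3) (Fin 3) ℂ) (x j) b * v (Function.update x j b) := by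
  rw [phi_coe]
  simp only [Matrix.mulVec, dotProduct, phiMat_apply, ite_mul, zero_mul]
  rw [← Finset.sum_filter]
  symm
  refine Finset.sum_bij (fun b _ => Function.update x j b) ?_ ?_ ?_ ?_
  · intro b _
    simp only [Finset.mem_filter, Finset.mem_univ, true_and]
    rw [rst_eq_iff]
    intro i hi
    simp [hi]
  · intro a _ b _ h
    have := congrFun h j
    simpa using this
  · intro y hy
    simp only [Finset.mem_filter, Finset.mem_univ, true_and] at hy
    rw [rst_eq_iff] at hy
    refine ⟨y j, Finset.mem_univ _, ?_⟩
    funext i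
    by_cases hi : i = j
    · subst hi; simp
    · simp [hi, hy i hi]
  · intro b _
    simp

noncomputable def LL (j : Fin m) : Subgroup (Rest j → U3) := (CliffordT m).comap (phi j)

lemma mem_LL (j : Fin m) (F : Rest j → U3) : F ∈ LL j ↔ phi j F ∈ CliffordT m := Iff.rfl

lemma phi_const (j : Fin m) (g : U3) :
    (phi j (fun _ => g) : Matrix (Fin m → Fin 3) (Fin m → Fin 3) ℂ) = wireGate m g j := by
  ext x y
  rw [phi_coe, phiMat_apply, wireGate, Matrix.of_apply]
  simp only [rst_eq_iff]

lemma LL_H (j : Fin m) : (fun _ => Hu) ∈ LL j := by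
  rw [mem_LL]
  apply Subgroup.subset_closure
  left
  exact ⟨j, Or.inl (phi_const j Hu)⟩

lemma LL_T (j : Fin m) : (fun _ => Tu) ∈ LL j := by
  rw [mem_LL]
  apply Subgroup.subset_closure
  left
  exact ⟨j, Or.inr (Or.inr (phi_const j Tu))⟩

lemma Xpow_apply (k : Fin 3) (a b : Fin 3) :
    ((Xu ^ (k : ℕ) : U3) : Matrix (Fin 3) (Fin 3) ℂ) a b = if a = k + b then 1 else 0 := by
  fin_cases k <;> fin_cases a <;> fin_cases b <;>
    simp [Xu, X3, pow_succ, Matrix.mul_apply, Fin.sum_univ_three]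

lemma LL_CX (j : Fin m) (i : {i : Fin m // i ≠ j}) :
    (fun r : Rest j => Xu ^ (r i : ℕ)) ∈ LL j := by
  rw [mem_LL]
  apply Subgroup.subset_closure
  right
  refine ⟨i, j, i.2, ?_⟩
  ext x y
  rw [phi_coe, phiMat_apply, cxGate, Matrix.of_apply, Xpow_apply, ← ite_and]
  refine if_congr ?_ rfl rfl
  rw [rst_eq_iff]
  constructor
  · rintro ⟨h1, h2⟩
    refine ⟨h1 _ i.2, ?_, fun k _ hk => h1 k hk⟩
    rw [h2, ← h1 _ i.2]
  · rintro ⟨h1, h2, h3⟩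
    refine ⟨fun k hk => ?_, ?_⟩
    · by_cases hki : k = i
      · rw [hki, h1]
      · exact h3 k hki hk
    · rw [h2, ← h1]

open Classical in
noncomputable def ind {j : Fin m} (A : Set (Rest j)) (g : U3) : Rest j → U3 :=
  fun r => if r ∈ A then g else 1

lemma ind_mul {j : Fin m} (A : Set (Rest j)) (g h : U3) : ind A (g * h) = ind A g * ind A h := by
  funext r
  by_cases hr : r ∈ A <;> simp [ind, hr]

lemma ind_inv {j : Fin m} (A : Set (Rest j)) (g : U3) : ind A (g⁻¹) = (ind A g)⁻¹ := by
  funext r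
  by_cases hr : r ∈ A <;> simp [ind, hr]

lemma ind_comm {j : Fin m} (A B : Set (Rest j)) (g h : U3) :
    ind (A ∩ B) (g * h * g⁻¹ * h⁻¹) = ind A g * ind B h * (ind A g)⁻¹ * (ind B h)⁻¹ := by
  funext r
  by_cases hr : r ∈ A <;> by_cases hs : r ∈ B <;> simp [ind, hr, hs]

lemma ind_conj {j : Fin m} (A : Set (Rest j)) (g h : U3) :
    ind A (h * g * h⁻¹) = (fun _ => h) * ind A g * (fun _ => h)⁻¹ := by
  funext r
  by_cases hr : r ∈ A <;> simp [ind, hr]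

/-- gates which can be controlled on `A` -/
noncomputable def KK (j : Fin m) (A : Set (Rest j)) : Subgroup U3 where
  carrier := {g | ind A g ∈ LL j}
  one_mem' := by
    have : ind A (1 : U3) = 1 := by funext r; simp [ind]
    simp only [Set.mem_ofPred_eq, this]; exact one_mem _
  mul_mem' := by
    intro a b ha hb
    simp only [Set.mem_ofPred_eq, ind_mul] at *
    exact mul_mem ha hb
  inv_mem' := by
    intro a ha
    simp only [Set.mem_ofPred_eq, ind_inv] at *
    exact inv_mem ha

lemma mem_KK {j : Fin m} {A : Set (Rest j)} {g : U3} : g ∈ KK j A ↔ ind A g ∈ LL j := Iff.rfl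

lemma KK_conj {j : Fin m} {A : Set (Rest j)} {g h : U3} (hg : g ∈ KK j A)
    (hh : (fun _ => h) ∈ LL j) : h * g * h⁻¹ ∈ KK j A := by
  rw [mem_KK, ind_conj]
  exact mul_mem (mul_mem hh hg) (inv_mem hh)

lemma KK_comm {j : Fin m} {A B : Set (Rest j)} {g h : U3} (hg : g ∈ KK j A) (hh : h ∈ KK j B) :
    g * h * g⁻¹ * h⁻¹ ∈ KK j (A ∩ B) := by
  rw [mem_KK, ind_comm]
  exact mul_mem (mul_mem (mul_mem hg hh) (inv_mem hg)) (inv_mem hh)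

lemma LL_const_inv {j : Fin m} {h : U3} (hh : (fun _ => h) ∈ LL j) : (fun _ => h⁻¹) ∈ LL j :=
  inv_mem hh

lemma X_eq : Xu = Hu⁻¹ * Zu * Hu⁻¹⁻¹ := by
  rw [inv_inv, mul_assoc, ← rel_HX, inv_mul_cancel_left]

lemma P_eq : Pu = Tu * (Xu * Tu⁻¹ * Xu⁻¹) := by
  have h := rel_P
  have : Pu = Tu * Xu * Tu⁻¹ * Xu⁻¹ := by rw [h]; group
  rw [this]; group

lemma KK_X {j : Fin m} {A : Set (Rest j)} (h : Zu ∈ KK j A) : Xu ∈ KK j A := by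
  rw [X_eq]
  exact KK_conj h (LL_const_inv (LL_H j))

lemma KK_P {j : Fin m} {A : Set (Rest j)} (h : Zu ∈ KK j A) : Pu ∈ KK j A := by
  have : Pu = (Tu * Xu * Tu⁻¹) * Xu⁻¹ := by rw [P_eq]; group
  rw [this]
  exact mul_mem (KK_conj (KK_X h) (LL_T j)) (inv_mem (KK_X h))

lemma KK_H {j : Fin m} {A : Set (Rest j)} (h : Zu ∈ KK j A) : Hu ∈ KK j A := by
  have hQ := KK_conj (KK_P h) (LL_H j)
  have hX := KK_X h
  have hP := KK_P h
  have : Hu⁻¹ = Pu * (Hu * Pu * Hu⁻¹) * Pu * Xu := by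
    have e : Xu * Hu * Pu * Hu * Pu = Pu⁻¹ * Hu := by
      rw [eq_inv_mul_iff_mul_eq]
      simpa only [mul_assoc] using rel_H
    have e2 : Pu * Hu * Pu = Hu⁻¹ * Xu⁻¹ * Pu⁻¹ * Hu := by
      rw [mul_assoc _ _ Hu, ← e]; group
    have e3 : Pu * (Hu * Pu * Hu⁻¹) * Pu * Xu = (Pu * Hu * Pu) * (Hu⁻¹ * Pu * Xu) := by group
    rw [e3, e2]; group
  have h2 : Hu⁻¹ ∈ KK j A := by
    rw [this]
    exact mul_mem (mul_mem (mul_mem hP hQ) hP) hX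
  simpa using inv_mem h2

lemma KK_inter {j : Fin m} {A B : Set (Rest j)} (hA : Zu ∈ KK j A) (hB : Zu ∈ KK j B) :
    Zu ∈ KK j (A ∩ B) := by
  have hW : Wu ∈ KK j (A ∩ B) := by
    have := KK_comm hA (KK_X hB)
    rwa [show Zu * Xu * Zu⁻¹ * Xu⁻¹ = Wu by rw [rel_ZX]; group] at this
  have h2 : Wu * Zu ^ 2 ∈ KK j (A ∩ B) := by
    have := KK_comm (KK_P hA) (KK_X hB)
    rwa [show Pu * Xu * Pu⁻¹ * Xu⁻¹ = Wu * Zu ^ 2 by rw [rel_PX]; group] at this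
  have h3 : Zu ^ 2 ∈ KK j (A ∩ B) := by
    have := mul_mem (inv_mem hW) h2
    rwa [inv_mul_cancel_left] at this
  have h4 : (Zu ^ 2)⁻¹ = Zu := by
    rw [inv_eq_iff_mul_eq_one, ← pow_succ, rel_Z]
  rw [← h4]
  exact inv_mem h3

lemma KK_univ (j : Fin m) : Zu ∈ KK j Set.univ := by
  rw [mem_KK]
  have : ind (Set.univ : Set (Rest j)) Zu = (fun _ => Tu) ^ 3 := by
    funext r
    simp [ind, rel_TZ]
  rw [this]
  exact pow_mem (LL_T j) 3

lemma LL_X (j : Fin m) : (fun _ => Xu) ∈ LL j := by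
  have := mem_KK.1 (KK_X (KK_univ j))
  have e : ind (Set.univ : Set (Rest j)) Xu = fun _ => Xu := by
    funext r; simp [ind]
  rwa [e] at this

lemma X_triple (Y : U3) (hY : Y = Xu ∨ Y = Xu ^ 2) :
    Tu * (Y * Tu * Y⁻¹) * (Y⁻¹ * Tu * Y) = 1 := by
  have h3 := rel_X
  have hi : Xu⁻¹ = Xu ^ 2 := by
    rw [inv_eq_iff_mul_eq_one, ← pow_succ', h3]
  have hi2 : (Xu ^ 2)⁻¹ = Xu := by rw [← hi, inv_inv]
  have hx : Xu ^ 2 * Xu ^ 2 = Xu := by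
    rw [← pow_add, show 2 + 2 = 3 + 1 from rfl, pow_succ, h3, one_mul]
  have h1 := rel_TX
  rcases hY with rfl | rfl
  · rw [hi]
    calc Tu * (Xu * Tu * Xu ^ 2) * (Xu ^ 2 * Tu * Xu)
        = Tu * Xu * Tu * (Xu ^ 2 * Xu ^ 2) * Tu * Xu := by simp only [mul_assoc]
      _ = 1 := by rw [hx, h1]
  · rw [hi2]
    have h5 : Tu * Xu * Tu * Xu * Tu = Xu⁻¹ := eq_inv_of_mul_eq_one_left h1
    have h6 : Xu * Tu * Xu * Tu = Tu⁻¹ * Xu⁻¹ := by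
      rw [← h5]; group
    have h7 : Xu * Tu * Xu * Tu * Xu * Tu = 1 := by
      have : Tu * (Xu * Tu * Xu * Tu * Xu * Tu) * Tu⁻¹ = 1 := by
        rw [← h1]; group
      have h8 := congrArg (fun a => Tu⁻¹ * a * Tu) this
      simpa [mul_assoc] using h8
    have comm : ∀ a b : U3, a * b = 1 → b * a = 1 := fun a b h => by
      rw [mul_eq_one_iff_eq_inv.1 h]; simp
    -- T X² T X X T X² is the product T (X² T X) (X T X²)
    have hD : Tu * (Xu ^ 2 * Tu * Xu) = (Xu ^ 2 * Tu * Xu) * Tu := by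
      apply Subtype.ext
      have hz := zeta_min
      simp only [pow_succ, pow_zero, one_mul, Submonoid.coe_mul, Tu, Xu]
      rw [T3, X3, zeta_inv]
      ext i j
      fin_cases i <;> fin_cases j <;>
        simp [Matrix.mul_apply, Fin.sum_univ_three] <;> grind
    rw [hD]
    calc Xu ^ 2 * Tu * Xu * Tu * (Xu * Tu * Xu ^ 2)
        = Xu ^ 2 * (Tu * Xu * Tu * Xu * Tu) * Xu ^ 2 := by simp only [mul_assoc]
      _ = 1 := by rw [h5, hi, hx, ← pow_succ', h3]

lemma KK_coord (j : Fin m) (i : {i : Fin m // i ≠ j}) (c : Fin 3) :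
    Zu ∈ KK j {r | r i = c} := by
  rw [mem_KK]
  have hX := LL_X j
  have hT := LL_T j
  have hY := mul_mem (LL_CX j i) (inv_mem (pow_mem hX (c : ℕ)))
  set Y : Rest j → U3 := (fun r : Rest j => Xu ^ (r i : ℕ)) * ((fun _ => Xu) ^ (c : ℕ))⁻¹ with hYdef
  have := mul_mem (mul_mem hT (mul_mem (mul_mem hY hT) (inv_mem hY)))
    (mul_mem (mul_mem (inv_mem hY) hT) hY)
  convert this using 1
  funext r
  have h3 := rel_X
  have hi : Xu⁻¹ = Xu ^ 2 := by
    rw [inv_eq_iff_mul_eq_one, ← pow_succ', h3]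
  have hi2 : (Xu ^ 2)⁻¹ = Xu := by rw [← hi, inv_inv]
  have hYr : Y r = Xu ^ (r i : ℕ) * (Xu ^ (c : ℕ))⁻¹ := by simp [hYdef]
  by_cases hr : r i = c
  · have : Y r = 1 := by rw [hYr, hr, mul_inv_cancel]
    simp only [ind, Set.mem_ofPred_eq, hr, if_true, Pi.mul_apply, Pi.inv_apply, this]
    rw [← rel_TZ]; simp [pow_succ, mul_assoc]
  · have h : Y r = Xu ∨ Y r = Xu ^ 2 := by
      rw [hYr]
      have hc := c.2
      have ha := (r i).2
      have hne : (r i : ℕ) ≠ c := fun h => hr (Fin.ext h)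
      have e : (Xu ^ (c : ℕ))⁻¹ = Xu ^ (3 - (c : ℕ)) := by
        apply inv_eq_of_mul_eq_one_right
        rw [← pow_add, Nat.add_sub_cancel' (by omega), h3]
      rw [e, ← pow_add, pow_eq_pow_mod _ h3]
      have : ((r i : ℕ) + (3 - (c : ℕ))) % 3 = 1 ∨ ((r i : ℕ) + (3 - (c : ℕ))) % 3 = 2 := by omega
      rcases this with h | h <;> rw [h]
      · left; exact pow_one _
      · right; rfl
    simp only [ind, Set.mem_ofPred_eq, hr, if_false, Pi.mul_apply, Pi.inv_apply]
    rw [X_triple _ h]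

lemma KK_single (j : Fin m) (r : Rest j) : Zu ∈ KK j {r} := by
  have key : ∀ s : Finset {i : Fin m // i ≠ j}, Zu ∈ KK j {q | ∀ i ∈ s, q i = r i} := by
    intro s
    induction s using Finset.induction_on with
    | empty =>
      convert KK_univ j
      simp
    | insert a s ha ih =>
      convert KK_inter (KK_coord j a (r a)) ih using 2
      ext q
      simp
  convert key Finset.univ using 2
  ext q
  simp [funext_iff]

end Wires

section Ops
set_option linter.unusedSectionVars false
variable {ι : Type*} [DecidableEq ι]

noncomputable def phase (x : ι) (p : ℂ) : Module.End ℂ (ι → ℂ) where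
  toFun v := fun y => if y = x then p * v y else v y
  map_add' u v := by
    funext y
    simp only [Pi.add_apply]
    split_ifs <;> ring
  map_smul' c v := by
    funext y
    simp only [Pi.smul_apply, smul_eq_mul, RingHom.id_apply]
    split_ifs <;> ring

lemma phase_apply (x : ι) (p : ℂ) (v : ι → ℂ) (y : ι) :
    phase x p v y = if y = x then p * v y else v y := rfl

noncomputable def lev (f : Fin 3 → ι) (g : Matrix (Fin 3) (Fin 3) ℂ) :
    Module.End ℂ (ι → ℂ) where
  toFun v := fun y =>
    if y = f 0 then ∑ b, g 0 b * v (f b) else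
    if y = f 1 then ∑ b, g 1 b * v (f b) else
    if y = f 2 then ∑ b, g 2 b * v (f b) else v y
  map_add' u v := by
    funext y
    simp only [Pi.add_apply, Fin.sum_univ_three]
    split_ifs <;> ring
  map_smul' c v := by
    funext y
    simp only [Pi.smul_apply, smul_eq_mul, RingHom.id_apply, Fin.sum_univ_three]
    split_ifs <;> ring

lemma lev_apply {f : Fin 3 → ι} (hf : Function.Injective f) (g : Matrix (Fin 3) (Fin 3) ℂ)
    (v : ι → ℂ) (a : Fin 3) : lev f g v (f a) = ∑ b, g a b * v (f b) := by
  simp only [lev, LinearMap.coe_mk, AddHom.coe_mk, hf.eq_iff]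
  fin_cases a <;> simp

lemma lev_apply_ne {f : Fin 3 → ι} (g : Matrix (Fin 3) (Fin 3) ℂ)
    (v : ι → ℂ) {y : ι} (hy : ∀ a, y ≠ f a) : lev f g v y = v y := by
  simp [lev, hy]

noncomputable def permEnd (σ : Equiv.Perm ι) : Module.End ℂ (ι → ℂ) :=
  LinearMap.funLeft ℂ ℂ σ.symm

lemma permEnd_apply (σ : Equiv.Perm ι) (v : ι → ℂ) (y : ι) : permEnd σ v y = v (σ.symm y) := rfl

lemma permEnd_mul (σ τ : Equiv.Perm ι) : permEnd (σ * τ) = permEnd σ * permEnd τ := by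
  ext; rfl

lemma permEnd_one : permEnd (1 : Equiv.Perm ι) = 1 := by
  ext; rfl

lemma lev_conj (σ : Equiv.Perm ι) {f : Fin 3 → ι} (hf : Function.Injective f)
    (g : Matrix (Fin 3) (Fin 3) ℂ) :
    lev (σ ∘ f) g = permEnd σ * lev f g * permEnd σ⁻¹ := by
  apply LinearMap.ext; intro v
  funext y
  simp only [Module.End.mul_apply, permEnd_apply]
  by_cases h : ∃ a, y = σ (f a)
  · obtain ⟨a, rfl⟩ := h
    have := lev_apply (σ.injective.comp hf) g v a
    simp only [Function.comp_apply] at this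
    rw [this, Equiv.symm_apply_apply, lev_apply hf]
    rfl
  · push Not at h
    rw [lev_apply_ne (f := σ ∘ f) g v (fun a => by simpa using h a), lev_apply_ne]
    · exact congrArg v (Equiv.apply_symm_apply σ y).symm
    · intro a ha
      exact h a (by rw [← ha, Equiv.apply_symm_apply])

end Ops

section Rep

noncomputable def w0 : Fin 3 → ℂ := fun b => if b = 0 then 1 else 0

noncomputable def anc {n : ℕ} (v : (Fin n → Fin 3) → ℂ) : (Fin (n + 1) → Fin 3) → ℂ :=
  fun x => v (Fin.init x) * w0 (x (Fin.last n))

noncomputable def Rep (n : ℕ) : Submonoid (Module.End ℂ ((Fin n → Fin 3) → ℂ)) where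
  carrier := {F | ∃ W ∈ CliffordT (n + 1), ∀ v,
    (W : Matrix (Fin (n + 1) → Fin 3) (Fin (n + 1) → Fin 3) ℂ).mulVec (anc v) = anc (F v)}
  one_mem' := ⟨1, one_mem _, fun v => by simp⟩
  mul_mem' := by
    rintro F G ⟨W, hW, h⟩ ⟨W', hW', h'⟩
    refine ⟨W * W', mul_mem hW hW', fun v => ?_⟩
    rw [Submonoid.coe_mul, ← Matrix.mulVec_mulVec, h', h]
    rfl

noncomputable def GG (m : ℕ) : Subgroup U3 := ⨅ (j : Fin m), ⨅ (r : Rest j), KK j {r}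

lemma mem_GG {m : ℕ} {g : U3} : g ∈ GG m ↔ ∀ (j : Fin m) (r : Rest j), g ∈ KK j {r} := by
  simp [GG, Subgroup.mem_iInf]

lemma GG_H (m : ℕ) : Hu ∈ GG m := mem_GG.2 fun j r => KK_H (KK_single j r)
lemma GG_X (m : ℕ) : Xu ∈ GG m := mem_GG.2 fun j r => KK_X (KK_single j r)
lemma GG_Z (m : ℕ) : Zu ∈ GG m := mem_GG.2 fun j r => KK_single j r
lemma GG_W (m : ℕ) : Wu ∈ GG m := by
  have : Wu = Zu * Xu * Zu⁻¹ * Xu⁻¹ := by rw [rel_ZX]; group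
  rw [this]
  exact mul_mem (mul_mem (mul_mem (GG_Z m) (GG_X m)) (inv_mem (GG_Z m))) (inv_mem (GG_X m))

lemma ind_coe {m : ℕ} {j : Fin m} (r q : Rest j) (g : U3) (a b : Fin 3) :
    ((ind {r} g q : U3) : Matrix (Fin 3) (Fin 3) ℂ) a b =
      if q = r then (g : Matrix (Fin 3) (Fin 3) ℂ) a b else if a = b then 1 else 0 := by
  by_cases h : q = r
  · simp [ind, h]
  · simp [ind, h, Matrix.one_apply]

lemma Rep_phase {n : ℕ} (x : Fin n → Fin 3) {g : U3} (hg : g ∈ GG (n + 1)) (p : ℂ)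
    (hp : ∀ a, (g : Matrix (Fin 3) (Fin 3) ℂ) a 0 = if a = 0 then p else 0) :
    phase x p ∈ Rep n := by
  set r : Rest (Fin.last n) := rst (Fin.last n) (Fin.snoc x 0 : Fin (n + 1) → Fin 3)
  refine ⟨phi (Fin.last n) (ind {r} g), mem_GG.1 hg _ _, fun v => ?_⟩
  funext y
  rw [phi_mulVec]
  have hr : rst (Fin.last n) y = r ↔ Fin.init y = x := by
    rw [rst_eq_iff]
    constructor
    · intro h
      funext i
      have := h i.castSucc (Fin.castSucc_ne_last i)
      simpa [Fin.init] using this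
    · intro h i hi
      obtain ⟨k, rfl⟩ := Fin.exists_castSucc_eq.2 hi
      simp [← h, Fin.init]
  simp only [anc, Fin.init_update_last, Function.update_self, ind_coe, phase_apply, hr]
  rw [Fin.sum_univ_three]
  by_cases h : Fin.init y = x
  · simp only [h, if_true, hp, w0]
    by_cases h2 : y (Fin.last n) = 0 <;> simp [h2]
  · simp only [h, if_false, w0]
    by_cases h2 : y (Fin.last n) = 0 <;> simp [h2]

lemma H3_entries : H3 = (-(1 + 2 * ω) / 3) • !![1, 1, 1; 1, ω, ω ^ 2; 1, ω ^ 2, ω] := by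
  rw [H3, h_scal]

lemma HH : ((Hu * Hu : U3) : Matrix (Fin 3) (Fin 3) ℂ) = !![-1, 0, 0; 0, 0, -1; 0, -1, 0] := by
  have hz := omega_quad
  rw [Submonoid.coe_mul]
  show H3 * H3 = _
  rw [H3_entries]
  ext i j
  fin_cases i <;> fin_cases j <;>
    simp [Matrix.mul_apply, Fin.sum_univ_three] <;> grind

lemma Rep_neg {n : ℕ} (x : Fin n → Fin 3) : phase x (-1) ∈ Rep n := by
  apply Rep_phase x (mul_mem (GG_H _) (GG_H _))
  rw [HH]
  intro a
  fin_cases a <;> simp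

lemma Rep_omega {n : ℕ} (x : Fin n → Fin 3) : phase x ω ∈ Rep n := by
  apply Rep_phase x (GG_W _)
  intro a
  fin_cases a <;> simp [Wu, W3]

lemma line_inj {n : ℕ} (x : Fin n → Fin 3) (j : Fin n) :
    Function.Injective (fun b => Function.update x j b) := Function.update_injective x j

lemma Rep_line {n : ℕ} (x : Fin n → Fin 3) (j : Fin n) {g : U3} (hg : g ∈ GG (n + 1)) :
    lev (fun b => Function.update x j b) g ∈ Rep n := by
  set r : Rest j.castSucc := rst j.castSucc (Fin.snoc x 0 : Fin (n + 1) → Fin 3) with hrdef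
  refine ⟨phi j.castSucc (ind {r} g), mem_GG.1 hg _ _, fun v => ?_⟩
  funext y
  rw [phi_mulVec]
  have hlast : ∀ b, Function.update y j.castSucc b (Fin.last n) = y (Fin.last n) := fun b =>
    Function.update_of_ne (Fin.castSucc_ne_last j).symm _ _
  simp only [anc, Fin.init_update_castSucc, ind_coe, hlast]
  by_cases h0 : y (Fin.last n) = 0
  swap
  · simp [w0, h0]
  have hr : rst j.castSucc y = r ↔ ∃ a, Fin.init y = Function.update x j a := by
    rw [hrdef, rst_eq_iff]
    constructor
    · intro h
      refine ⟨y j.castSucc, ?_⟩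
      funext i
      by_cases hi : i = j
      · subst hi; simp [Fin.init]
      · have := h i.castSucc (fun h => hi (Fin.castSucc_injective _ h))
        simpa [Fin.init, hi] using this
    · rintro ⟨a, ha⟩ i hi
      by_cases hl : i = Fin.last n
      · subst hl; simp [h0]
      · obtain ⟨k, rfl⟩ := Fin.exists_castSucc_eq.2 hl
        have hk : k ≠ j := fun h => hi (by rw [h])
        have := congrFun ha k
        simpa [Fin.init, hk] using this
  by_cases h : ∃ a, Fin.init y = Function.update x j a
  · have hq := hr.2 h
    obtain ⟨a, ha⟩ := h
    have hya : y j.castSucc = a := by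
      have := congrFun ha j
      simpa [Fin.init] using this
    have e := lev_apply (line_inj x j) (g : Matrix (Fin 3) (Fin 3) ℂ) v a
    rw [ha]
    refine Eq.trans ?_ (congrArg (fun t => t * w0 (y (Fin.last n))) e.symm)
    simp [hq, hya, w0, h0]
  · have hq : ¬ rst j.castSucc y = r := fun hh => h (hr.1 hh)
    push Not at h
    rw [lev_apply_ne _ _ h]
    have : Function.update (Fin.init y) j (y j.castSucc) = Fin.init y := by
      have : y j.castSucc = Fin.init y j := rfl
      rw [this, Function.update_eq_self]
    simp [hq, w0, h0, this]

lemma exists_neg_swap (m : ℕ) (a b : Fin 3) (hab : a ≠ b) : ∃ g ∈ GG m, ∀ u w,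
    (g : Matrix (Fin 3) (Fin 3) ℂ) u w = if w = Equiv.swap a b u then -1 else 0 := by
  have hX := GG_X m
  have hH := mul_mem (GG_H m) (GG_H m)
  have k0 : ∃ g ∈ GG m, (g : Matrix (Fin 3) (Fin 3) ℂ) =
      !![-1, 0, 0; 0, 0, -1; 0, -1, 0] := ⟨_, hH, HH⟩
  have k2 : ∃ g ∈ GG m, (g : Matrix (Fin 3) (Fin 3) ℂ) =
      !![0, -1, 0; -1, 0, 0; 0, 0, -1] := by
    refine ⟨Xu * Xu * (Hu * Hu) * Xu, mul_mem (mul_mem (mul_mem hX hX) hH) hX, ?_⟩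
    have : ((Xu * Xu * (Hu * Hu) * Xu : U3) : Matrix (Fin 3) (Fin 3) ℂ) =
      X3 * X3 * ((Hu * Hu : U3) : Matrix (Fin 3) (Fin 3) ℂ) * X3 := rfl
    rw [this, HH]
    ext i j
    fin_cases i <;> fin_cases j <;>
      simp [X3, Matrix.mul_apply, Fin.sum_univ_three]
  have k1 : ∃ g ∈ GG m, (g : Matrix (Fin 3) (Fin 3) ℂ) =
      !![0, 0, -1; 0, -1, 0; -1, 0, 0] := by
    refine ⟨Xu * (Hu * Hu) * Xu * Xu, mul_mem (mul_mem (mul_mem hX hH) hX) hX, ?_⟩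
    have : ((Xu * (Hu * Hu) * Xu * Xu : U3) : Matrix (Fin 3) (Fin 3) ℂ) =
      X3 * ((Hu * Hu : U3) : Matrix (Fin 3) (Fin 3) ℂ) * X3 * X3 := rfl
    rw [this, HH]
    ext i j
    fin_cases i <;> fin_cases j <;>
      simp [X3, Matrix.mul_apply, Fin.sum_univ_three]
  have q0 : ∀ u w : Fin 3, (!![-1, 0, 0; 0, 0, -1; 0, -1, 0] : Matrix (Fin 3) (Fin 3) ℂ) u w =
      if w = Equiv.swap 1 2 u then -1 else 0 := by
    intro u w
    fin_cases u <;> fin_cases w <;> simp [Equiv.swap_apply_def]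
  have q1 : ∀ u w : Fin 3, (!![0, 0, -1; 0, -1, 0; -1, 0, 0] : Matrix (Fin 3) (Fin 3) ℂ) u w =
      if w = Equiv.swap 0 2 u then -1 else 0 := by
    intro u w
    fin_cases u <;> fin_cases w <;> simp [Equiv.swap_apply_def]
  have q2 : ∀ u w : Fin 3, (!![0, -1, 0; -1, 0, 0; 0, 0, -1] : Matrix (Fin 3) (Fin 3) ℂ) u w =
      if w = Equiv.swap 0 1 u then -1 else 0 := by
    intro u w
    fin_cases u <;> fin_cases w <;> simp [Equiv.swap_apply_def]
  obtain ⟨g0, h0, e0⟩ := k0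
  obtain ⟨g1, h1, e1⟩ := k1
  obtain ⟨g2, h2, e2⟩ := k2
  have c : Equiv.swap a b = Equiv.swap 1 2 ∨ Equiv.swap a b = Equiv.swap 0 2 ∨
      Equiv.swap a b = Equiv.swap 0 1 := by
    revert a b; decide
  rcases c with c | c | c
  · exact ⟨g0, h0, fun u w => by rw [e0, c, q0]⟩
  · exact ⟨g1, h1, fun u w => by rw [e1, c, q1]⟩
  · exact ⟨g2, h2, fun u w => by rw [e2, c, q2]⟩

lemma Rep_adj {n : ℕ} (x : Fin n → Fin 3) (j : Fin n) (b : Fin 3) :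
    permEnd (Equiv.swap x (Function.update x j b)) ∈ Rep n := by
  by_cases hab : x j = b
  · subst hab
    rw [Function.update_eq_self, Equiv.swap_self]
    have := permEnd_one (ι := Fin n → Fin 3)
    rw [Equiv.Perm.one_def] at this
    rw [this]; exact one_mem _
  obtain ⟨g, hg, hgu⟩ := exists_neg_swap (n + 1) (x j) b hab
  set f : Fin 3 → (Fin n → Fin 3) := fun b => Function.update x j b with hf
  have hinj : Function.Injective f := line_inj x j
  have e : permEnd (Equiv.swap x (Function.update x j b)) =
      phase (f 0) (-1) * phase (f 1) (-1) * phase (f 2) (-1) * lev f g := by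
    apply LinearMap.ext; intro v
    funext y
    have hx : x = f (x j) := by simp [hf]
    have hs : Equiv.swap x (Function.update x j b) = Equiv.swap (f (x j)) (f b) := by rw [← hx]
    rw [hs]
    simp only [Module.End.mul_apply, permEnd_apply, phase_apply, Equiv.symm_swap]
    by_cases h : ∃ a, y = f a
    · obtain ⟨a, rfl⟩ := h
      rw [lev_apply hinj, hinj.swap_apply]
      simp only [hgu, ite_mul, zero_mul, Finset.sum_ite_eq', Finset.mem_univ, if_true,
        hinj.eq_iff]
      fin_cases a <;> simp
    · push Not at h
      rw [lev_apply_ne _ _ h, Equiv.swap_apply_of_ne_of_ne (h _) (h _)]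
      simp [h]
  rw [e]
  exact mul_mem (mul_mem (mul_mem (Rep_neg _) (Rep_neg _)) (Rep_neg _)) (Rep_line x j hg)

lemma Rep_swap {n : ℕ} (x y : Fin n → Fin 3) : permEnd (Equiv.swap x y) ∈ Rep n := by
  have key : ∀ s : Finset (Fin n), permEnd (Equiv.swap x (s.piecewise y x)) ∈ Rep n := by
    intro s
    induction s using Finset.induction_on with
    | empty =>
      rw [Finset.piecewise_empty, Equiv.swap_self]
      have := permEnd_one (ι := Fin n → Fin 3)
      rw [Equiv.Perm.one_def] at this
      rw [this]; exact one_mem _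
    | insert a s ha ih =>
      rw [Finset.piecewise_insert]
      set z := s.piecewise y x
      have h2 := Rep_adj z a (y a)
      set t := Function.update z a (y a)
      by_cases h1 : x = t
      · rw [← h1, Equiv.swap_self]
        have := permEnd_one (ι := Fin n → Fin 3)
        rw [Equiv.Perm.one_def] at this
        rw [this]; exact one_mem _
      by_cases h3 : x = z
      · rw [h3]; exact h2
      have h4 : Equiv.swap x t = Equiv.swap z t * Equiv.swap x z * Equiv.swap z t := by
        rw [Equiv.swap_comm x t]
        exact (Equiv.swap_mul_swap_mul_swap h3 h1).symm
      rw [h4, permEnd_mul, permEnd_mul]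
      exact mul_mem (mul_mem h2 ih) h2
  have := key Finset.univ
  rwa [Finset.piecewise_univ] at this

lemma Rep_perm {n : ℕ} (σ : Equiv.Perm (Fin n → Fin 3)) : permEnd σ ∈ Rep n := by
  induction σ using Equiv.Perm.swap_induction_on with
  | one => rw [permEnd_one]; exact one_mem _
  | swap_mul f x y _ ih => rw [permEnd_mul]; exact mul_mem (Rep_swap x y) ih

lemma exists_perm_comp {α : Type*} (f0 f : Fin 3 → α) (hf0 : Function.Injective f0)
    (hf : Function.Injective f) : ∃ σ : Equiv.Perm α, f = σ ∘ f0 := by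
  have := Equiv.Perm.isMultiplyPretransitive α 3
  obtain ⟨σ, hσ⟩ := MulAction.exists_smul_eq (Equiv.Perm α)
    (⟨f0, hf0⟩ : Fin 3 ↪ α) ⟨f, hf⟩
  refine ⟨σ, ?_⟩
  funext a
  have := congrArg (fun (h : Fin 3 ↪ α) => h a) hσ
  simpa using this.symm

lemma Rep_lev {n : ℕ} (hn : 1 ≤ n) (f : Fin 3 → (Fin n → Fin 3)) (hf : Function.Injective f) :
    lev f H3 ∈ Rep n := by
  obtain ⟨σ, e⟩ := exists_perm_comp _ f (line_inj (0 : Fin n → Fin 3) ⟨0, hn⟩) hf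
  have hH : (Hu : Matrix (Fin 3) (Fin 3) ℂ) = H3 := rfl
  have h1 := Rep_line (0 : Fin n → Fin 3) ⟨0, hn⟩ (GG_H (n + 1))
  rw [hH] at h1
  rw [e, lev_conj σ (line_inj (0 : Fin n → Fin 3) ⟨0, hn⟩)]
  exact (Rep n).mul_mem ((Rep n).mul_mem (Rep_perm σ) h1) (Rep_perm σ⁻¹)

lemma anc_inner {n : ℕ} (u v : (Fin n → Fin 3) → ℂ) :
    star (anc u) ⬝ᵥ anc v = star u ⬝ᵥ v := by
  simp only [dotProduct, anc, Pi.star_apply]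
  rw [← (Fin.snocEquiv (fun _ => Fin 3)).sum_comp, Fintype.sum_prod_type, Fin.sum_univ_three]
  simp [w0, Fin.snocEquiv]

lemma Rep_inner {n : ℕ} {F : Module.End ℂ ((Fin n → Fin 3) → ℂ)} (hF : F ∈ Rep n)
    (u v : (Fin n → Fin 3) → ℂ) : star (F u) ⬝ᵥ F v = star u ⬝ᵥ v := by
  obtain ⟨W, _, h⟩ := hF
  rw [← anc_inner, ← h, ← h, Matrix.star_mulVec, Matrix.dotProduct_mulVec, Matrix.vecMul_vecMul,
    ← Matrix.star_eq_conjTranspose, Matrix.mem_unitaryGroup_iff'.1 W.2, Matrix.vecMul_one,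
    anc_inner]

end Rep

section Arith

lemma omega_sq : ω ^ 2 = -1 - ω := by
  have := omega_quad
  linear_combination this

noncomputable def th : ℂ := 1 + 2 * ω

lemma th_sq : th ^ 2 = -3 := by
  have := omega_sq
  unfold th
  linear_combination 4 * this

lemma th_ne : th ≠ 0 := by
  intro h
  have := th_sq
  rw [h] at this
  norm_num at this

lemma star_omega : star ω = -1 - ω := by
  rw [← omega_sq]; exact conj_omega

lemma star_th : star th * th = 3 := by
  have h : star th = - th := by
    unfold th
    rw [star_add, star_mul', star_omega, star_one, star_ofNat]
    ring
  rw [h]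
  linear_combination -th_sq

noncomputable def OO : Subring ℂ where
  carrier := {z | ∃ a b : ℤ, z = a + b * ω}
  zero_mem' := ⟨0, 0, by simp⟩
  one_mem' := ⟨1, 0, by simp⟩
  add_mem' := by
    rintro _ _ ⟨a, b, rfl⟩ ⟨c, d, rfl⟩
    exact ⟨a + c, b + d, by push_cast; ring⟩
  neg_mem' := by
    rintro _ ⟨a, b, rfl⟩
    exact ⟨-a, -b, by push_cast; ring⟩
  mul_mem' := by
    rintro _ _ ⟨a, b, rfl⟩ ⟨c, d, rfl⟩
    exact ⟨a * c - b * d, a * d + b * c - b * d, by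
      push_cast; linear_combination (b : ℂ) * d * omega_sq⟩

lemma mem_OO {z : ℂ} : z ∈ OO ↔ ∃ a b : ℤ, z = a + b * ω := Iff.rfl

lemma OO_omega : ω ∈ OO := ⟨0, 1, by simp⟩
lemma OO_th : th ∈ OO := ⟨1, 2, by simp [th]⟩

def Dv (z : ℂ) : Prop := ∃ z' ∈ OO, z = th * z'

lemma Dv_OO {z : ℂ} (h : Dv z) : z ∈ OO := by
  obtain ⟨z', hz', rfl⟩ := h
  exact mul_mem OO_th hz'

noncomputable def UU : Submonoid ℂ := Submonoid.closure {-1, ω}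

lemma UU_neg : (-1 : ℂ) ∈ UU := Submonoid.subset_closure (by simp)
lemma UU_omega : ω ∈ UU := Submonoid.subset_closure (by simp)

lemma star_norm (a b : ℤ) : star ((a : ℂ) + b * ω) * (a + b * ω) =
    ((a ^ 2 - a * b + b ^ 2 : ℤ) : ℂ) := by
  have h1 : star ((a : ℂ) + b * ω) = a + b * (-1 - ω) := by
    rw [star_add, star_mul', star_omega]
    simp
  rw [h1]
  push_cast
  linear_combination -(b : ℂ) ^ 2 * omega_sq

lemma dichotomy {z : ℂ} (hz : z ∈ OO) :
    (Dv z ∧ ∃ N : ℤ, star z * z = N ∧ N % 3 = 0) ∨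
    (¬ Dv z ∧ (∃ p ∈ UU, ∃ z' ∈ OO, p * z = 1 + 3 * z') ∧
      ∃ N : ℤ, star z * z = N ∧ N % 3 = 1) := by
  obtain ⟨a, b, rfl⟩ := hz
  by_cases h : (a + b) % 3 = 0
  · left
    obtain ⟨k, hk⟩ := Int.dvd_of_emod_eq_zero h
    have hk' : (a : ℂ) = 3 * k - b := by
      have : a = 3 * k - b := by linarith
      rw [this]; push_cast; ring
    refine ⟨⟨-k * th - b * (-1 - ω), ?_, ?_⟩, _, star_norm a b, ?_⟩
    · refine ⟨-k + b, -2 * k + b, ?_⟩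
      unfold th; push_cast; ring
    · rw [hk']
      have := th_sq
      unfold th at *
      linear_combination (k : ℂ) * this - 2 * (b : ℂ) * omega_sq
    · have : a = 3 * k - b := by linarith
      subst this
      have : (3 * k - b) ^ 2 - (3 * k - b) * b + b ^ 2 = 3 * (3 * k ^ 2 - 3 * k * b + b ^ 2) := by
        ring
      rw [this]; simp
  · right
    have hN : (a ^ 2 - a * b + b ^ 2) % 3 = 1 := by
      have ha : a % 3 = 0 ∨ a % 3 = 1 ∨ a % 3 = 2 := by omega
      have hb : b % 3 = 0 ∨ b % 3 = 1 ∨ b % 3 = 2 := by omega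
      rcases ha with ha | ha | ha <;> rcases hb with hb | hb | hb <;>
        first
          | (exfalso; omega)
          | simp [Int.sub_emod, Int.add_emod, Int.mul_emod, pow_two, ha, hb]
    refine ⟨?_, ?_, _, star_norm a b, hN⟩
    · rintro ⟨_, ⟨c, d, rfl⟩, e⟩
      have e1 := star_norm a b
      rw [e, star_mul'] at e1
      have e2 : star th * star ((c : ℂ) + d * ω) * (th * (c + d * ω)) =
        (star th * th) * (star ((c : ℂ) + d * ω) * (c + d * ω)) := by ring
      rw [e2, star_th, star_norm] at e1
      have e3 : 3 * (c ^ 2 - c * d + d ^ 2) = a ^ 2 - a * b + b ^ 2 := by exact_mod_cast e1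
      omega
    · have hq := omega_sq
      have c : (a % 3 = 1 ∧ b % 3 = 0) ∨ (a % 3 = 2 ∧ b % 3 = 0) ∨ (a % 3 = 0 ∧ b % 3 = 1) ∨
        (a % 3 = 0 ∧ b % 3 = 2) ∨ (a % 3 = 1 ∧ b % 3 = 1) ∨ (a % 3 = 2 ∧ b % 3 = 2) := by omega
      have ha := Int.mul_ediv_add_emod a 3
      have hb := Int.mul_ediv_add_emod b 3
      set k := a / 3
      set l := b / 3
      rcases c with ⟨h1, h2⟩ | ⟨h1, h2⟩ | ⟨h1, h2⟩ | ⟨h1, h2⟩ | ⟨h1, h2⟩ | ⟨h1, h2⟩ <;>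
        rw [h1] at ha <;> rw [h2] at hb <;> rw [← ha, ← hb]
      · exact ⟨1, one_mem _, _, ⟨k, l, rfl⟩, by push_cast; ring⟩
      · exact ⟨-1, UU_neg, _, ⟨-k - 1, -l, rfl⟩, by push_cast; ring⟩
      · exact ⟨ω ^ 2, pow_mem UU_omega 2, _, ⟨-k + l, -k, rfl⟩, by
          push_cast; rw [hq]; linear_combination -(3 * l + 1 : ℂ) * hq⟩
      · exact ⟨-1 * ω ^ 2, mul_mem UU_neg (pow_mem UU_omega 2), _, ⟨k - l - 1, k, rfl⟩, by
          push_cast; rw [hq]; linear_combination (3 * l + 2 : ℂ) * hq⟩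
      · exact ⟨-1 * ω, mul_mem UU_neg UU_omega, _, ⟨l, l - k, rfl⟩, by
          push_cast; linear_combination -(3 * l + 1 : ℂ) * hq⟩
      · exact ⟨ω, UU_omega, _, ⟨-l - 1, k - l, rfl⟩, by
          push_cast; linear_combination (3 * l + 2 : ℂ) * hq⟩

lemma norm_one_unit {z : ℂ} (hz : z ∈ OO) (h : star z * z = 1) : ∃ p ∈ UU, p * z = 1 := by
  obtain ⟨a, b, rfl⟩ := hz
  rw [star_norm] at h
  have h' : a ^ 2 - a * b + b ^ 2 = 1 := by exact_mod_cast h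
  have hq := omega_sq
  have hb1 : b ≤ 1 := by nlinarith [sq_nonneg (2 * a - b)]
  have hb2 : -1 ≤ b := by nlinarith [sq_nonneg (2 * a - b)]
  have ha1 : a ≤ 1 := by nlinarith [sq_nonneg (2 * b - a)]
  have ha2 : -1 ≤ a := by nlinarith [sq_nonneg (2 * b - a)]
  have u2 := pow_mem UU_omega 2
  interval_cases a <;> interval_cases b <;> norm_num at h' <;> push_cast
  · exact ⟨ω, UU_omega, by linear_combination -hq⟩
  · exact ⟨-1, UU_neg, by ring⟩
  · exact ⟨-1 * ω ^ 2, mul_mem UU_neg u2, by rw [hq]; linear_combination -hq⟩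
  · exact ⟨ω ^ 2, u2, by rw [hq]; linear_combination -hq⟩
  · exact ⟨1, one_mem _, by ring⟩
  · exact ⟨-1 * ω, mul_mem UU_neg UU_omega, by linear_combination -hq⟩

lemma nonneg_norm {z : ℂ} {N : ℤ} (h : star z * z = N) : 0 ≤ N ∧ (N = 0 → z = 0) := by
  have e : star z * z = ((Complex.normSq z : ℝ) : ℂ) := by
    rw [mul_comm]; exact Complex.mul_conj z
  rw [e] at h
  have h' : Complex.normSq z = (N : ℝ) := by exact_mod_cast h
  constructor
  · have := Complex.normSq_nonneg z
    rw [h'] at this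
    exact_mod_cast this
  · intro h0
    rw [h0] at h'
    exact Complex.normSq_eq_zero.1 (by simpa using h')

def RR (r : ℂ) : Prop := ∃ k : ℕ, th ^ k * r ∈ OO

lemma RR_mono {r : ℂ} {k l : ℕ} (hkl : k ≤ l) (h : th ^ k * r ∈ OO) : th ^ l * r ∈ OO := by
  obtain ⟨m, rfl⟩ := Nat.exists_eq_add_of_le hkl
  rw [add_comm, pow_add, mul_assoc]
  exact mul_mem (pow_mem OO_th m) h

lemma RR_OO {r : ℂ} (h : r ∈ OO) : RR r := ⟨0, by simpa using h⟩

lemma RR_add {r s : ℂ} (hr : RR r) (hs : RR s) : RR (r + s) := by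
  obtain ⟨k, hk⟩ := hr
  obtain ⟨l, hl⟩ := hs
  refine ⟨max k l, ?_⟩
  rw [mul_add]
  exact add_mem (RR_mono (le_max_left _ _) hk) (RR_mono (le_max_right _ _) hl)

lemma RR_mul {r s : ℂ} (hr : RR r) (hs : RR s) : RR (r * s) := by
  obtain ⟨k, hk⟩ := hr
  obtain ⟨l, hl⟩ := hs
  refine ⟨k + l, ?_⟩
  have : th ^ (k + l) * (r * s) = (th ^ k * r) * (th ^ l * s) := by rw [pow_add]; ring
  rw [this]
  exact mul_mem hk hl

lemma RR_third : RR (3 : ℂ)⁻¹ := by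
  refine ⟨2, -1, 0, ?_⟩
  rw [th_sq]
  norm_num

lemma RR_closure {r : ℂ} (h : r ∈ Subring.closure {(3 : ℂ)⁻¹, ω}) : RR r := by
  induction h using Subring.closure_induction with
  | mem x hx =>
    rcases hx with rfl | rfl
    · exact RR_third
    · exact RR_OO OO_omega
  | zero => exact RR_OO (zero_mem _)
  | one => exact RR_OO (one_mem _)
  | add x y _ _ hx hy => exact RR_add hx hy
  | neg x _ hx =>
    have := RR_mul (RR_OO (neg_mem (one_mem OO))) hx
    simpa using this
  | mul x y _ _ hx hy => exact RR_mul hx hy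

lemma RR_common {ι : Type*} [Fintype ι] {u : ι → ℂ} (h : ∀ i, RR (u i)) :
    ∃ k : ℕ, ∀ i, th ^ k * u i ∈ OO := by
  choose k hk using h
  exact ⟨Finset.univ.sup k, fun i => RR_mono (Finset.le_sup (Finset.mem_univ i)) (hk i)⟩

lemma H3_th : H3 = (-th / 3) • !![1, 1, 1; 1, ω, ω ^ 2; 1, ω ^ 2, ω] := H3_entries

lemma H3_RR (a b : Fin 3) : RR (H3 a b) := by
  have h1 : RR (-th / 3) := by
    rw [div_eq_mul_inv]
    exact RR_mul (RR_OO (neg_mem OO_th)) RR_third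
  have h2 : (!![1, 1, 1; 1, ω, ω ^ 2; 1, ω ^ 2, ω] : Matrix (Fin 3) (Fin 3) ℂ) a b ∈ OO := by
    have h3 := OO_omega
    have h4 := pow_mem OO_omega 2
    have h5 := one_mem OO
    fin_cases a <;> fin_cases b <;> simp <;> assumption
  rw [H3_th, Matrix.smul_apply, smul_eq_mul]
  exact RR_mul h1 (RR_OO h2)

lemma H3_Dv (a : Fin 3) (z : Fin 3 → ℂ) (hz : ∀ b, z b ∈ OO) :
    Dv (∑ b, H3 a b * (1 + 3 * z b)) := by
  have hq := omega_quad
  have h3 := OO_omega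
  have h4 := pow_mem OO_omega 2
  rw [H3_th, Fin.sum_univ_three]
  fin_cases a
  · refine ⟨-(1 + z 0 + z 1 + z 2), neg_mem (add_mem (add_mem (add_mem (one_mem _) (hz 0)) (hz 1))
      (hz 2)), ?_⟩
    simp
    ring
  · refine ⟨-(z 0 + ω * z 1 + ω ^ 2 * z 2), neg_mem (add_mem (add_mem (hz 0) (mul_mem h3 (hz 1)))
      (mul_mem h4 (hz 2))), ?_⟩
    simp
    linear_combination (-th / 3) * hq
  · refine ⟨-(z 0 + ω ^ 2 * z 1 + ω * z 2), neg_mem (add_mem (add_mem (hz 0) (mul_mem h4 (hz 1)))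
      (mul_mem h3 (hz 2))), ?_⟩
    simp
    linear_combination (-th / 3) * hq

end Arith

section Reduce
variable {n : ℕ}

noncomputable def Good (n : ℕ) (A : Finset (Fin n → Fin 3)) :
    Submonoid (Module.End ℂ ((Fin n → Fin 3) → ℂ)) where
  carrier := {F | F ∈ Rep n ∧ (∀ u, (∀ i, RR (u i)) → ∀ i, RR (F u i)) ∧
    (∀ v, ∀ y, y ∉ A → F v y = v y) ∧ ∀ v, (∀ a ∈ A, v a = 0) → F v = v}
  one_mem' := ⟨one_mem _, fun _ h => h, fun _ _ _ => rfl, fun _ _ => rfl⟩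
  mul_mem' := by
    rintro F G ⟨f1, f2, f3, f4⟩ ⟨g1, g2, g3, g4⟩
    refine ⟨mul_mem f1 g1, fun u h => f2 _ (g2 u h), fun v y hy => ?_, fun v h => ?_⟩
    · rw [Module.End.mul_apply, f3 _ y hy, g3 _ y hy]
    · rw [Module.End.mul_apply, g4 v h, f4 v h]

lemma mem_Good {A : Finset (Fin n → Fin 3)} {F : Module.End ℂ ((Fin n → Fin 3) → ℂ)} :
    F ∈ Good n A ↔ F ∈ Rep n ∧ (∀ u, (∀ i, RR (u i)) → ∀ i, RR (F u i)) ∧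
    (∀ v, ∀ y, y ∉ A → F v y = v y) ∧ ∀ v, (∀ a ∈ A, v a = 0) → F v = v := Iff.rfl

lemma Good_phase_gen {A : Finset (Fin n → Fin 3)} {x : Fin n → Fin 3} (hx : x ∈ A) {p : ℂ}
    (hp : p ∈ OO) (h : phase x p ∈ Rep n) : phase x p ∈ Good n A := by
  refine ⟨h, fun u hu i => ?_, fun v y hy => ?_, fun v hv => ?_⟩
  · rw [phase_apply]
    split_ifs
    · exact RR_mul (RR_OO hp) (hu i)
    · exact hu i
  · rw [phase_apply, if_neg]
    rintro rfl; exact hy hx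
  · funext y
    rw [phase_apply]
    split_ifs with hyx
    · subst hyx; rw [hv _ hx, mul_zero]
    · rfl

lemma Good_phase {A : Finset (Fin n → Fin 3)} {x : Fin n → Fin 3} (hx : x ∈ A) {p : ℂ}
    (hp : p ∈ UU) : phase x p ∈ Good n A := by
  induction hp using Submonoid.closure_induction with
  | mem y hy =>
    rcases hy with rfl | rfl
    · exact Good_phase_gen hx (neg_mem (one_mem _)) (Rep_neg x)
    · exact Good_phase_gen hx OO_omega (Rep_omega x)
  | one =>
    have : phase x 1 = 1 := by
      apply LinearMap.ext; intro v; funext y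
      rw [phase_apply]
      split_ifs <;> simp
    rw [this]; exact one_mem _
  | mul p q _ _ hp hq =>
    have : phase x (p * q) = phase x p * phase x q := by
      apply LinearMap.ext; intro v; funext y
      rw [Module.End.mul_apply, phase_apply, phase_apply, phase_apply]
      split_ifs <;> ring
    rw [this]; exact mul_mem hp hq

lemma Good_swap {A : Finset (Fin n → Fin 3)} {x y : Fin n → Fin 3} (hx : x ∈ A) (hy : y ∈ A) :
    permEnd (Equiv.swap x y) ∈ Good n A := by
  refine ⟨Rep_swap x y, fun u hu i => hu _, fun v z hz => ?_, fun v hv => ?_⟩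
  · rw [permEnd_apply, Equiv.symm_swap, Equiv.swap_apply_of_ne_of_ne]
    · rintro rfl; exact hz hx
    · rintro rfl; exact hz hy
  · funext z
    rw [permEnd_apply, Equiv.symm_swap, Equiv.swap_apply_def]
    split_ifs with h1 h2
    · subst h1; rw [hv _ hx, hv _ hy]
    · subst h2; rw [hv _ hx, hv _ hy]
    · rfl

lemma Good_lev (hn : 1 ≤ n) {A : Finset (Fin n → Fin 3)} {f : Fin 3 → (Fin n → Fin 3)}
    (hf : Function.Injective f) (hA : ∀ a, f a ∈ A) : lev f H3 ∈ Good n A := by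
  refine ⟨Rep_lev hn f hf, fun u hu i => ?_, fun v y hy => ?_, fun v hv => ?_⟩
  · by_cases h : ∃ a, i = f a
    · obtain ⟨a, rfl⟩ := h
      rw [lev_apply hf, Fin.sum_univ_three]
      exact RR_add (RR_add (RR_mul (H3_RR _ _) (hu _)) (RR_mul (H3_RR _ _) (hu _)))
        (RR_mul (H3_RR _ _) (hu _))
    · push Not at h
      rw [lev_apply_ne _ _ h]; exact hu i
  · apply lev_apply_ne
    rintro a rfl
    exact hy (hA a)
  · funext y
    by_cases h : ∃ a, y = f a
    · obtain ⟨a, rfl⟩ := h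
      rw [lev_apply hf, hv _ (hA a)]
      apply Finset.sum_eq_zero
      intro b _
      rw [hv _ (hA b), mul_zero]
    · push Not at h
      rw [lev_apply_ne _ _ h]

lemma column_zero {A : Finset (Fin n → Fin 3)} {x0 : Fin n → Fin 3} (hx0 : x0 ∈ A)
    (u : (Fin n → Fin 3) → ℂ) (hs : ∀ y, y ∉ A → u y = 0) (hu : ∀ i, u i ∈ OO)
    (h1 : star u ⬝ᵥ u = 1) : ∃ V ∈ Good n A, V u = Pi.single x0 1 := by
  have hN : ∀ i, ∃ N : ℤ, star (u i) * u i = N := by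
    intro i
    obtain ⟨a, b, e⟩ := hu i
    rw [e]
    exact ⟨_, star_norm a b⟩
  choose N hN using hN
  have hsum : ∑ i, N i = 1 := by
    have : ((∑ i, N i : ℤ) : ℂ) = 1 := by
      rw [← h1, Int.cast_sum]
      exact Finset.sum_congr rfl fun i _ => (hN i).symm
    exact_mod_cast this
  have hex : ∃ i, N i ≠ 0 := by
    by_contra hcon
    push Not at hcon
    rw [Finset.sum_eq_zero (fun i _ => hcon i)] at hsum
    exact zero_ne_one hsum
  obtain ⟨i, hi⟩ := hex
  have hpos : 0 ≤ N i := (nonneg_norm (hN i)).1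
  have hrest : 0 ≤ ∑ j ∈ Finset.univ.erase i, N j :=
    Finset.sum_nonneg fun j _ => (nonneg_norm (hN j)).1
  have hsplit := Finset.add_sum_erase Finset.univ N (Finset.mem_univ i)
  rw [hsum] at hsplit
  have hNi : N i = 1 := by omega
  have hr0 : ∑ j ∈ Finset.univ.erase i, N j = 0 := by omega
  have hz : ∀ j, j ≠ i → u j = 0 := by
    intro j hj
    have := (Finset.sum_eq_zero_iff_of_nonneg
      (fun j _ => (nonneg_norm (hN j)).1)).1 hr0 j (Finset.mem_erase.2 ⟨hj, Finset.mem_univ j⟩)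
    exact (nonneg_norm (hN j)).2 this
  have hiA : i ∈ A := by
    by_contra hcon
    have h0 := hs i hcon
    have := hN i
    rw [h0, hNi] at this
    norm_num at this
  obtain ⟨p, hp, hpu⟩ := norm_one_unit (hu i) (by rw [hN i, hNi]; simp)
  refine ⟨permEnd (Equiv.swap i x0) * phase i p, mul_mem (Good_swap hiA hx0) (Good_phase hiA hp), ?_⟩
  funext y
  rw [Module.End.mul_apply, permEnd_apply, Equiv.symm_swap, phase_apply]
  by_cases hy : y = x0
  · subst hy
    rw [Equiv.swap_apply_right, if_pos rfl, hpu, Pi.single_eq_same]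
  · have : Equiv.swap i x0 y ≠ i := by
      intro h
      apply hy
      have := congrArg (Equiv.swap i x0) h
      rwa [Equiv.swap_apply_self, Equiv.swap_apply_left] at this
    rw [if_neg this, Pi.single_eq_of_ne hy, hz _ this]

open Classical in
lemma column_step (hn : 1 ≤ n) {A : Finset (Fin n → Fin 3)} (k : ℕ)
    (u : (Fin n → Fin 3) → ℂ) (hs : ∀ y, y ∉ A → u y = 0)
    (hu : ∀ i, th ^ (k + 1) * u i ∈ OO)
    (h1 : star u ⬝ᵥ u = 1) (hne : ∃ i, ¬ Dv (th ^ (k + 1) * u i)) :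
    ∃ V ∈ Good n A, (∀ i, th ^ (k + 1) * V u i ∈ OO) ∧
      (Finset.univ.filter fun i => ¬ Dv (th ^ (k + 1) * V u i)).card <
      (Finset.univ.filter fun i => ¬ Dv (th ^ (k + 1) * u i)).card := by
  set s := Finset.univ.filter fun i => ¬ Dv (th ^ (k + 1) * u i) with hsdef
  have hN : ∀ i, ∃ N : ℤ, star (th ^ (k + 1) * u i) * (th ^ (k + 1) * u i) = N ∧
      N % 3 = if i ∈ s then 1 else 0 := by
    intro i
    rcases dichotomy (hu i) with ⟨hd, N, e, h⟩ | ⟨hd, _, N, e, h⟩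
    · exact ⟨N, e, by simp [hsdef, hd, h]⟩
    · exact ⟨N, e, by simp [hsdef, hd, h]⟩
  choose N hN hN3 using hN
  have hsum : ∑ i, N i = 3 ^ (k + 1) := by
    have : ((∑ i, N i : ℤ) : ℂ) = 3 ^ (k + 1) * (star u ⬝ᵥ u) := by
      rw [Int.cast_sum, dotProduct, Finset.mul_sum]
      refine Finset.sum_congr rfl fun i _ => ?_
      rw [← hN i, star_mul', star_pow, ← star_th, mul_pow, Pi.star_apply]
      ring
    rw [h1, mul_one] at this
    exact_mod_cast this
  have hcard : (s.card : ℤ) % 3 = 0 := by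
    have e1 : (∑ i, N i) % 3 = (∑ i, (N i % 3)) % 3 := Finset.sum_int_mod _ _ _
    rw [hsum] at e1
    have e2 : ∑ i, (N i % 3) = s.card := by
      rw [Finset.sum_congr rfl fun i _ => hN3 i]
      simp
    rw [e2] at e1
    rw [← e1, pow_succ]
    simp
  have hpos : 0 < s.card := by
    obtain ⟨i, hi⟩ := hne
    exact Finset.card_pos.2 ⟨i, by simp [hsdef, hi]⟩
  obtain ⟨a, ha, b, hb, c, hc, hab, hac, hbc⟩ := Finset.two_lt_card.1 (show 2 < s.card by omega)
  have hP : ∀ i ∈ s, i ∈ A ∧ ∃ p ∈ UU, ∃ z ∈ OO, p * (th ^ (k + 1) * u i) = 1 + 3 * z := by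
    intro i hi
    have hd : ¬ Dv (th ^ (k + 1) * u i) := by simpa [hsdef] using hi
    constructor
    · by_contra hcon
      apply hd
      rw [hs i hcon]
      exact ⟨0, zero_mem _, by simp⟩
    · rcases dichotomy (hu i) with ⟨hd', _⟩ | ⟨_, h, _⟩
      · exact absurd hd' hd
      · exact h
  obtain ⟨haA, pa, hpa, za, hza, ea⟩ := hP a ha
  obtain ⟨hbA, pb, hpb, zb, hzb, eb⟩ := hP b hb
  obtain ⟨hcA, pc, hpc, zc, hzc, ec⟩ := hP c hc
  set f : Fin 3 → (Fin n → Fin 3) := ![a, b, c] with hf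
  have hinj : Function.Injective f := by
    intro i j hij
    fin_cases i <;> fin_cases j <;>
      simp [hf, hab, hac, hbc, hab.symm, hac.symm, hbc.symm] at hij ⊢
  have hfA : ∀ i, f i ∈ A := by
    intro i; fin_cases i <;> simp [hf] <;> assumption
  set P := phase c pc * phase b pb * phase a pa with hPdef
  have hPG : P ∈ Good n A :=
    mul_mem (mul_mem (Good_phase hcA hpc) (Good_phase hbA hpb)) (Good_phase haA hpa)
  have hPu : ∀ i, th ^ (k + 1) * P u (f i) = 1 + 3 * (![za, zb, zc] : Fin 3 → ℂ) i := by
    intro i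
    simp only [hPdef, Module.End.mul_apply, phase_apply]
    fin_cases i
    · simp [hf, hab, hac]
      linear_combination ea
    · simp [hf, hab, hbc, hab.symm]
      linear_combination eb
    · simp [hf, hac.symm, hbc.symm]
      linear_combination ec
  have hzO : ∀ i, (![za, zb, zc] : Fin 3 → ℂ) i ∈ OO := by
    intro i; fin_cases i <;> simp <;> assumption
  have hV1 : ∀ i, Dv (th ^ (k + 1) * (lev f H3 * P) u (f i)) := by
    intro i
    have := H3_Dv i _ hzO
    convert this using 1
    rw [Module.End.mul_apply, lev_apply hinj, Finset.mul_sum]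
    refine Finset.sum_congr rfl fun j _ => ?_
    rw [← hPu j]; ring
  have hV2 : ∀ y, (∀ i, y ≠ f i) → (lev f H3 * P) u y = u y := by
    intro y hy
    rw [Module.End.mul_apply, lev_apply_ne _ _ hy]
    have h0 := hy 0
    have h1 := hy 1
    have h2 := hy 2
    simp [hf] at h0 h1 h2
    simp [hPdef, Module.End.mul_apply, phase_apply, h0, h1, h2]
  refine ⟨lev f H3 * P, mul_mem (Good_lev hn hinj hfA) hPG, ?_, ?_⟩
  · intro y
    by_cases h : ∃ i, y = f i
    · obtain ⟨i, rfl⟩ := h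
      exact Dv_OO (hV1 i)
    · push Not at h
      rw [hV2 y h]; exact hu y
  · apply Finset.card_lt_card
    refine Finset.ssubset_iff_subset_ne.2 ⟨?_, ?_⟩
    · intro y hy
      rw [Finset.mem_filter] at hy
      by_cases h : ∃ i, y = f i
      · obtain ⟨i, rfl⟩ := h
        exact absurd (hV1 i) hy.2
      · push Not at h
        rw [hV2 y h] at hy
        rw [hsdef, Finset.mem_filter]; exact hy
    · intro e
      rw [← e, Finset.mem_filter] at ha
      exact ha.2 (hV1 0)

open Classical in
lemma column (hn : 1 ≤ n) {A : Finset (Fin n → Fin 3)} {x0 : Fin n → Fin 3} (hx0 : x0 ∈ A)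
    (k : ℕ) : ∀ (u : (Fin n → Fin 3) → ℂ), (∀ y, y ∉ A → u y = 0) →
    (∀ i, th ^ k * u i ∈ OO) → star u ⬝ᵥ u = 1 →
    ∃ V ∈ Good n A, V u = Pi.single x0 1 := by
  induction k with
  | zero =>
    intro u hs hu h1
    exact column_zero hx0 u hs (fun i => by simpa using hu i) h1
  | succ k ih =>
    have main : ∀ (m : ℕ) (u : (Fin n → Fin 3) → ℂ),
        (Finset.univ.filter fun i => ¬ Dv (th ^ (k + 1) * u i)).card = m →
        (∀ y, y ∉ A → u y = 0) → (∀ i, th ^ (k + 1) * u i ∈ OO) → star u ⬝ᵥ u = 1 →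
        ∃ V ∈ Good n A, V u = Pi.single x0 1 := by
      intro m
      induction m using Nat.strong_induction_on with
      | _ m ihm =>
        intro u hm hs hu h1
        by_cases hne : ∃ i, ¬ Dv (th ^ (k + 1) * u i)
        · obtain ⟨V, hV, hVu, hlt⟩ := column_step hn k u hs hu h1 hne
          obtain ⟨V', hV', e⟩ := ihm _ (hm ▸ hlt) (V u) rfl
            (fun y hy => by rw [hV.2.2.1 u y hy, hs y hy]) hVu (by rw [Rep_inner hV.1, h1])
          exact ⟨V' * V, mul_mem hV' hV, e⟩
        · push Not at hne
          refine ih u hs (fun i => ?_) h1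
          obtain ⟨z, hz, e⟩ := hne i
          have : th ^ k * u i = z := by
            apply mul_left_cancel₀ th_ne
            rw [← e]; ring
          rw [this]; exact hz
    intro u hs hu h1
    exact main _ u rfl hs hu h1

lemma single_inner (y : Fin n → Fin 3) (v : (Fin n → Fin 3) → ℂ) :
    star (Pi.single y (1 : ℂ)) ⬝ᵥ v = v y := by
  rw [← Pi.single_star]
  simp

lemma synth (hn : 1 ≤ n) (A : Finset (Fin n → Fin 3)) :
    ∀ U : Module.End ℂ ((Fin n → Fin 3) → ℂ),
    (∀ u v, star (U u) ⬝ᵥ U v = star u ⬝ᵥ v) →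
    (∀ y i, RR (U (Pi.single y 1) i)) →
    (∀ y, y ∉ A → U (Pi.single y 1) = Pi.single y 1) →
    ∃ F ∈ Rep n, F * U = 1 := by
  induction A using Finset.induction_on with
  | empty =>
    intro U _ _ h
    refine ⟨1, one_mem _, ?_⟩
    rw [one_mul]
    apply LinearMap.pi_ext'
    intro y
    apply LinearMap.ext_ring
    simpa using h y (by simp)
  | insert x0 A hx ih =>
    intro U hi hR hfix
    have hmem : x0 ∈ insert x0 A := Finset.mem_insert_self _ _
    obtain ⟨k, hk⟩ := RR_common (hR x0)
    obtain ⟨V, hV, e⟩ := column hn hmem k (U (Pi.single x0 1)) (by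
      intro y hy
      have h0 := hi (Pi.single y 1) (Pi.single x0 1)
      rw [hfix y hy, single_inner, single_inner] at h0
      rw [h0]
      have : y ≠ x0 := fun h => hy (h ▸ hmem)
      simp [this]) hk (by rw [hi, single_inner]; simp)
    obtain ⟨F, hF, e'⟩ := ih (V * U) (fun u v => by
      rw [Module.End.mul_apply, Module.End.mul_apply, Rep_inner hV.1, hi])
      (fun y i => hV.2.1 _ (hR y) i) (by
        intro y hy
        rw [Module.End.mul_apply]
        by_cases h : y = x0
        · rw [h, e]
        · have hy' : y ∉ insert x0 A := by simp [h, hy]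
          rw [hfix y hy']
          apply hV.2.2.2
          intro a ha
          have : a ≠ y := fun h => hy' (h ▸ ha)
          simp [this])
    exact ⟨F * V, mul_mem hF hV.1, by rw [mul_assoc]; exact e'⟩

lemma w0_ne : w0 ≠ 0 := by
  intro h
  have := congrFun h 0
  simp [w0] at this

end Reduce

end MQ

/-- For `n ≥ 1` and a `3^n × 3^n` unitary `U` with entries in `ℤ[1/3, ω]`,
there are an element `W` of the `(n+1)`-qutrit Clifford+`T` group and a nonzero `w ∈ ℂ³`
such that `W(v ⊗ w) = (Uv) ⊗ w` for every `v ∈ ℂ^{3^n}`: `U` is exactly representable over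
Clifford+`T` with at most one ancilla. -/
theorem multiqutrit_omega_ring_synthesis
    (n : ℕ) (hn : 1 ≤ n)
    (U : Matrix (Fin n → Fin 3) (Fin n → Fin 3) ℂ)
    (hU : U ∈ Matrix.unitaryGroup (Fin n → Fin 3) ℂ)
    (hent : ∀ x y, U x y ∈ Subring.closure {(3 : ℂ)⁻¹, ω}) :
    ∃ W ∈ CliffordT (n + 1), ∃ w : Fin 3 → ℂ, w ≠ 0 ∧
      ∀ v : (Fin n → Fin 3) → ℂ,
        (W : Matrix (Fin (n + 1) → Fin 3) (Fin (n + 1) → Fin 3) ℂ).mulVec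
            (fun x => v (Fin.init x) * w (x (Fin.last n))) =
          fun x => U.mulVec v (Fin.init x) * w (x (Fin.last n)) := by
  obtain ⟨F, ⟨W, hW, h⟩, e⟩ := MQ.synth hn Finset.univ U.mulVecLin (fun u v => by
      rw [Matrix.mulVecLin_apply, Matrix.mulVecLin_apply, Matrix.star_mulVec,
        Matrix.dotProduct_mulVec, Matrix.vecMul_vecMul, ← Matrix.star_eq_conjTranspose,
        Matrix.mem_unitaryGroup_iff'.1 hU, Matrix.vecMul_one])
    (fun y i => by
      rw [Matrix.mulVecLin_apply, Matrix.mulVec_single_one]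
      exact MQ.RR_closure (hent i y)) (fun y hy => absurd (Finset.mem_univ y) hy)
  refine ⟨W⁻¹, inv_mem hW, MQ.w0, MQ.w0_ne, fun v => ?_⟩
  have h1 := h (U.mulVec v)
  have h2 : F (U.mulVec v) = v := LinearMap.congr_fun e v
  rw [h2] at h1
  have h3 : ((W⁻¹ : Matrix.unitaryGroup (Fin (n + 1) → Fin 3) ℂ) :
      Matrix (Fin (n + 1) → Fin 3) (Fin (n + 1) → Fin 3) ℂ) *
      (W : Matrix (Fin (n + 1) → Fin 3) (Fin (n + 1) → Fin 3) ℂ) = 1 :=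
    congrArg Subtype.val (inv_mul_cancel W)
  change (W⁻¹ : Matrix.unitaryGroup (Fin (n + 1) → Fin 3) ℂ).1.mulVec (MQ.anc v) =
    MQ.anc (U.mulVec v)
  rw [← h1, Matrix.mulVec_mulVec]
  erw [h3]
  rw [Matrix.one_mulVec]
end

section
/- Let n ≥ 1 and let U be a 3^n × 3^n unitary matrix all of whose entries lie in ℤ[1/3, ζ], where ζ = e^{2πi/9}. Then there exist an element W of the (n+2)-qutrit Clifford+T group and a nonzero vector w ∈ ℂ⁹ such that for every v ∈ ℂ^{3^n}, W(v ⊗ w) = (U v) ⊗ w. That is, U can be exactly represented by a quantum circuit over the Clifford+T gate set using at most two ancillae. -/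
section part1

open Matrix

noncomputable def θ : ℂ := 1 + 2 * ω

theorem omega_eq : ω = -1/2 + (Real.sqrt 3 / 2 : ℝ) * Complex.I := by
  unfold ω
  have h : (2 * Real.pi * Complex.I / 3 : ℂ) = ((Real.pi - Real.pi / 3 : ℝ) : ℂ) * Complex.I := by
    push_cast; ring
  rw [h, Complex.exp_mul_I, ← Complex.ofReal_cos, ← Complex.ofReal_sin, Real.cos_pi_sub,
    Real.sin_pi_sub, Real.cos_pi_div_three, Real.sin_pi_div_three]
  push_cast; ring

theorem sqrt3_sq : ((Real.sqrt 3 : ℝ) : ℂ) ^ 2 = 3 := by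
  rw [← Complex.ofReal_pow, Real.sq_sqrt (by norm_num)]; norm_num

theorem theta_eq : Complex.I * (Real.sqrt 3 : ℂ) = θ := by
  unfold θ; rw [omega_eq]; push_cast; ring

theorem omega_sq : ω ^ 2 = -1 - ω := by
  rw [omega_eq]; push_cast
  linear_combination (1/4 : ℂ) * Complex.I ^ 2 * sqrt3_sq + (3/4 : ℂ) * Complex.I_sq

theorem omega_cube : ω ^ 3 = 1 := by
  linear_combination (ω - 1) * omega_sq

theorem theta_sq : θ ^ 2 = -3 := by
  unfold θ; linear_combination 4 * omega_sq

theorem theta_ne : θ ≠ 0 := by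
  intro h; have := theta_sq; rw [h] at this; norm_num at this

theorem omega_ne : ω ≠ 0 := by
  intro h; have := omega_cube; rw [h] at this; norm_num at this

theorem theta_inv : θ⁻¹ = -θ / 3 := by
  have := theta_ne; field_simp; linear_combination theta_sq

theorem star_omega : star ω = -1 - ω := by
  rw [omega_eq]
  simp only [Complex.star_def, map_add, map_mul, Complex.conj_I, Complex.conj_ofReal, map_div₀,
    map_neg, map_one, map_ofNat]
  ring

theorem star_theta : star θ = -θ := by
  unfold θ; rw [star_add, star_mul, star_omega]; simp; ring

theorem zeta_cube : ζ ^ 3 = ω := by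
  unfold ζ ω; rw [← Complex.exp_nat_mul]; congr 1; push_cast; ring

theorem zeta_ne : ζ ≠ 0 := Complex.exp_ne_zero _

theorem star_zeta : star ζ = ζ⁻¹ := by
  unfold ζ; rw [← Complex.exp_neg, Complex.star_def, ← Complex.exp_conj]; congr 1
  simp only [map_div₀, map_mul, Complex.conj_I, Complex.conj_ofReal, map_ofNat]; ring

theorem zeta_inv : ζ⁻¹ = ζ ^ 8 := by
  have := zeta_ne
  have h9 : ζ ^ 9 = 1 := by rw [show 9 = 3 * 3 from rfl, pow_mul, zeta_cube, omega_cube]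
  field_simp; rw [h9]

noncomputable def om (a : Fin 3) : ℂ := ω ^ (a : ℕ)

@[simp] theorem om_zero : om 0 = 1 := by simp [om]
@[simp] theorem om_one : om 1 = ω := by simp [om]
@[simp] theorem om_two : om 2 = -1 - ω := by simp [om, omega_sq]

theorem om_add (a b : Fin 3) : om (a + b) = om a * om b := by
  unfold om; rw [← pow_add, pow_eq_pow_mod ((a:ℕ) + b) omega_cube, Fin.val_add]

theorem star_om (a : Fin 3) : star (om a) = om (-a) := by
  fin_cases a
  · simp
  · have := star_omega; simp at *; rw [this]; exact om_two.symm
  · simp; have := star_omega; simp at this; rw [this]; rw [show (-2 : Fin 3) = 1 from rfl]; simp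

theorem om_mul_neg (a : Fin 3) : om a * om (-a) = 1 := by
  rw [← om_add]; simp

theorem H3_apply (a b : Fin 3) : H3 a b = θ⁻¹ * om (a * b) := by
  unfold H3; rw [theta_eq]
  fin_cases a <;> fin_cases b <;> simp [omega_sq]

theorem H3_unitary : H3 * star H3 = 1 := by
  have h3 : θ⁻¹ * star θ⁻¹ = 1 / 3 := by
    rw [star_inv₀, star_theta, inv_neg, theta_inv]; linear_combination (-1/9:ℂ) * theta_sq
  have h4 := omega_sq
  ext a b
  simp only [Matrix.mul_apply, Matrix.star_apply, H3_apply, Fin.sum_univ_three, star_mul, star_om]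
  have : ∀ x y z w u v: ℂ, θ⁻¹ * x * (y * star θ⁻¹) + θ⁻¹ * z * (w * star θ⁻¹) + θ⁻¹ * u * (v * star θ⁻¹)
    = (1/3) * (x * y + z * w + u * v) := by
    intros; rw [← h3]; ring
  rw [this]; simp only [← om_add]
  fin_cases a <;> fin_cases b <;> simp
  all_goals try simp [show (-2 : Fin 3) = 1 from rfl, show (-1 : Fin 3) = 2 from rfl,
    show (2+2 : Fin 3) = 1 from rfl, show (1+1 : Fin 3) = 2 from rfl]
  all_goals try norm_num
  all_goals try ring

end part1

section part2

open Matrix Function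

section gates
variable {N : ℕ}

def InG (N : ℕ) (M : Matrix (Fin N → Fin 3) (Fin N → Fin 3) ℂ) : Prop :=
  ∃ W ∈ CliffordT N, (W : Matrix (Fin N → Fin 3) (Fin N → Fin 3) ℂ) = M

theorem InG.mul {A B : Matrix (Fin N → Fin 3) (Fin N → Fin 3) ℂ} (hA : InG N A) (hB : InG N B) :
    InG N (A * B) := by
  obtain ⟨W, hW, rfl⟩ := hA
  obtain ⟨V, hV, rfl⟩ := hB
  exact ⟨W * V, mul_mem hW hV, rfl⟩

theorem InG.star {A : Matrix (Fin N → Fin 3) (Fin N → Fin 3) ℂ} (hA : InG N A) :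
    InG N (star A) := by
  obtain ⟨W, hW, rfl⟩ := hA
  exact ⟨W⁻¹, inv_mem hW, rfl⟩

theorem InG.unit {A : Matrix (Fin N → Fin 3) (Fin N → Fin 3) ℂ} (hA : InG N A) :
    Star.star A * A = 1 := by
  obtain ⟨W, hW, rfl⟩ := hA
  exact (Matrix.mem_unitaryGroup_iff'.1 W.2)

theorem InG.unit' {A : Matrix (Fin N → Fin 3) (Fin N → Fin 3) ℂ} (hA : InG N A) :
    A * Star.star A = 1 := by
  obtain ⟨W, hW, rfl⟩ := hA
  exact (Matrix.mem_unitaryGroup_iff.1 W.2)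

theorem inG_one : InG N 1 := ⟨1, one_mem _, rfl⟩

theorem inG_of_gen {A : Matrix (Fin N → Fin 3) (Fin N → Fin 3) ℂ} (hA : A * star A = 1)
    (h : A ∈ cliffordTGens N) : InG N A :=
  ⟨⟨A, Matrix.mem_unitaryGroup_iff.2 hA⟩, Subgroup.subset_closure h, rfl⟩

theorem mulVec_ext {X : Type*} [Fintype X] [DecidableEq X] {A B : Matrix X X ℂ}
    (h : ∀ v x, (A *ᵥ v) x = (B *ᵥ v) x) : A = B := by
  apply Matrix.toLin'.injective
  ext v x
  simp [h]

theorem wire_mulVec (g : Matrix (Fin 3) (Fin 3) ℂ) (t : Fin N) (v : (Fin N → Fin 3) → ℂ)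
    (x : Fin N → Fin 3) :
    (wireGate N g t *ᵥ v) x = ∑ c, g (x t) c * v (update x t c) := by
  simp only [Matrix.mulVec, dotProduct, wireGate, Matrix.of_apply, ite_mul, zero_mul]
  rw [← Finset.sum_filter]
  refine Finset.sum_nbij' (fun y => y t) (fun c => update x t c) ?_ ?_ ?_ ?_ ?_
  · simp
  · intro c _
    simp only [Finset.mem_filter, Finset.mem_univ, true_and]
    intro i hi; simp [hi]
  · intro y hy
    simp only [Finset.mem_filter, Finset.mem_univ, true_and] at hy
    ext i; by_cases hi : i = t
    · subst hi; simp
    · simp [hi, hy i hi]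
  · simp
  · intro y hy
    simp only [Finset.mem_filter, Finset.mem_univ, true_and] at hy
    congr 2
    ext i; by_cases hi : i = t
    · subst hi; simp
    · simp [hi, hy i hi]

theorem wire_mul (g h : Matrix (Fin 3) (Fin 3) ℂ) (t : Fin N) :
    wireGate N g t * wireGate N h t = wireGate N (g * h) t := by
  apply mulVec_ext; intro v x
  rw [← Matrix.mulVec_mulVec]
  simp only [wire_mulVec, update_self, update_idem, Matrix.mul_apply, Fin.sum_univ_three]
  ring

theorem wire_star (g : Matrix (Fin 3) (Fin 3) ℂ) (t : Fin N) :
    star (wireGate N g t) = wireGate N (star g) t := by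
  ext x y
  simp only [Matrix.star_apply, wireGate, Matrix.of_apply]
  have : (∀ i, i ≠ t → y i = x i) ↔ (∀ i, i ≠ t → x i = y i) := by
    constructor <;> intro h i hi <;> exact (h i hi).symm
  simp only [this]
  split_ifs <;> simp

theorem wire_one (t : Fin N) : wireGate N 1 t = 1 := by
  apply mulVec_ext; intro v x
  rw [wire_mulVec]
  simp [Matrix.one_apply]

theorem inG_H (t : Fin N) : InG N (wireGate N H3 t) := by
  apply inG_of_gen
  · rw [wire_star, wire_mul, H3_unitary, wire_one]
  · left; exact ⟨t, Or.inl rfl⟩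

theorem inG_Hs (t : Fin N) : InG N (wireGate N (star H3) t) := by
  rw [← wire_star]; exact (inG_H t).star

noncomputable def D (f : (Fin N → Fin 3) → Fin 3) : Matrix (Fin N → Fin 3) (Fin N → Fin 3) ℂ :=
  Matrix.diagonal fun x => om (f x)

theorem D_mulVec (f : (Fin N → Fin 3) → Fin 3) (v : (Fin N → Fin 3) → ℂ) (x) :
    (D f *ᵥ v) x = om (f x) * v x := by
  simp [D, Matrix.mulVec_diagonal]

theorem D_mul (f g : (Fin N → Fin 3) → Fin 3) : D f * D g = D (fun x => f x + g x) := by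
  simp [D, om_add]

noncomputable def P (σ : Equiv.Perm (Fin N → Fin 3)) : Matrix (Fin N → Fin 3) (Fin N → Fin 3) ℂ :=
  Matrix.of fun x y => if x = σ y then 1 else 0

theorem P_mulVec (σ : Equiv.Perm (Fin N → Fin 3)) (v : (Fin N → Fin 3) → ℂ) (x) :
    (P σ *ᵥ v) x = v (σ.symm x) := by
  simp only [Matrix.mulVec, dotProduct, P, Matrix.of_apply, ite_mul, zero_mul, one_mul]
  simp only [← Equiv.symm_apply_eq]
  simp

theorem P_star (σ : Equiv.Perm (Fin N → Fin 3)) : star (P σ) = P σ.symm := by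
  ext x y
  simp only [Matrix.star_apply, P, Matrix.of_apply]
  have : y = σ x ↔ x = σ.symm y := by rw [Equiv.eq_symm_apply]; exact eq_comm
  simp only [this]; split_ifs <;> simp

theorem P_unit (σ : Equiv.Perm (Fin N → Fin 3)) : P σ * star (P σ) = 1 := by
  rw [P_star]; apply mulVec_ext; intro v x
  rw [← Matrix.mulVec_mulVec]
  simp [P_mulVec]

theorem InG.conj {σ : Equiv.Perm (Fin N → Fin 3)} {d : (Fin N → Fin 3) → ℂ}
    (hσ : InG N (P σ)) (hf : InG N (diagonal d)) : InG N (diagonal fun x => d (σ x)) := by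
  have := (hσ.star.mul hf).mul hσ
  convert this using 1
  apply mulVec_ext; intro v x
  rw [P_star]
  simp [← Matrix.mulVec_mulVec, P_mulVec, Matrix.mulVec_diagonal]

theorem InG.dconj {σ : Equiv.Perm (Fin N → Fin 3)} {f : (Fin N → Fin 3) → Fin 3}
    (hσ : InG N (P σ)) (hf : InG N (D f)) : InG N (D fun x => f (σ x)) :=
  InG.conj hσ hf

theorem InG.dadd {f g : (Fin N → Fin 3) → Fin 3} (hf : InG N (D f)) (hg : InG N (D g)) :
    InG N (D fun x => f x + g x) := by
  rw [← D_mul]; exact hf.mul hg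

theorem inG_d0 : InG N (D fun _ => 0) := by
  convert inG_one (N := N); simp [D]

open Fin.CommRing in
theorem InG.dsmul {f : (Fin N → Fin 3) → Fin 3} (hf : InG N (D f)) (k : Fin 3) :
    InG N (D fun x => k * f x) := by
  have h2 := hf.dadd hf
  fin_cases k
  · convert inG_d0 (N := N) using 2; funext x; simp
  · convert hf using 2; funext x; simp
  · convert h2 using 2; funext x; exact two_mul (f x)

/-- independent of wire t -/
def Ind (t : Fin N) (f : (Fin N → Fin 3) → Fin 3) : Prop := ∀ x c, f (update x t c) = f x

def A (t : Fin N) (f : (Fin N → Fin 3) → Fin 3) (h : Ind t f) : Equiv.Perm (Fin N → Fin 3) where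
  toFun x := update x t (x t + f x)
  invFun x := update x t (x t - f x)
  left_inv x := by simp [h x]
  right_inv x := by simp [h x]

theorem A_apply (t : Fin N) (f : (Fin N → Fin 3) → Fin 3) (h : Ind t f) (x) :
    A t f h x = update x t (x t + f x) := rfl
theorem A_symm (t : Fin N) (f : (Fin N → Fin 3) → Fin 3) (h : Ind t f) (x) :
    (A t f h).symm x = update x t (x t - f x) := rfl

open Fin.CommRing in
theorem H_conj (t : Fin N) (f : (Fin N → Fin 3) → Fin 3) (h : Ind t f) :
    wireGate N H3 t * D (fun x => - x t * f x) = P (A t f h) * wireGate N H3 t := by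
  apply mulVec_ext; intro v x
  rw [← Matrix.mulVec_mulVec, ← Matrix.mulVec_mulVec, P_mulVec, wire_mulVec, wire_mulVec]
  refine Finset.sum_congr rfl fun c _ => ?_
  rw [D_mulVec, A_symm, H3_apply, H3_apply, h]
  simp only [update_self, update_idem]
  rw [show (x t - f x) * c = x t * c + -c * f x by ring, om_add]
  ring

open Fin.CommRing in
theorem inG_A_of {t : Fin N} {f : (Fin N → Fin 3) → Fin 3} (h : Ind t f)
    (hD : InG N (D fun x => x t * f x)) : InG N (P (A t f h)) := by
  have h1 := ((inG_H t).mul (hD.dsmul (-1))).mul (inG_H t).star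
  have h2 : (fun x : Fin N → Fin 3 => -1 * (x t * f x)) = fun x => -x t * f x := by
    funext x; ring
  rw [h2, H_conj t f h, Matrix.mul_assoc, (inG_H t).unit', mul_one] at h1
  exact h1

open Fin.CommRing in
theorem inG_of_A {t : Fin N} {f : (Fin N → Fin 3) → Fin 3} (h : Ind t f)
    (hP : InG N (P (A t f h))) : InG N (D fun x => x t * f x) := by
  have h1 := (inG_H t).star.mul (hP.mul (inG_H t))
  rw [← H_conj t f h, ← Matrix.mul_assoc, (inG_H t).unit, one_mul] at h1
  have h2 : (fun x : Fin N → Fin 3 => x t * f x) = fun x => -1 * (-x t * f x) := by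
    funext x; ring
  rw [h2]; exact h1.dsmul (-1)

theorem ind_wire {t a : Fin N} (h : a ≠ t) (φ : Fin 3 → Fin 3) : Ind t (fun x => φ (x a)) := by
  intro x c; simp [h]

theorem inG_cx {a t : Fin N} (h : a ≠ t) : InG N (P (A t (fun x => x a) (ind_wire h id))) := by
  apply inG_of_gen (P_unit _)
  right
  refine ⟨a, t, h, ?_⟩
  ext x y
  simp only [P, cxGate, Matrix.of_apply, A_apply]
  congr 1
  apply propext
  constructor
  · rintro rfl
    refine ⟨by simp [h], by simp [add_comm], fun i _ hi => by simp [hi]⟩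
  · rintro ⟨h1, h2, h3⟩
    ext i
    by_cases hi : i = t
    · subst hi; simp [h2, add_comm]
    · by_cases hia : i = a
      · subst hia; simp [h1, hi]
      · simp [hi, h3 i hia hi]

noncomputable def zt (a : Fin 3) : ℂ := ![1, ζ, ζ⁻¹] a

theorem inG_T (t : Fin N) : InG N (diagonal fun x => zt (x t)) := by
  have : wireGate N T3 t = diagonal fun x => zt (x t) := by
    apply mulVec_ext; intro v x
    rw [wire_mulVec, Matrix.mulVec_diagonal]
    have h3 : T3 = diagonal zt := by
      ext i j; fin_cases i <;> fin_cases j <;> simp [T3, zt]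
    rw [h3]
    simp [Matrix.diagonal_apply]
  apply inG_of_gen
  · rw [Matrix.star_eq_conjTranspose, Matrix.diagonal_conjTranspose, Matrix.diagonal_mul_diagonal, ← Matrix.diagonal_one]
    congr 1; funext x
    have hz := zeta_ne
    have hs := star_zeta
    have : ∀ a, zt a * star (zt a) = 1 := by
      intro a; fin_cases a
      · simp [zt]
      · simp only [zt]; simp at hs ⊢; rw [hs]; field_simp
      · simp only [zt]; simp at hs ⊢; rw [hs]; field_simp
    exact this _
  · left; exact ⟨t, Or.inr (Or.inr this.symm)⟩

open Fin.CommRing in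
theorem zt_add (a b : Fin 3) : zt (a + b) = zt a * zt b * om (a^2*b + a*b^2) := by
  have h9 : ζ ^ 9 = 1 := by rw [show 9 = 3 * 3 from rfl, pow_mul, zeta_cube, omega_cube]
  have hz := zeta_ne
  have hi := zeta_inv
  have h0 : om (0) = 1 := om_zero
  fin_cases a <;> fin_cases b
  · simp [zt]
  · simp [zt]
  · simp [zt]
  · simp [zt]
  · show zt 2 = zt 1 * zt 1 * om 2
    simp only [zt, om]; simp [hi, ← zeta_cube]; ring
  · show zt 0 = zt 1 * zt 2 * om 0
    simp [zt, hz]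
  · simp [zt]
  · show zt 0 = zt 2 * zt 1 * om 0
    simp [zt, hz]
  · show zt 1 = zt 2 * zt 2 * om 1
    simp [zt, hi, ← zeta_cube]; 
    linear_combination (-ζ * (1 + ζ^9)) * h9

end gates

end part2

section part3

open Matrix Function
open scoped Fin.CommRing

section induct
variable {N : ℕ}

theorem zt_star (a : Fin 3) : zt a * star (zt a) = 1 := by
  have hz := zeta_ne
  have hs := star_zeta
  fin_cases a
  · simp [zt]
  · simp only [zt]; simp at hs ⊢; rw [hs]; field_simp
  · simp only [zt]; simp at hs ⊢; rw [hs]; field_simp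

theorem base1 {a t : Fin N} (h : a ≠ t) :
    InG N (D fun x => (x a)^2 * x t + x a * (x t)^2) := by
  have h1 := (inG_cx h).conj (inG_T t)
  have h2 := (h1.mul (inG_T t).star).mul (inG_T a).star
  convert h2 using 1
  simp only [D, Matrix.star_eq_conjTranspose, Matrix.diagonal_conjTranspose,
    Matrix.diagonal_mul_diagonal]
  congr 1; funext x
  simp only [A_apply, update_self, Pi.star_apply]
  rw [add_comm (x t), zt_add]
  linear_combination (-om ((x a)^2 * x t + x a * (x t)^2)) * (zt (x a) * star (zt (x a)) * zt_star (x t) + zt_star (x a))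

theorem base2 {a t : Fin N} (h : a ≠ t) :
    InG N (D fun x => x t * (x a)^2) ∧ InG N (D fun x => x t) := by
  have h1 := base1 h
  have h2 := (inG_cx h.symm).dconj h1
  have h3 := (inG_cx h.symm).dconj h2
  simp only [A_apply, update_self, update_of_ne h.symm] at h2 h3
  have h4 := (h1.dadd h3).dsmul 2
  have key : InG N (D fun x => x t * (x a)^2) := by
    convert h4 using 2; funext x
    generalize x a = a; generalize x t = b; revert a b; decide
  refine ⟨key, ?_⟩
  have h5 := (h2.dsmul 2).dadd key
  convert h5 using 2; funext x
  generalize x a = a; generalize x t = b; revert a b; decide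

theorem base3 {a t : Fin N} (h : a ≠ t) : InG N (D fun x => x t * x a) :=
  inG_of_A (ind_wire h id) (inG_cx h)

theorem base4 {a t : Fin N} (h : a ≠ t) : InG N (D fun x => (x t)^2) := by
  have h1 := (inG_cx h.symm).dconj (base3 h)
  simp only [A_apply, update_self, update_of_ne h.symm] at h1
  have := h1.dadd ((base3 h).dsmul 2)
  convert this using 2; funext x
  generalize x a = a; generalize x t = b; revert a b; decide

theorem base5 {a t : Fin N} (h : a ≠ t) : InG N (D fun _ => 1) := by
  have h0 := (base2 h).2
  have h1 : InG N (P (A t (fun _ => 1) (fun _ _ => rfl))) := inG_A_of _ (by simpa using h0)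
  have h2 := (h1.dconj h0).dadd (h0.dsmul 2)
  convert h2 using 2; funext x
  show (1 : Fin 3) = update x t (x t + 1) t + 2 * x t
  rw [update_self]
  generalize x t = b; revert b; decide

theorem phi_eq (φ : Fin 3 → Fin 3) (x : Fin 3) :
    φ x = φ 0 * 1 + (φ 1 * 2 + φ 2) * x + (φ 0 * 2 + φ 1 * 2 + φ 2 * 2) * x ^ 2 := by
  generalize h0 : φ 0 = p
  generalize h1 : φ 1 = q
  generalize h2 : φ 2 = r
  have : φ x = ![p, q, r] x := by
    fin_cases x
    · exact h0
    · exact h1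
    · exact h2
  rw [this]
  clear this h0 h1 h2
  revert p q r x; decide

theorem inG_one_wire {a t : Fin N} (h : a ≠ t) (φ : Fin 3 → Fin 3) : InG N (D fun x => φ (x t)) := by
  have := (((base5 h).dsmul (φ 0)).dadd ((base2 h).2.dsmul (φ 1 * 2 + φ 2))).dadd
    ((base4 h).dsmul (φ 0 * 2 + φ 1 * 2 + φ 2 * 2))
  convert this using 2; funext x
  exact phi_eq φ (x t)

theorem inG_two_wire {a t : Fin N} (h : a ≠ t) (φ : Fin 3 → Fin 3) :
    InG N (D fun x => x t * φ (x a)) := by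
  have := (((base2 h).2.dsmul (φ 0)).dadd ((base3 h).dsmul (φ 1 * 2 + φ 2))).dadd
    ((base2 h).1.dsmul (φ 0 * 2 + φ 1 * 2 + φ 2 * 2))
  convert this using 2; funext x
  rw [phi_eq φ (x a)]; ring

def dl (c b : Fin 3) : Fin 3 := if b = c then 1 else 0

theorem dl_sum (f : (Fin N → Fin 3) → Fin 3) (a : Fin N) (x : Fin N → Fin 3) :
    f x = dl 0 (x a) * f (update x a 0) + dl 1 (x a) * f (update x a 1) + dl 2 (x a) * f (update x a 2) := by
  have h : f x = f (update x a (x a)) := by simp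
  rw [h]
  generalize x a = b
  fin_cases b <;> simp [dl]

/-- depends only on wires in S -/
def Dep (S : Finset (Fin N)) (f : (Fin N → Fin 3) → Fin 3) : Prop :=
  ∀ x y, (∀ i ∈ S, x i = y i) → f x = f y

theorem Dep.ind {S : Finset (Fin N)} {f : (Fin N → Fin 3) → Fin 3} (h : Dep S f) {t} (ht : t ∉ S) :
    Ind t f := by
  intro x c; apply h; intro i hi
  have : i ≠ t := by rintro rfl; exact ht hi
  simp [this]

theorem Dep.upd {S : Finset (Fin N)} {f : (Fin N → Fin 3) → Fin 3} (h : Dep S f) (a c) :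
    Dep (S.erase a) (fun x => f (update x a c)) := by
  intro x y hxy; apply h; intro i hi
  by_cases hia : i = a
  · subst hia; simp
  · simp [hia]; exact hxy i (Finset.mem_erase.2 ⟨hia, hi⟩)

def PP (N k : ℕ) : Prop := ∀ S : Finset (Fin N), S.card ≤ k → ∀ f, Dep S f → InG N (D f)

theorem stepA {k : ℕ} (hP : PP N k) (hk : 1 ≤ k) {S : Finset (Fin N)} (hS : S.card ≤ k)
    {t : Fin N} (ht : t ∉ S) {f : (Fin N → Fin 3) → Fin 3} (hf : Dep S f) :
    InG N (D fun x => x t * f x) := by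
  rcases S.eq_empty_or_nonempty with rfl | ⟨a, ha⟩
  · apply hP {t} (by simpa using hk)
    intro x y hxy
    dsimp only; rw [hf x y (by simp), hxy t (by simp)]
  · have hat : a ≠ t := by rintro rfl; exact ht ha
    have key : ∀ c, InG N (D fun x => x t * (dl c (x a) * f (update x a c))) := by
      intro c
      have h1 : InG N (D fun x => (x t)^2 * f (update x a c)) := by
        apply hP (insert t (S.erase a))
        · rw [Finset.card_insert_of_notMem (by simp [ht]), Finset.card_erase_of_mem ha]
          have := Finset.card_pos.2 ⟨a, ha⟩; omega
        · intro x y hxy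
          have := hf.upd a c x y (fun i hi => hxy i (by simp at hi ⊢; tauto))
          dsimp only at this ⊢
          rw [hxy t (by simp), this]
      have h2 : InG N (D fun x => dl c (x a) * f (update x a c)) := by
        apply hP S hS
        intro x y hxy
        have := hf.upd a c x y (fun i hi => hxy i (by simp at hi ⊢; tauto))
        dsimp only at this ⊢
        rw [hxy a ha, this]
      have h3 := inG_A_of (ind_wire hat (dl c)) (inG_two_wire hat (dl c))
      have h4 := h3.dconj h1
      simp only [A_apply, update_self] at h4
      have h5 := ((h4.dadd (h1.dsmul 2)).dadd (h2.dsmul 2)).dsmul 2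
      convert h5 using 2; funext x
      have e : f (update (update x t (x t + dl c (x a))) a c) = f (update x a c) := by
        rw [update_comm hat.symm]; exact (hf.ind ht) _ _
      rw [e]
      have : dl c (x a) = 0 ∨ dl c (x a) = 1 := by unfold dl; split_ifs <;> simp
      generalize f (update x a c) = g
      generalize x t = b
      rcases this with h | h <;> rw [h]
      · revert g b; decide
      · revert g b; decide
    have := ((key 0).dadd (key 1)).dadd (key 2)
    convert this using 2; funext x
    rw [← mul_add, ← mul_add, ← dl_sum]

theorem stepB {k : ℕ} (hP : PP N k) (hk : 1 ≤ k) (hN : k + 1 < N) : PP N (k + 1) := by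
  intro S hS f hf
  by_cases hS' : S.card ≤ k
  · exact hP S hS' f hf
  obtain ⟨a, ha⟩ : S.Nonempty := Finset.card_pos.1 (by omega)
  obtain ⟨t, ht⟩ : ∃ t, t ∉ S := by
    by_contra hc; push Not at hc
    have : S = Finset.univ := by ext; simp [hc]
    rw [this] at hS; simp at hS; omega
  have hat : a ≠ t := by rintro rfl; exact ht ha
  have key : ∀ c, InG N (D fun x => dl c (x a) * f (update x a c)) := by
    intro c
    have hd := hf.upd a c
    have hi : Ind t (fun x => f (update x a c)) := hd.ind (by simp [ht])
    have h1 := stepA hP hk (S := S.erase a) (t := t) (by rw [Finset.card_erase_of_mem ha]; omega)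
      (by simp [ht]) hd
    have h2 := inG_A_of hi h1
    have h3 := inG_two_wire hat (dl c)
    have h4 := h2.dconj h3
    simp only [A_apply, update_self, update_of_ne hat] at h4
    have h5 := h4.dadd (h3.dsmul 2)
    convert h5 using 2; funext x
    generalize f (update x a c) = g
    generalize x t = b
    generalize dl c (x a) = d
    revert g b d; decide
  have := ((key 0).dadd (key 1)).dadd (key 2)
  convert this using 2; funext x
  rw [← dl_sum]

theorem PP_one (hN : 2 ≤ N) : PP N 1 := by
  intro S hS f hf
  obtain ⟨t, ht⟩ : ∃ t, S ⊆ {t} := by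
    have : Nonempty (Fin N) := ⟨⟨0, by omega⟩⟩
    exact Finset.card_le_one_iff_subset_singleton.1 hS
  obtain ⟨a, ha⟩ : ∃ a : Fin N, a ≠ t := by
    have : Nontrivial (Fin N) := Fin.nontrivial_iff_two_le.2 hN
    exact exists_ne t
  have := inG_one_wire ha (fun c => f (fun _ => c))
  convert this using 2; funext x
  apply hf; intro i hi
  have := ht hi; simp at this; rw [this]

theorem PP_all (hN : 2 ≤ N) : PP N (N - 1) := by
  have : ∀ k, k + 2 ≤ N → PP N (k + 1) := by
    intro k
    induction k with
    | zero => intro h; exact PP_one hN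
    | succ k ih => intro h; exact stepB (ih (by omega)) (by omega) (by omega)
  obtain ⟨k, rfl⟩ : ∃ k, N = k + 2 := ⟨N - 2, by omega⟩
  exact this k le_rfl

theorem Ind.dep {t : Fin N} {f : (Fin N → Fin 3) → Fin 3} (h : Ind t f) :
    Dep (Finset.univ.erase t) f := by
  intro x y hxy
  rw [← h x (y t)]
  congr 1
  ext i
  by_cases hi : i = t
  · subst hi; simp
  · simp [hi]; exact congrArg _ (hxy i (by simp [hi]))

theorem inG_ind (hN : 2 ≤ N) {t : Fin N} {f : (Fin N → Fin 3) → Fin 3} (h : Ind t f) :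
    InG N (D f) :=
  PP_all hN _ (by simp [Finset.card_erase_of_mem]) f h.dep

theorem inG_mul_ind (hN : 2 ≤ N) {t : Fin N} {f : (Fin N → Fin 3) → Fin 3} (h : Ind t f) :
    InG N (D fun x => x t * f x) :=
  stepA (PP_all hN) (by omega) (S := Finset.univ.erase t) (by simp [Finset.card_erase_of_mem])
    (by simp) h.dep

end induct

end part3

section part4

open Matrix Function
open scoped Fin.CommRing

section chsec
variable {N : ℕ}

noncomputable def CHm (h : Fin 3) : Matrix (Fin 3) (Fin 3) ℂ :=
  ![1, H3, star H3] h

theorem starH3_apply (a b : Fin 3) : (star H3) a b = - θ⁻¹ * om (-(a * b)) := by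
  rw [Matrix.star_apply, H3_apply, star_mul, star_om, star_inv₀, star_theta, inv_neg, mul_comm,
    mul_comm b a]

theorem CH_id (h b : Fin 3) (u : Fin 3 → ℂ) :
    om (dl 0 b * h) * ∑ c, H3 b c * (om (dl 0 c * h) * ∑ d, (star H3) c d * (om (dl 0 d * h) * u d))
      = ∑ c, CHm h b c * u c := by
  have h1 := omega_sq
  have n1 : (-1 : Fin 3) = 2 := rfl
  have n2 : (-2 : Fin 3) = 1 := rfl
  have n3 : (2 * 2 : Fin 3) = 1 := rfl
  have e0 : dl 0 0 = 1 := rfl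
  have e1 : dl 0 1 = 0 := rfl
  have e2 : dl 0 2 = 0 := rfl
  have c0 : CHm 0 = 1 := rfl
  have c1 : CHm 1 = H3 := rfl
  have c2 : CHm 2 = star H3 := rfl
  have ht : θ⁻¹ = -(1 + 2 * ω) / 3 := theta_inv
  fin_cases h <;> fin_cases b <;>
    simp only [Fin.sum_univ_three, Fin.zero_eta, Fin.mk_one, Fin.reduceFinMk, Fin.isValue, e0, e1, e2, c0, c1, c2,
      H3_apply, starH3_apply, mul_zero, zero_mul, mul_one, one_mul, neg_zero, n1, n2, n3, om_zero, om_one, om_two, ht] <;>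
    (try simp) <;> grind

theorem CH_sq (h b : Fin 3) (u : Fin 3 → ℂ) :
    ∑ c, CHm h b c * ∑ d, CHm h c d * u d = if h = 0 then u b else - u (-b) := by
  have h1 := omega_sq
  have n1 : (-1 : Fin 3) = 2 := rfl
  have n2 : (-2 : Fin 3) = 1 := rfl
  have n3 : (2 * 2 : Fin 3) = 1 := rfl
  have c0 : CHm 0 = 1 := rfl
  have c1 : CHm 1 = H3 := rfl
  have c2 : CHm 2 = star H3 := rfl
  have ht : θ⁻¹ = -(1 + 2 * ω) / 3 := theta_inv
  fin_cases h <;> fin_cases b <;>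
    simp only [Fin.sum_univ_three, Fin.zero_eta, Fin.mk_one, Fin.reduceFinMk, Fin.isValue, c0, c1, c2,
      H3_apply, starH3_apply, mul_zero, zero_mul, mul_one, one_mul, neg_zero, n1, n2, n3, om_zero, om_one, om_two, ht] <;>
    (try simp) <;> grind

theorem inG_CH {t : Fin N} {h : (Fin N → Fin 3) → Fin 3} (hi : Ind t h)
    (hD : InG N (D fun x => dl 0 (x t) * h x)) :
    ∃ W, InG N W ∧ ∀ v x, (W *ᵥ v) x = ∑ c, CHm (h x) (x t) c * v (update x t c) := by
  refine ⟨_, hD.mul ((inG_H t).mul (hD.mul ((inG_Hs t).mul hD))), fun v x => ?_⟩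
  simp only [← Matrix.mulVec_mulVec, D_mulVec, wire_mulVec, update_self, update_idem, hi x]
  exact CH_id (h x) (x t) fun c => v (update x t c)

theorem inG_CH2 {t : Fin N} {h : (Fin N → Fin 3) → Fin 3} (hi : Ind t h)
    (hD : InG N (D fun x => dl 0 (x t) * h x)) :
    ∃ W, InG N W ∧ ∀ v x, (W *ᵥ v) x = if h x = 0 then v x else - v (update x t (- x t)) := by
  obtain ⟨W, hW, hv⟩ := inG_CH hi hD
  refine ⟨W * W, hW.mul hW, fun v x => ?_⟩
  simp only [← Matrix.mulVec_mulVec, hv, update_self, update_idem, hi x]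
  have := CH_sq (h x) (x t) fun c => v (update x t c)
  rw [this]; simp
end chsec

end part4

section part5

open Matrix Function
open scoped Fin.CommRing

section ksec
variable {N : ℕ}

abbrev XX (ℓ : Fin N) := {x : Fin N → Fin 3 // x ℓ = 0}

def extv (ℓ : Fin N) (v : XX ℓ → ℂ) : (Fin N → Fin 3) → ℂ :=
  fun x => if h : x ℓ = 0 then v ⟨x, h⟩ else 0

theorem extv_inj (ℓ : Fin N) {v w : XX ℓ → ℂ} (h : extv ℓ v = extv ℓ w) : v = w := by
  funext x
  have := congrFun h x.1
  simpa [extv, x.2] using this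

theorem extv_add (ℓ : Fin N) (v w : XX ℓ → ℂ) : extv ℓ (v + w) = extv ℓ v + extv ℓ w := by
  funext x; simp only [extv, Pi.add_apply]; split_ifs <;> simp

theorem extv_smul (ℓ : Fin N) (c : ℂ) (v : XX ℓ → ℂ) : extv ℓ (c • v) = c • extv ℓ v := by
  funext x; simp only [extv, Pi.smul_apply]; split_ifs <;> simp

def KK (ℓ : Fin N) : Submonoid (Module.End ℂ (XX ℓ → ℂ)) where
  carrier := {L | ∃ W, InG N W ∧ ∀ v, W *ᵥ extv ℓ v = extv ℓ (L v)}
  one_mem' := ⟨1, inG_one, fun v => by simp⟩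
  mul_mem' := by
    rintro L M ⟨W, hW, hw⟩ ⟨V, hV, hv⟩
    exact ⟨W * V, hW.mul hV, fun v => by rw [← Matrix.mulVec_mulVec, hv, hw]; rfl⟩

/-- realizable functions -/
def RK (ℓ : Fin N) (T : (XX ℓ → ℂ) → (XX ℓ → ℂ)) : Prop := ∃ L ∈ KK ℓ, ∀ v, L v = T v

theorem RK.mk {ℓ : Fin N} {T : (XX ℓ → ℂ) → (XX ℓ → ℂ)} {W} (hW : InG N W)
    (h : ∀ v, W *ᵥ extv ℓ v = extv ℓ (T v)) : RK ℓ T := by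
  refine ⟨{ toFun := T, map_add' := ?_, map_smul' := ?_ }, ⟨W, hW, h⟩, fun v => rfl⟩
  · intro v w; apply extv_inj
    rw [← h, extv_add, extv_add, Matrix.mulVec_add, h, h]
  · intro c v; apply extv_inj
    rw [← h, RingHom.id_apply, extv_smul, extv_smul, Matrix.mulVec_smul, h]

theorem RK.comp {ℓ : Fin N} {T T' : (XX ℓ → ℂ) → (XX ℓ → ℂ)} (h : RK ℓ T) (h' : RK ℓ T') :
    RK ℓ (fun v => T (T' v)) := by
  obtain ⟨L, hL, h1⟩ := h
  obtain ⟨L', hL', h2⟩ := h'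
  exact ⟨L * L', mul_mem hL hL', fun v => by rw [Module.End.mul_apply, h2, h1]⟩

theorem RK.id {ℓ : Fin N} : RK ℓ (fun v => v) := ⟨1, one_mem _, fun v => rfl⟩

theorem RK.congr {ℓ : Fin N} {T T' : (XX ℓ → ℂ) → (XX ℓ → ℂ)} (h : RK ℓ T) (h' : ∀ v x, T v x = T' v x) :
    RK ℓ T' := by
  have : T = T' := by funext v x; exact h' v x
  rwa [← this]

theorem RK_phase (hN : 2 ≤ N) {ℓ : Fin N} (p : XX ℓ) : RK ℓ (fun v => update v p (ω * v p)) := by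
  classical
  have hi : Ind ℓ (fun x => if ∀ i, i ≠ ℓ → x i = p.1 i then 1 else 0) := by
    intro x c
    dsimp only
    congr 1; apply propext
    refine forall_congr' fun i => ?_
    refine forall_congr' fun hi => ?_
    simp [hi]
  refine RK.mk (inG_ind hN hi) fun v => ?_
  funext x
  rw [D_mulVec]
  by_cases hx : x ℓ = 0
  · simp only [extv, hx, dite_true]
    by_cases hp : ∀ i, i ≠ ℓ → x i = p.1 i
    · have : (⟨x, hx⟩ : XX ℓ) = p := by
        apply Subtype.ext; funext i
        by_cases h : i = ℓ
        · rw [h, p.2]; exact hx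
        · exact hp i h
      rw [if_pos hp, this, update_self, om_one]
    · have : (⟨x, hx⟩ : XX ℓ) ≠ p := by
        rintro rfl; exact hp fun _ _ => rfl
      rw [if_neg hp, update_of_ne this, om_zero, one_mul]
  · simp [extv, hx]

theorem RK_neg (hN : 2 ≤ N) {ℓ : Fin N} (p : XX ℓ) : RK ℓ (fun v => update v p (- v p)) := by
  classical
  obtain ⟨s, hs⟩ : ∃ s : Fin N, s ≠ ℓ := by
    have : Nontrivial (Fin N) := Fin.nontrivial_iff_two_le.2 hN
    exact exists_ne ℓ
  set h1 : (Fin N → Fin 3) → Fin 3 := fun x => if ∀ i, i ≠ ℓ → i ≠ s → x i = p.1 i then 1 else 0 with hh1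
  have i1 : Ind ℓ h1 := by
    intro x c
    simp only [hh1]
    congr 1; apply propext
    refine forall_congr' fun i => ?_
    refine forall_congr' fun hi => ?_
    simp [hi]
  have i2 : Ind s h1 := by
    intro x c
    simp only [hh1]
    congr 1; apply propext
    refine forall_congr' fun i => ?_
    refine forall_congr' fun hi => ?_
    refine forall_congr' fun hi => ?_
    simp [hi]
  have i3 : Ind s (fun x => dl 0 (x ℓ) * h1 x) := by
    intro x c; simp only [i2 x c, update_of_ne hs.symm]
  have i4 : Ind ℓ (fun x => (x s - p.1 s) * h1 x) := by
    intro x c; simp only [i1 x c, update_of_ne hs]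
  have d1 := inG_ind hN i3
  have d2 : InG N (D fun x => dl 0 (x ℓ) * ((x s - p.1 s) * h1 x)) := by
    have := (inG_mul_ind hN i3).dadd (d1.dsmul (- p.1 s))
    convert this using 2; funext x; ring
  obtain ⟨W, hW, hw⟩ := inG_CH2 i1 d1
  obtain ⟨V, hV, hv⟩ := inG_CH2 i4 d2
  refine RK.mk (hW.mul hV) fun v => ?_
  funext x
  rw [← Matrix.mulVec_mulVec, hw, hv, hv]
  have e1 := i1 x (- x ℓ)
  simp only [e1, update_of_ne hs, update_idem, update_self, neg_neg, update_eq_self]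
  by_cases hx : x ℓ = 0
  · have e2 : update x ℓ 0 = x := by rw [← hx]; simp
    simp only [hx, neg_zero, e2]
    simp only [extv, hx, dite_true]
    by_cases hp : (⟨x, hx⟩ : XX ℓ) = p
    · subst hp
      simp [hh1]
    · rw [update_of_ne hp]
      by_cases h : h1 x = 0
      · simp [h]
      · have hone : h1 x = 1 := by
          simp only [hh1] at h ⊢
          split_ifs at h ⊢ with h3
          · rfl
          · exact absurd rfl h
        have h4 : x s - p.1 s ≠ 0 := by
          intro h5
          apply hp
          apply Subtype.ext; funext i
          by_cases h : i = ℓ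
          · rw [h, p.2]; exact hx
          · by_cases h' : i = s
            · rw [h']; exact sub_eq_zero.1 h5
            · have : ∀ i, i ≠ ℓ → i ≠ s → x i = p.1 i := by
                by_contra hc
                simp only [hh1, if_neg hc] at hone
                exact absurd hone (by decide)
              exact this i h h'
        rw [hone]; simp [h4]
  · have hx' : -x ℓ ≠ 0 := by simpa using hx
    simp [extv, hx]

theorem RK_negs (hN : 2 ≤ N) {ℓ : Fin N} (S : Finset (XX ℓ)) :
    RK ℓ (fun v x => if x ∈ S then - v x else v x) := by
  induction S using Finset.induction_on with
  | empty => exact RK.id.congr (by simp)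
  | insert p S hp ih =>
    refine ((RK_neg hN p).comp ih).congr fun v x => ?_
    by_cases h : x = p
    · subst h; simp [hp]
    · simp [h]

def lpt {ℓ : Fin N} (p : XX ℓ) {t : Fin N} (ht : t ≠ ℓ) (c : Fin 3) : XX ℓ :=
  ⟨update p.1 t c, by rw [update_of_ne ht.symm]; exact p.2⟩

theorem ind_line (ℓ : Fin N) (p : Fin N → Fin 3) (t : Fin N) (ht : t ≠ ℓ) [DecidablePred fun x : Fin N → Fin 3 => ∀ i, i ≠ ℓ → i ≠ t → x i = p i] :
    Ind t (fun x => if ∀ i, i ≠ ℓ → i ≠ t → x i = p i then 1 else 0) ∧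
    Ind ℓ (fun x => dl 0 (x t) * (if ∀ i, i ≠ ℓ → i ≠ t → x i = p i then 1 else 0)) := by
  constructor
  · intro x c
    dsimp only
    congr 1; apply propext
    refine forall_congr' fun i => ?_
    refine forall_congr' fun hi => ?_
    refine forall_congr' fun hi => ?_
    simp [hi]
  · intro x c
    dsimp only
    rw [update_of_ne ht]
    congr 2; apply propext
    refine forall_congr' fun i => ?_
    refine forall_congr' fun hi => ?_
    simp [hi]

theorem line_iff {ℓ : Fin N} (p x : XX ℓ) (t : Fin N) (ht : t ≠ ℓ) :
    (∀ i, i ≠ ℓ → i ≠ t → x.1 i = p.1 i) ↔ lpt x ht (p.1 t) = p := by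
  constructor
  · intro h; apply Subtype.ext; funext i
    simp only [lpt]
    by_cases h1 : i = t
    · subst h1; simp
    · rw [update_of_ne h1]
      by_cases h2 : i = ℓ
      · subst h2; rw [x.2, p.2]
      · exact h i h2 h1
  · intro h i h1 h2
    rw [← h]; simp [lpt, h2]

theorem RK_H (hN : 2 ≤ N) {ℓ : Fin N} (p : XX ℓ) {t : Fin N} (ht : t ≠ ℓ) :
    RK ℓ (fun v x => if lpt x ht (p.1 t) = p then ∑ c, H3 (x.1 t) c * v (lpt x ht c) else v x) := by
  classical
  obtain ⟨i1, i2⟩ := ind_line ℓ p.1 t ht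
  obtain ⟨W, hW, hw⟩ := inG_CH i1 (inG_ind hN i2)
  refine RK.mk hW fun v => ?_
  funext x
  rw [hw]
  by_cases hx : x ℓ = 0
  · have := line_iff p ⟨x, hx⟩ t ht
    dsimp only at this
    simp only [extv, hx, dite_true, this, update_of_ne ht.symm]
    split_ifs
    · rfl
    · simp [CHm, Matrix.one_apply]
  · simp only [extv, update_of_ne ht.symm]
    simp [hx]

theorem RK_H2 (hN : 2 ≤ N) {ℓ : Fin N} (p : XX ℓ) {t : Fin N} (ht : t ≠ ℓ) :
    RK ℓ (fun v x => if lpt x ht (p.1 t) = p then v (lpt x ht (- x.1 t)) else v x) := by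
  classical
  obtain ⟨i1, i2⟩ := ind_line ℓ p.1 t ht
  obtain ⟨W, hW, hw⟩ := inG_CH2 i1 (inG_ind hN i2)
  have h1 : RK ℓ (fun v x => if lpt x ht (p.1 t) = p then - v (lpt x ht (- x.1 t)) else v x) := by
    refine RK.mk hW fun v => ?_
    funext x
    rw [hw]
    by_cases hx : x ℓ = 0
    · have := line_iff p ⟨x, hx⟩ t ht
      dsimp only at this
      simp only [extv, hx, dite_true, this, update_of_ne ht.symm]
      by_cases h : lpt ⟨x, hx⟩ ht (p.1 t) = p
      · simp [h]; rfl
      · simp [h]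
    · simp only [extv, update_of_ne ht.symm]
      simp [hx]
  refine ((RK_negs hN (Finset.univ.filter fun x => lpt x ht (p.1 t) = p)).comp h1).congr
    fun v x => ?_
  by_cases h : lpt x ht (p.1 t) = p <;> simp [h]

def shiftX {ℓ : Fin N} {t : Fin N} (ht : t ≠ ℓ) : Equiv.Perm (XX ℓ) where
  toFun x := lpt x ht (x.1 t + 1)
  invFun x := lpt x ht (x.1 t - 1)
  left_inv x := by simp [lpt]
  right_inv x := by simp [lpt]

def CC (ℓ : Fin N) : Submonoid (Equiv.Perm (XX ℓ)) where
  carrier := {σ | RK ℓ (fun v => v ∘ σ)}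
  one_mem' := RK.id
  mul_mem' := by
    intro σ τ h h'
    exact (h'.comp h).congr fun v x => rfl

theorem shift_mem (hN : 2 ≤ N) {ℓ : Fin N} {t : Fin N} (ht : t ≠ ℓ) :
    shiftX ht ∈ CC ℓ ∧ (shiftX ht)⁻¹ ∈ CC ℓ := by
  have h1 : Ind t (fun _ : Fin N → Fin 3 => 1) := fun _ _ => rfl
  have h2 := inG_A_of h1 (inG_mul_ind hN h1)
  constructor
  · refine RK.mk h2.star fun v => ?_
    funext x
    rw [P_star, P_mulVec, Equiv.symm_symm, A_apply]
    simp only [extv, update_of_ne ht.symm]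
    rfl
  · refine RK.mk h2 fun v => ?_
    funext x
    rw [P_mulVec, A_symm]
    simp only [extv, update_of_ne ht.symm]
    rfl

theorem swap12 (hN : 2 ≤ N) {ℓ : Fin N} (p : XX ℓ) {t : Fin N} (ht : t ≠ ℓ) :
    Equiv.swap (lpt p ht 1) (lpt p ht 2) ∈ CC ℓ := by
  refine (RK_H2 hN p ht).congr fun v x => ?_
  simp only [Function.comp_apply]
  by_cases h : lpt x ht (p.1 t) = p
  · rw [if_pos h]
    congr 1
    have hx : ∀ c, lpt x ht c = lpt p ht c := by
      intro c; rw [← h]; simp [lpt]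
    have hx' : lpt p ht (x.1 t) = x := by rw [← hx]; simp [lpt]
    have hne : ∀ a b : Fin 3, lpt p ht a = lpt p ht b ↔ a = b := by
      intro a b
      constructor
      · intro h
        have := congrFun (congrArg Subtype.val h) t
        simpa [lpt] using this
      · rintro rfl; rfl
    rw [hx]
    generalize x.1 t = c at hx'
    rw [← hx']
    fin_cases c
    · rw [Equiv.swap_apply_of_ne_of_ne] <;> simp [hne]
    · exact (Equiv.swap_apply_left _ _).symm
    · exact (Equiv.swap_apply_right _ _).symm
  · rw [if_neg h, Equiv.swap_apply_of_ne_of_ne]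
    · rintro rfl; apply h; simp [lpt]
    · rintro rfl; apply h; simp [lpt]

theorem swap_conj {ℓ : Fin N} {p q : XX ℓ} (h : Equiv.swap p q ∈ CC ℓ) {σ : Equiv.Perm (XX ℓ)}
    (h1 : σ ∈ CC ℓ) (h2 : σ⁻¹ ∈ CC ℓ) : Equiv.swap (σ p) (σ q) ∈ CC ℓ := by
  have := mul_mem (mul_mem h1 h) h2
  rwa [Equiv.mul_swap_eq_swap_mul, mul_assoc, mul_inv_cancel, mul_one] at this

theorem swap_line (hN : 2 ≤ N) {ℓ : Fin N} (p : XX ℓ) {t : Fin N} (ht : t ≠ ℓ) (a b : Fin 3) :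
    Equiv.swap (lpt p ht a) (lpt p ht b) ∈ CC ℓ := by
  obtain ⟨s1, s2⟩ := shift_mem hN ht
  have e : ∀ c, shiftX ht (lpt p ht c) = lpt p ht (c + 1) := by
    intro c; simp [shiftX, lpt]
  have h1 := swap12 hN p ht
  have h2 := swap_conj h1 s1 s2
  rw [e, e] at h2
  have h3 := swap_conj h2 s1 s2
  rw [e, e] at h3
  have h1' := h1; have h2' := h2; have h3' := h3
  rw [Equiv.swap_comm] at h1' h2' h3'
  fin_cases a <;> fin_cases b
  · rw [Equiv.swap_self]; exact one_mem _
  · exact h3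
  · exact h2'
  · exact h3'
  · rw [Equiv.swap_self]; exact one_mem _
  · exact h1
  · exact h2
  · exact h1'
  · rw [Equiv.swap_self]; exact one_mem _

theorem swap_tr {ℓ : Fin N} {p q r : XX ℓ} (h : Equiv.swap p q ∈ CC ℓ) (h' : Equiv.swap q r ∈ CC ℓ) :
    Equiv.swap p r ∈ CC ℓ := SubmonoidClass.swap_mem_trans (CC ℓ) h h'

theorem swap_all (hN : 2 ≤ N) {ℓ : Fin N} (p q : XX ℓ) : Equiv.swap p q ∈ CC ℓ := by
  have : ∀ S : Finset (Fin N), ∀ p q : XX ℓ, (∀ i ∉ S, p.1 i = q.1 i) → Equiv.swap p q ∈ CC ℓ := by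
    intro S
    induction S using Finset.induction_on with
    | empty =>
      intro p q h
      have : p = q := Subtype.ext (funext fun i => h i (by simp))
      subst this; rw [Equiv.swap_self]; exact one_mem _
    | insert t S hts ih =>
      intro p q h
      by_cases ht : t = ℓ
      · apply ih; intro i hi
        by_cases hit : i = t
        · rw [hit, ht, p.2, q.2]
        · exact h i (by simp [hit, hi])
      · have h1 := swap_line hN p ht (p.1 t) (q.1 t)
        have e : lpt p ht (p.1 t) = p := by simp [lpt]
        rw [e] at h1
        refine swap_tr h1 (ih _ _ fun i hi => ?_)
        by_cases hit : i = t
        · subst hit; simp [lpt]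
        · simp only [lpt]; rw [update_of_ne hit]; exact h i (by simp [hit, hi])
  exact this Finset.univ p q (by simp)

theorem perm_all (hN : 2 ≤ N) {ℓ : Fin N} (σ : Equiv.Perm (XX ℓ)) : σ ∈ CC ℓ := by
  induction σ using Equiv.Perm.swap_induction_on with
  | one => exact one_mem _
  | swap_mul f x y hxy h => exact mul_mem (swap_all hN x y) h

end ksec

end part5

section part6

open Matrix Function
open scoped Fin.CommRing

section trisec
variable {N : ℕ}

theorem tri_mem (hN : 2 ≤ N) {ℓ : Fin N} (f : Fin 3 → XX ℓ) (hf : Injective f) :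
    ∃ L ∈ KK ℓ, (∀ v a, L v (f a) = ∑ c, H3 a c * v (f c)) ∧
      ∀ v x, (∀ a, x ≠ f a) → L v x = v x := by
  obtain ⟨t, ht⟩ : ∃ s : Fin N, s ≠ ℓ := by
    have : Nontrivial (Fin N) := Fin.nontrivial_iff_two_le.2 hN
    exact exists_ne ℓ
  let p : XX ℓ := f 0
  have hg : Injective (lpt p ht) := by
    intro a b h
    have := congrFun (congrArg Subtype.val h) t
    simpa [lpt] using this
  obtain ⟨σ, hσ⟩ := Equiv.Perm.exists_extending_pair f (lpt p ht) hf hg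
  have h1 : RK ℓ (fun v => v ∘ σ) := perm_all hN σ
  have h2 : RK ℓ (fun v => v ∘ (σ⁻¹ : Equiv.Perm (XX ℓ))) := perm_all hN σ⁻¹
  obtain ⟨L, hL, h⟩ := (h1.comp (RK_H hN p ht)).comp h2
  refine ⟨L, hL, fun v a => ?_, fun v x hx => ?_⟩
  · rw [h]
    simp only [Function.comp_apply, hσ]
    rw [if_pos (by simp [lpt])]
    have : (lpt p ht a).1 t = a := by simp [lpt]
    rw [this]
    refine Finset.sum_congr rfl fun c _ => ?_
    have : lpt (lpt p ht a) ht c = lpt p ht c := by simp [lpt]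
    rw [this, ← hσ]; simp
  · rw [h]
    simp only [Function.comp_apply]
    rw [if_neg]
    · simp
    · intro hc
      apply hx ((σ x).1 t)
      apply σ.injective
      rw [hσ, ← hc]; simp [lpt]

theorem extv_dot (ℓ : Fin N) (u v : XX ℓ → ℂ) : star (extv ℓ u) ⬝ᵥ extv ℓ v = star u ⬝ᵥ v := by
  symm
  refine Fintype.sum_of_injective Subtype.val Subtype.val_injective _ _ (fun x hx => ?_) fun x => ?_
  · have : x ℓ ≠ 0 := fun h => hx ⟨⟨x, h⟩, rfl⟩
    simp [extv, this]
  · simp [extv, x.2]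

theorem KK_iso {ℓ : Fin N} {L} (hL : L ∈ KK ℓ) (u v : XX ℓ → ℂ) : star (L u) ⬝ᵥ L v = star u ⬝ᵥ v := by
  obtain ⟨W, hW, h⟩ := hL
  rw [← extv_dot, ← h, ← h, Matrix.star_mulVec, ← Matrix.dotProduct_mulVec, Matrix.mulVec_mulVec,
    ← Matrix.star_eq_conjTranspose, hW.unit, Matrix.one_mulVec, extv_dot]

theorem KK_phase (hN : 2 ≤ N) {ℓ : Fin N} (p : XX ℓ) : ∃ L ∈ KK ℓ, ∀ v, L v = update v p (ω * v p) :=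
  RK_phase hN p
theorem KK_neg (hN : 2 ≤ N) {ℓ : Fin N} (p : XX ℓ) : ∃ L ∈ KK ℓ, ∀ v, L v = update v p (- v p) :=
  RK_neg hN p
theorem KK_perm (hN : 2 ≤ N) {ℓ : Fin N} (σ : Equiv.Perm (XX ℓ)) : ∃ L ∈ KK ℓ, ∀ v, L v = v ∘ σ :=
  perm_all hN σ

end trisec

end part6

section part7

open Matrix Function

section ringsec

def EE : Subring ℂ where
  carrier := {z | ∃ a b : ℤ, z = a + b * ω}
  mul_mem' := by
    rintro _ _ ⟨a, b, rfl⟩ ⟨c, d, rfl⟩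
    refine ⟨a * c - b * d, a * d + b * c - b * d, ?_⟩
    push_cast
    linear_combination (b * d : ℂ) * omega_sq
  one_mem' := ⟨1, 0, by simp⟩
  add_mem' := by
    rintro _ _ ⟨a, b, rfl⟩ ⟨c, d, rfl⟩
    exact ⟨a + c, b + d, by push_cast; ring⟩
  zero_mem' := ⟨0, 0, by simp⟩
  neg_mem' := by
    rintro _ ⟨a, b, rfl⟩
    exact ⟨-a, -b, by push_cast; ring⟩

theorem mem_EE {z : ℂ} : z ∈ EE ↔ ∃ a b : ℤ, z = a + b * ω := Iff.rfl

theorem omega_mem : ω ∈ EE := ⟨0, 1, by simp⟩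
theorem theta_mem : θ ∈ EE := ⟨1, 2, by simp [θ]⟩
theorem om_mem (a : Fin 3) : om a ∈ EE := pow_mem omega_mem _

def Dv (z : ℂ) : Prop := ∃ w ∈ EE, z = θ * w

theorem dv_of {a b : ℤ} (h : (3 : ℤ) ∣ a + b) : Dv (a + b * ω) := by
  obtain ⟨m, hm⟩ := h
  refine ⟨((b - m : ℤ) : ℂ) + ((b - 2 * m : ℤ) : ℂ) * ω, ⟨_, _, rfl⟩, ?_⟩
  have ha : (a : ℂ) = 3 * m - b := by
    have h : ((a + b : ℤ) : ℂ) = ((3 * m : ℤ) : ℂ) := by rw [hm]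
    push_cast at h
    linear_combination h
  rw [ha, θ]; push_cast
  linear_combination (-2 * (b - 2 * m) : ℂ) * omega_sq

def UU (z : ℂ) : Prop := z = 1 ∨ z = ω ∨ z = ω ^ 2 ∨ z = -1 ∨ z = - ω ∨ z = - ω ^ 2

theorem UU.inv {z : ℂ} (h : UU z) : ∃ w, UU w ∧ w * z = 1 := by
  have := omega_cube
  rcases h with rfl | rfl | rfl | rfl | rfl | rfl
  · exact ⟨1, by simp [UU], by ring⟩
  · exact ⟨ω ^ 2, by simp [UU], by rw [← this]; ring⟩
  · exact ⟨ω, by simp [UU], by rw [← this]; ring⟩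
  · exact ⟨-1, by simp [UU], by ring⟩
  · exact ⟨-ω ^ 2, by simp [UU], by rw [← this]; ring⟩
  · exact ⟨-ω, by simp [UU], by rw [← this]; ring⟩

theorem UU.mem {z : ℂ} (h : UU z) : z ∈ EE := by
  have := omega_mem
  rcases h with rfl | rfl | rfl | rfl | rfl | rfl
  · exact one_mem _
  · exact this
  · exact pow_mem this 2
  · exact neg_mem (one_mem _)
  · exact neg_mem this
  · exact neg_mem (pow_mem this 2)

theorem norm_EE (a b : ℤ) : ((a : ℂ) + b * ω) * star ((a : ℂ) + b * ω) = ((a ^ 2 - a * b + b ^ 2 : ℤ) : ℂ) := by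
  have : star ((a : ℂ) + b * ω) = a + b * (-1 - ω) := by
    rw [← star_omega]; simp
  rw [this]; push_cast
  linear_combination (-b ^ 2 : ℂ) * omega_sq

theorem sum3 {a b : ℤ} (h : ¬ (3 : ℤ) ∣ a + b) : ∃ e, UU e ∧ ∃ w ∈ EE, (a : ℂ) + b * ω = e + 3 * w := by
  obtain ⟨r, s, hr, hs, m, k, rfl, rfl⟩ : ∃ r s : ℤ, (r = 0 ∨ r = 1 ∨ r = 2) ∧ (s = 0 ∨ s = 1 ∨ s = 2) ∧ ∃ m k : ℤ, a = r + 3 * m ∧ b = s + 3 * k :=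
    ⟨a % 3, b % 3, by omega, by omega, a / 3, b / 3, by omega, by omega⟩
  have key : ∀ e : ℂ, ∀ c d : ℤ, UU e → (r : ℂ) + s * ω = e + 3 * (c + d * ω) →
      ∃ e, UU e ∧ ∃ w ∈ EE, ((r + 3 * m : ℤ) : ℂ) + ((s + 3 * k : ℤ) : ℂ) * ω = e + 3 * w := by
    intro e c d he h
    refine ⟨e, he, ((c + m : ℤ) : ℂ) + ((d + k : ℤ) : ℂ) * ω, ⟨_, _, rfl⟩, ?_⟩
    push_cast
    linear_combination h
  have hsq := omega_sq
  rcases hr with rfl | rfl | rfl <;> rcases hs with rfl | rfl | rfl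
  · exact absurd h (by omega)
  · exact key ω 0 0 (by simp [UU]) (by push_cast; ring)
  · exact key (-ω) 0 1 (by simp [UU]) (by push_cast; ring)
  · exact key 1 0 0 (by simp [UU]) (by push_cast; ring)
  · exact key (-ω^2) 0 0 (by simp [UU]) (by push_cast; linear_combination hsq)
  · exact absurd h (by omega)
  · exact key (-1) 1 0 (by simp [UU]) (by push_cast; ring)
  · exact absurd h (by omega)
  · exact key (ω^2) 1 1 (by simp [UU]) (by push_cast; linear_combination -hsq)

theorem normal {z : ℂ} (hz : z ∈ EE) (h : ¬ Dv z) : ∃ e, UU e ∧ ∃ w ∈ EE, e * z = 1 + 3 * w := by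
  obtain ⟨a, b, rfl⟩ := hz
  obtain ⟨e, he, w, hw, h1⟩ := sum3 (fun h2 => h (dv_of h2))
  obtain ⟨f, hf, hfe⟩ := he.inv
  exact ⟨f, hf, f * w, mul_mem hf.mem hw, by rw [h1]; linear_combination hfe⟩

/-- the norm -/
theorem exists_norm {z : ℂ} (hz : z ∈ EE) : ∃ m : ℕ, z * star z = m ∧ (Dv z → m % 3 = 0) ∧ (¬ Dv z → m % 3 = 1)
    ∧ (m = 0 → z = 0) ∧ (m = 1 → UU z) := by
  obtain ⟨a, b, rfl⟩ := hz
  have hn : 0 ≤ a ^ 2 - a * b + b ^ 2 := by nlinarith [sq_nonneg (a - b), sq_nonneg a, sq_nonneg b]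
  obtain ⟨m, hm⟩ := Int.eq_ofNat_of_zero_le hn
  have h0 : ((a : ℂ) + b * ω) * star ((a : ℂ) + b * ω) = m := by rw [norm_EE, hm]; simp
  refine ⟨m, h0, ?_, ?_, ?_, ?_⟩
  · rintro ⟨w, ⟨c, d, rfl⟩, h⟩
    rw [h, star_mul', star_theta] at h0
    have h2 := norm_EE c d
    have h3 : ((3 * (c ^ 2 - c * d + d ^ 2) : ℤ) : ℂ) = ((m : ℤ) : ℂ) := by
      rw [Int.cast_mul, ← h2]; push_cast; rw [← h0]
      linear_combination ((c + d * ω) * star ((c : ℂ) + d * ω)) * theta_sq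
    have h4 := Int.cast_injective h3
    omega
  · intro h
    have h2 : ¬ (3 : ℤ) ∣ a + b := fun h2 => h (dv_of h2)
    have h3 : (m : ℤ) = (a + b) ^ 2 - 3 * (a * b) := by linear_combination -hm
    have h4 : (a + b) ^ 2 % 3 = 1 := by
      have : (a + b) % 3 = 1 ∨ (a + b) % 3 = 2 := by omega
      rcases this with h | h <;> simp [pow_two, Int.mul_emod, h]
    omega
  · rintro rfl
    have : b = 0 := by
      have : b ^ 2 = 0 := by push_cast at hm; nlinarith [sq_nonneg (2 * a - b), sq_nonneg b]
      simpa using this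
    subst this
    have : a = 0 := by
      have : a ^ 2 = 0 := by push_cast at hm; nlinarith [sq_nonneg a]
      simpa using this
    subst this; simp
  · rintro rfl
    push_cast at hm
    have hb : b ≤ 1 := by nlinarith [sq_nonneg (2 * a - b)]
    have hb' : -1 ≤ b := by nlinarith [sq_nonneg (2 * a - b)]
    have ha : a ≤ 1 := by nlinarith [sq_nonneg (2 * b - a)]
    have ha' : -1 ≤ a := by nlinarith [sq_nonneg (2 * b - a)]
    have := omega_sq
    interval_cases a <;> interval_cases b <;> first | (exfalso; revert hm; norm_num; done) | skip
    all_goals simp only [UU, this]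
    · right; right; left; push_cast; ring
    · right; right; right; left; push_cast; ring
    · right; right; right; right; left; push_cast; ring
    · right; left; push_cast; ring
    · left; push_cast; ring
    · right; right; right; right; right; push_cast; ring

def RR : Subring ℂ where
  carrier := {z | ∃ k : ℕ, θ ^ k * z ∈ EE}
  mul_mem' := by
    rintro a b ⟨k, hk⟩ ⟨l, hl⟩
    exact ⟨k + l, by convert mul_mem hk hl using 1; ring⟩
  one_mem' := ⟨0, by simp [one_mem]⟩
  add_mem' := by
    rintro a b ⟨k, hk⟩ ⟨l, hl⟩
    refine ⟨k + l, ?_⟩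
    convert add_mem (mul_mem (pow_mem theta_mem l) hk) (mul_mem (pow_mem theta_mem k) hl) using 1; ring
  zero_mem' := ⟨0, by simp [zero_mem]⟩
  neg_mem' := by
    rintro a ⟨k, hk⟩
    exact ⟨k, by convert neg_mem hk using 1; ring⟩

theorem EE_le {z : ℂ} (h : z ∈ EE) : z ∈ RR := ⟨0, by simpa using h⟩
theorem thinv_mem : θ⁻¹ ∈ RR := ⟨1, by simp [theta_ne, one_mem]⟩
theorem H3_mem (a b : Fin 3) : H3 a b ∈ RR := by
  rw [H3_apply]; exact mul_mem thinv_mem (EE_le (om_mem _))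

theorem common {X : Type*} [Fintype X] (b : X → ℂ) (hb : ∀ x, b x ∈ RR) : ∃ k : ℕ, ∀ x, θ ^ k * b x ∈ EE := by
  choose k hk using hb
  refine ⟨∑ x, k x, fun x => ?_⟩
  have : k x ≤ ∑ x, k x := Finset.single_le_sum (f := k) (fun _ _ => Nat.zero_le _) (Finset.mem_univ x)
  obtain ⟨l, hl⟩ := Nat.exists_eq_add_of_le this
  rw [hl, pow_add]
  convert mul_mem (pow_mem theta_mem l) (hk x) using 1; ring

end ringsec

end part7

section part8

open Matrix Function

section redsec
variable {X : Type*} [Fintype X] [DecidableEq X]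

structure Good (K : Submonoid (Module.End ℂ (X → ℂ))) : Prop where
  phase : ∀ p, ∃ L ∈ K, ∀ v, L v = update v p (ω * v p)
  neg : ∀ p, ∃ L ∈ K, ∀ v, L v = update v p (- v p)
  perm : ∀ σ : Equiv.Perm X, ∃ L ∈ K, ∀ v, L v = v ∘ σ
  tri : ∀ f : Fin 3 → X, Injective f → ∃ L ∈ K, (∀ v a, L v (f a) = ∑ c, H3 a c * v (f c)) ∧
      ∀ v x, (∀ a, x ≠ f a) → L v x = v x
  iso : ∀ L ∈ K, ∀ u v, star (L u) ⬝ᵥ L v = star u ⬝ᵥ v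

def GG (K : Submonoid (Module.End ℂ (X → ℂ))) (s : Finset X) : Submonoid (Module.End ℂ (X → ℂ)) where
  carrier := {L | L ∈ K ∧ (∀ v : X → ℂ, (∀ x, v x ∈ RR) → ∀ x, L v x ∈ RR) ∧
    ∀ y ∈ s, L (Pi.single y 1) = Pi.single y 1}
  one_mem' := ⟨one_mem _, fun v h => h, fun y _ => rfl⟩
  mul_mem' := by
    rintro L M ⟨h1, h2, h3⟩ ⟨k1, k2, k3⟩
    refine ⟨mul_mem h1 k1, fun v h => h2 _ (k2 _ h), fun y hy => ?_⟩
    rw [Module.End.mul_apply, k3 y hy, h3 y hy]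

variable {K : Submonoid (Module.End ℂ (X → ℂ))} (hK : Good K) {s : Finset X}
include hK

theorem gg_unit {e : ℂ} (he : UU e) {p : X} (hp : p ∉ s) : ∃ L ∈ GG K s, ∀ v, L v = update v p (e * v p) := by
  have key : ∀ e : ℂ, e ∈ EE → (∃ L ∈ K, ∀ v, L v = update v p (e * v p)) →
      ∃ L ∈ GG K s, ∀ v, L v = update v p (e * v p) := by
    rintro e he ⟨L, hL, h⟩
    refine ⟨L, ⟨hL, fun v hv x => ?_, fun y hy => ?_⟩, h⟩
    · rw [h]
      by_cases hx : x = p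
      · subst hx; rw [update_self]; exact mul_mem (EE_le he) (hv _)
      · rw [update_of_ne hx]; exact hv x
    · have : p ≠ y := by rintro rfl; exact hp hy
      rw [h, Pi.single_eq_of_ne this]
      funext x; by_cases hx : x = p
      · subst hx; simp [this]
      · simp [hx]
  have mul : ∀ e f : ℂ, (∃ L ∈ GG K s, ∀ v, L v = update v p (e * v p)) →
      (∃ L ∈ GG K s, ∀ v, L v = update v p (f * v p)) → ∃ L ∈ GG K s, ∀ v, L v = update v p ((e * f) * v p) := by
    rintro e f ⟨L, hL, h⟩ ⟨M, hM, h'⟩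
    exact ⟨L * M, mul_mem hL hM, fun v => by rw [Module.End.mul_apply, h, h']; simp [mul_assoc]⟩
  have h1 : ∃ L ∈ GG K s, ∀ v, L v = update v p (1 * v p) := ⟨1, one_mem _, by simp⟩
  have hw := key _ omega_mem (hK.phase p)
  have hm : ∃ L ∈ GG K s, ∀ v, L v = update v p (-1 * v p) :=
    key _ (neg_mem (one_mem _)) (by simpa using hK.neg p)
  have hw2 := mul _ _ hw hw
  rw [← pow_two] at hw2
  rcases he with rfl | rfl | rfl | rfl | rfl | rfl
  · exact h1
  · exact hw
  · exact hw2
  · exact hm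
  · simpa using mul _ _ hm hw
  · simpa using mul _ _ hm hw2

theorem gg_swap {p q : X} (hp : p ∉ s) (hq : q ∉ s) : ∃ L ∈ GG K s, ∀ v, L v = v ∘ Equiv.swap p q := by
  obtain ⟨L, hL, h⟩ := hK.perm (Equiv.swap p q)
  refine ⟨L, ⟨hL, fun v hv x => by rw [h]; exact hv _, fun y hy => ?_⟩, h⟩
  have h1 : y ≠ p := by rintro rfl; exact hp hy
  have h2 : y ≠ q := by rintro rfl; exact hq hy
  rw [h]; funext x
  simp only [Function.comp_apply, Pi.single_apply]
  congr 1; apply propext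
  rw [Equiv.swap_apply_eq_iff, Equiv.swap_apply_of_ne_of_ne h1 h2]

theorem gg_tri (f : Fin 3 → X) (hf : Injective f) (hs : ∀ a, f a ∉ s) :
    ∃ L ∈ GG K s, (∀ v a, L v (f a) = ∑ c, H3 a c * v (f c)) ∧
      ∀ v x, (∀ a, x ≠ f a) → L v x = v x := by
  obtain ⟨L, hL, h1, h2⟩ := hK.tri f hf
  refine ⟨L, ⟨hL, fun v hv x => ?_, fun y hy => ?_⟩, h1, h2⟩
  · by_cases hx : ∃ a, x = f a
    · obtain ⟨a, rfl⟩ := hx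
      rw [h1]; exact sum_mem fun c _ => mul_mem (H3_mem _ _) (hv _)
    · push Not at hx
      rw [h2 _ _ hx]; exact hv x
  · have hne : ∀ a, f a ≠ y := by rintro a rfl; exact hs a hy
    funext x
    by_cases hx : ∃ a, x = f a
    · obtain ⟨a, rfl⟩ := hx
      rw [h1]; simp [hne]
    · push Not at hx
      rw [h2 _ _ hx]

omit hK in
theorem tri_dv (z : Fin 3 → ℂ) (hz : ∀ c, ∃ w ∈ EE, z c = 1 + 3 * w) (a : Fin 3) :
    Dv (∑ c, H3 a c * z c) := by
  choose w hw h using hz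
  obtain ⟨r, hr, hr'⟩ : ∃ r ∈ EE, ∑ c, om (a * c) = 3 * r := by
    fin_cases a
    · exact ⟨1, one_mem _, by simp [om_zero]⟩
    · refine ⟨0, zero_mem _, ?_⟩
      simp [Fin.sum_univ_three, om_zero, om_one, om_two]
    · refine ⟨0, zero_mem _, ?_⟩
      simp [Fin.sum_univ_three, om_zero, om_two]
      ring
  refine ⟨- (r + ∑ c, om (a * c) * w c), neg_mem (add_mem hr (sum_mem fun c _ => mul_mem (om_mem _) (hw c))), ?_⟩
  have : ∑ c, H3 a c * z c = θ⁻¹ * (∑ c, om (a * c) + 3 * ∑ c, om (a * c) * w c) := by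
    rw [Finset.mul_sum, ← Finset.sum_add_distrib, Finset.mul_sum]
    refine Finset.sum_congr rfl fun c _ => ?_
    rw [H3_apply, h]; ring
  rw [this, hr', theta_inv]
  ring

/-- one step -/
theorem gg_step (f : Fin 3 → X) (hf : Injective f) (hs : ∀ a, f a ∉ s) (u : X → ℂ) (hu : ∀ x, u x ∈ EE)
    (hd : ∀ a, ¬ Dv (u (f a))) : ∃ L ∈ GG K s, (∀ a, Dv (L u (f a))) ∧ ∀ x, (∀ a, x ≠ f a) → L u x = u x := by
  have hn := fun a => normal (hu (f a)) (hd a)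
  choose e he w hw h using hn
  have H : ∀ a, ∃ L ∈ GG K s, ∀ v, L v = update v (f a) (e a * v (f a)) := fun a => gg_unit hK (he a) (hs a)
  choose L hL hl using H
  obtain ⟨T, hT, h1, h2⟩ := gg_tri hK f hf hs
  have hne : ∀ a b, a ≠ b → f a ≠ f b := fun a b h h' => h (hf h')
  refine ⟨T * (L 0 * (L 1 * L 2)), mul_mem hT (mul_mem (hL _) (mul_mem (hL _) (hL _))), fun a => ?_, fun x hx => ?_⟩
  · simp only [Module.End.mul_apply]
    rw [h1]
    apply tri_dv
    intro c
    refine ⟨w c, hw c, ?_⟩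
    rw [← h, hl, hl, hl]
    fin_cases c
    · simp [hf.eq_iff]
    · simp [hf.eq_iff]
    · simp [hf.eq_iff]
  · simp only [Module.End.mul_apply]
    rw [h2 _ _ hx, hl, hl, hl, update_of_ne (hx _), update_of_ne (hx _), update_of_ne (hx _)]

end redsec

end part8

section part9

open Matrix Function

section redsec2
variable {X : Type*} [Fintype X] [DecidableEq X]
variable {K : Submonoid (Module.End ℂ (X → ℂ))} 

theorem reduce (hK : Good K) {s : Finset X} {x0 : X} (hx0 : x0 ∉ s) (k : ℕ) : ∀ u : X → ℂ, (∀ x, u x ∈ EE) → (∀ x ∈ s, u x = 0) →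
    star u ⬝ᵥ u = 3 ^ k → ∃ L ∈ GG K s, L u = Pi.single x0 (θ ^ k) := by
  classical
  induction k with
  | zero =>
    intro u hu hs h1
    choose m hm _ _ hm0 hm1 using fun x => exists_norm (hu x)
    have hsum : ∑ x, m x = 1 := by
      have : ((∑ x, m x : ℕ) : ℂ) = 1 := by
        rw [pow_zero] at h1
        rw [← h1]; push_cast
        refine Finset.sum_congr rfl fun x _ => ?_
        rw [← hm, Pi.star_apply, mul_comm]
      exact_mod_cast this
    obtain ⟨p, -, hp⟩ : ∃ p ∈ Finset.univ, m p ≠ 0 := by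
      apply Finset.exists_ne_zero_of_sum_ne_zero; rw [hsum]; exact one_ne_zero
    have hsum2 := Finset.add_sum_erase Finset.univ m (Finset.mem_univ p)
    rw [hsum] at hsum2
    have hz : ∑ x ∈ Finset.univ.erase p, m x = 0 := by omega
    have hz' : ∀ x, x ≠ p → u x = 0 := fun x hx => hm0 x
      (Finset.sum_eq_zero_iff.1 hz x (by simp [hx]))
    have hpu := hm1 p (by omega)
    have hps : p ∉ s := by
      intro h
      have := hm p
      rw [hs p h] at this
      apply hp; have h2 : (m p : ℂ) = 0 := by rw [← this]; simp
      exact_mod_cast h2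
    obtain ⟨w, hw, hwp⟩ := hpu.inv
    obtain ⟨L, hL, hl⟩ := gg_unit hK hw hps
    obtain ⟨M, hM, hl2⟩ := gg_swap hK hps hx0
    refine ⟨M * L, mul_mem hM hL, ?_⟩
    rw [Module.End.mul_apply, hl, hl2, hwp]
    funext x
    rw [Function.comp_apply, pow_zero, Pi.single_apply]
    by_cases hx : x = x0
    · subst hx; simp
    · have : Equiv.swap p x0 x ≠ p := by
        rw [Ne, Equiv.swap_apply_eq_iff]; simpa using hx
      rw [update_of_ne this, if_neg hx, hz' _ this]
  | succ k ih =>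
    have inner : ∀ c : ℕ, ∀ u : X → ℂ, (Finset.univ.filter fun x => ¬ Dv (u x)).card ≤ c → (∀ x, u x ∈ EE) → (∀ x ∈ s, u x = 0) →
      star u ⬝ᵥ u = 3 ^ (k + 1) → ∃ L ∈ GG K s, L u = Pi.single x0 (θ ^ (k + 1)) := by
      intro c
      induction c with
      | zero =>
        intro u hc hu hs h1
        have hd : ∀ x, Dv (u x) := by
          intro x
          by_contra h
          have := Finset.card_eq_zero.1 (Nat.le_zero.1 hc)
          have h2 : x ∈ (Finset.univ.filter fun x => ¬ Dv (u x)) := by simp [h]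
          rw [this] at h2; simp at h2
        choose w hw huw using hd
        have e : u = θ • w := by funext x; simp [huw]
        obtain ⟨L, hL, hl⟩ := ih w hw (fun x hx => by
          have := huw x
          rw [hs x hx] at this
          simpa [theta_ne] using this.symm) (by
            rw [e, star_smul, smul_dotProduct, dotProduct_smul, star_theta, smul_eq_mul, smul_eq_mul] at h1
            have h2 := theta_sq
            have h3 : (3 : ℂ) ≠ 0 := by norm_num
            apply mul_left_cancel₀ h3
            rw [pow_succ'] at h1
            rw [← h1]; linear_combination (star w ⬝ᵥ w) * h2)
        refine ⟨L, hL, ?_⟩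
        rw [e, map_smul, hl, pow_succ', ← Pi.single_smul, smul_eq_mul]
      | succ c ihc =>
        intro u hc hu hs h1
        by_cases h0 : (Finset.univ.filter fun x => ¬ Dv (u x)).card ≤ c
        · exact ihc u h0 hu hs h1
        choose m hm hd hnd _ _ using fun x => exists_norm (hu x)
        have hsum : ∑ x, m x = 3 ^ (k + 1) := by
          have : ((∑ x, m x : ℕ) : ℂ) = 3 ^ (k + 1) := by
            rw [← h1]; push_cast
            refine Finset.sum_congr rfl fun x _ => ?_
            rw [← hm, Pi.star_apply, mul_comm]
          exact_mod_cast this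
        have hmod : (Finset.univ.filter fun x => ¬ Dv (u x)).card % 3 = 0 := by
          have h2 : (∑ x, m x) % 3 = 0 := by rw [hsum, pow_succ]; omega
          rw [Finset.sum_nat_mod] at h2
          refine Eq.trans ?_ h2
          rw [Finset.card_filter]
          congr 1
          refine Finset.sum_congr rfl fun x _ => ?_
          by_cases h : Dv (u x)
          · simp [h, hd x h]
          · simp [h, hnd x h]
        have hcard : 2 < (Finset.univ.filter fun x => ¬ Dv (u x)).card := by omega
        obtain ⟨p, hp, q, hq, r, hr, hpq, hpr, hqr⟩ := Finset.two_lt_card.1 hcard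
        simp only [Finset.mem_filter, Finset.mem_univ, true_and] at hp hq hr
        let f : Fin 3 → X := ![p, q, r]
        have hf : Injective f := by
          intro a b h
          fin_cases a <;> fin_cases b <;> simp_all [f]
        have hfd : ∀ a, ¬ Dv (u (f a)) := by
          intro a; fin_cases a
          · exact hp
          · exact hq
          · exact hr
        have hD0 : Dv 0 := ⟨0, zero_mem _, by simp⟩
        have hfs : ∀ a, f a ∉ s := by
          intro a h
          apply hfd a; rw [hs _ h]; exact hD0
        obtain ⟨L, hL, hl1, hl2⟩ := gg_step hK f hf hfs u hu hfd
        have hmem : ∀ x, x ∈ s → ∀ a, x ≠ f a := by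
          rintro x hx a rfl; exact hfs a hx
        obtain ⟨M, hM, hM2⟩ := ihc (L u) (by
            have : (Finset.univ.filter fun x => ¬ Dv (L u x)).card <
                (Finset.univ.filter fun x => ¬ Dv (u x)).card := by
              apply Finset.card_lt_card
              rw [Finset.ssubset_iff_of_subset]
              · refine ⟨f 0, by simpa using hfd 0, by simpa using hl1 0⟩
              · intro x hx
                simp only [Finset.mem_filter, Finset.mem_univ, true_and] at hx ⊢
                have : ∀ a, x ≠ f a := by
                  rintro a rfl; exact hx (hl1 a)
                rwa [hl2 x this] at hx
            omega) (by
            intro x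
            by_cases hx : ∃ a, x = f a
            · obtain ⟨a, rfl⟩ := hx
              obtain ⟨w, hw, h⟩ := hl1 a
              rw [h]; exact mul_mem theta_mem hw
            · push Not at hx
              rw [hl2 x hx]; exact hu x) (fun x hx => by rw [hl2 x (hmem x hx)]; exact hs x hx)
            (by rw [hK.iso L hL.1, h1])
        exact ⟨M * L, mul_mem hM hL, hM2⟩
    intro u
    exact inner _ u le_rfl

theorem reduce_all (hK : Good K) (A : Matrix X X ℂ) (hA : star A * A = 1) (hR : ∀ x y, A x y ∈ RR) :
    ∃ L ∈ K, ∀ v, L (A *ᵥ v) = v := by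
  have key : ∀ s : Finset X, ∃ L ∈ GG K ∅, ∀ x ∈ s, L (A *ᵥ Pi.single x 1) = Pi.single x 1 := by
    intro s
    induction s using Finset.induction_on with
    | empty => exact ⟨1, one_mem _, by simp⟩
    | insert x0 s hx0 ih =>
      obtain ⟨L, hL, hs⟩ := ih
      set b := L (A *ᵥ Pi.single x0 1) with hb
      have hdot : ∀ x y, star (L (A *ᵥ Pi.single x 1)) ⬝ᵥ L (A *ᵥ Pi.single y 1) = if x = y then 1 else 0 := by
        intro x y
        rw [hK.iso L hL.1, Matrix.star_mulVec, ← Matrix.dotProduct_mulVec, Matrix.mulVec_mulVec,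
          ← Matrix.star_eq_conjTranspose, hA, Matrix.one_mulVec]
        simp [Pi.single_apply, eq_comm]
      have hbR : ∀ x, b x ∈ RR := hL.2.1 _ (fun x => by simpa using hR x x0)
      obtain ⟨k, hk⟩ := common b hbR
      obtain ⟨M, hM, hM2⟩ := reduce hK hx0 k (θ ^ k • b) hk (fun x hx => by
          have := hdot x x0
          rw [hs x hx, if_neg (by rintro rfl; exact hx0 hx)] at this
          have h2 : b x = 0 := by rw [← hb] at this; simpa [← Pi.single_star] using this
          simp [h2]) (by
          have := hdot x0 x0
          rw [if_pos rfl, ← hb] at this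
          rw [star_smul, smul_dotProduct, dotProduct_smul, this, star_pow, star_theta, smul_eq_mul, smul_eq_mul,
            mul_one, ← mul_pow]
          congr 1; linear_combination - theta_sq)
      refine ⟨M * L, mul_mem ⟨hM.1, hM.2.1, by simp⟩ hL, fun x hx => ?_⟩
      rw [Module.End.mul_apply]
      rcases Finset.mem_insert.1 hx with rfl | hx
      · rw [← hb]
        have hne : θ ^ k ≠ 0 := pow_ne_zero _ theta_ne
        rw [map_smul] at hM2
        have h3 : (θ ^ k)⁻¹ • (θ ^ k • M b) = M b := by rw [smul_smul, inv_mul_cancel₀ hne, one_smul]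
        rw [← h3, hM2, ← Pi.single_smul, smul_eq_mul, inv_mul_cancel₀ hne]
      · rw [hs x hx, hM.2.2 x hx]
  obtain ⟨L, hL, h⟩ := key Finset.univ
  refine ⟨L, hL.1, fun v => ?_⟩
  have : L ∘ₗ A.mulVecLin = LinearMap.id := by
    apply LinearMap.pi_ext'
    intro x
    apply LinearMap.ext_ring
    simpa using h x (Finset.mem_univ x)
  exact congrFun (congrArg DFunLike.coe this) v

end redsec2

end part9

section part10

open Matrix Function
open scoped Kronecker

section catsec

theorem three_inv_mem : (3 : ℂ)⁻¹ ∈ RR := ⟨2, by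
  rw [theta_sq]
  have : (-3 : ℂ) * 3⁻¹ = -1 := by norm_num
  rw [this]; exact neg_mem (one_mem _)⟩

theorem omega_memR : ω ∈ RR := EE_le omega_mem

theorem star_memE {z : ℂ} (h : z ∈ EE) : star z ∈ EE := by
  obtain ⟨a, b, rfl⟩ := h
  refine ⟨a - b, -b, ?_⟩
  have : star ((a : ℂ) + b * ω) = a + b * (-1 - ω) := by
    rw [← star_omega]; simp
  rw [this]; push_cast; ring

theorem star_memR {z : ℂ} (h : z ∈ RR) : star z ∈ RR := by
  obtain ⟨k, hk⟩ := h
  refine ⟨k, ?_⟩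
  have h1 := star_memE hk
  rw [star_mul', star_pow, star_theta, neg_pow] at h1
  have h2 := mul_mem (pow_mem (neg_mem (one_mem EE)) k) h1
  convert h2 using 1
  rw [← mul_assoc, ← mul_assoc, ← mul_pow]; simp

theorem rat_of {z : ℂ} (h : z ∈ RR) : ∃ p q : ℚ, z = p + q * ω := by
  obtain ⟨k, hk⟩ := h
  have : ∀ k : ℕ, ∀ z : ℂ, (∃ p q : ℚ, θ ^ k * z = p + q * ω) → ∃ p q : ℚ, z = p + q * ω := by
    intro k
    induction k with
    | zero => intro z h; simpa using h
    | succ k ih =>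
      rintro z ⟨p, q, h⟩
      apply ih
      refine ⟨-(p - 2 * q) / 3, -(2 * p - q) / 3, ?_⟩
      have h2 : θ ^ k * z = θ⁻¹ * (θ ^ (k + 1) * z) := by
        rw [pow_succ', mul_assoc, inv_mul_cancel_left₀ theta_ne]
      rw [h2, h, theta_inv, θ]
      push_cast
      linear_combination (-2 * q / 3 : ℂ) * omega_sq
  obtain ⟨a, b, h⟩ := hk
  exact this k z ⟨a, b, by rw [h]; simp⟩

theorem zeta_prim : IsPrimitiveRoot ζ 9 := Complex.isPrimitiveRoot_exp 9 (by norm_num)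

open Polynomial in
theorem indep {a b c : ℂ} (ha : a ∈ RR) (hb : b ∈ RR) (hc : c ∈ RR) (h : a + b * ζ + c * ζ ^ 2 = 0) :
    a = 0 ∧ b = 0 ∧ c = 0 := by
  obtain ⟨p0, q0, rfl⟩ := rat_of ha
  obtain ⟨p1, q1, rfl⟩ := rat_of hb
  obtain ⟨p2, q2, rfl⟩ := rat_of hc
  set f : ℚ[X] := C p0 + C p1 * X + C p2 * X ^ 2 + C q0 * X ^ 3 + C q1 * X ^ 4 + C q2 * X ^ 5 with hf
  have h1 : aeval ζ f = 0 := by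
    simp [hf]
    rw [← h, ← zeta_cube]; ring
  have h2 : f = 0 := by
    by_contra hne
    have h3 := minpoly.degree_le_of_ne_zero ℚ ζ hne h1
    rw [← cyclotomic_eq_minpoly_rat zeta_prim (by norm_num), degree_cyclotomic] at h3
    have h4 : f.degree ≤ 5 := by rw [hf]; compute_degree
    have h5 : Nat.totient 9 = 6 := by decide
    rw [h5] at h3
    have := h3.trans h4
    exact absurd this (by decide)
  have hco : ∀ n, f.coeff n = 0 := by rw [h2]; simp
  have c0 := hco 0
  have c1 := hco 1
  have c2 := hco 2
  have c3 := hco 3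
  have c4 := hco 4
  have c5 := hco 5
  simp [hf, coeff_X, coeff_C, coeff_X_pow] at c0 c1 c2 c3 c4 c5
  simp [c0, c1, c2, c3, c4, c5]

theorem decomp {z : ℂ} (h : z ∈ Subring.closure {(3 : ℂ)⁻¹, ζ}) :
    ∃ a b c : ℂ, a ∈ RR ∧ b ∈ RR ∧ c ∈ RR ∧ z = a + b * ζ + c * ζ ^ 2 := by
  induction h using Subring.closure_induction with
  | mem x hx =>
    rcases hx with rfl | rfl
    · exact ⟨_, 0, 0, three_inv_mem, zero_mem _, zero_mem _, by ring⟩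
    · exact ⟨0, 1, 0, zero_mem _, one_mem _, zero_mem _, by ring⟩
  | zero => exact ⟨0, 0, 0, zero_mem _, zero_mem _, zero_mem _, by ring⟩
  | one => exact ⟨1, 0, 0, one_mem _, zero_mem _, zero_mem _, by ring⟩
  | add x y _ _ hx hy =>
    obtain ⟨a, b, c, ha, hb, hc, rfl⟩ := hx
    obtain ⟨a', b', c', ha', hb', hc', rfl⟩ := hy
    exact ⟨_, _, _, add_mem ha ha', add_mem hb hb', add_mem hc hc', by ring⟩
  | neg x _ hx =>
    obtain ⟨a, b, c, ha, hb, hc, rfl⟩ := hx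
    exact ⟨_, _, _, neg_mem ha, neg_mem hb, neg_mem hc, by ring⟩
  | mul x y _ _ hx hy =>
    obtain ⟨a, b, c, ha, hb, hc, rfl⟩ := hx
    obtain ⟨a', b', c', ha', hb', hc', rfl⟩ := hy
    have hw := omega_memR
    refine ⟨a * a' + ω * (b * c' + c * b'), a * b' + b * a' + ω * (c * c'), a * c' + b * b' + c * a',
      ?_, ?_, ?_, ?_⟩
    · exact add_mem (mul_mem ha ha') (mul_mem hw (add_mem (mul_mem hb hc') (mul_mem hc hb')))
    · exact add_mem (add_mem (mul_mem ha hb') (mul_mem hb ha')) (mul_mem hw (mul_mem hc hc'))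
    · exact add_mem (add_mem (mul_mem ha hc') (mul_mem hb hb')) (mul_mem hc ha')
    · rw [← zeta_cube]; ring

noncomputable def Lam : Matrix (Fin 3) (Fin 3) ℂ := !![0, 1, 0; 0, 0, 1; ω, 0, 0]

theorem star_om2 : star ω = ω ^ 2 := by rw [star_omega, omega_sq]

theorem Lam_sq : Lam ^ 2 = !![0, 0, 1; ω, 0, 0; 0, ω, 0] := by
  rw [pow_two]
  ext i j
  fin_cases i <;> fin_cases j <;> simp [Lam, Matrix.mul_apply, Fin.sum_univ_three]

theorem Lam_star : star Lam = ω ^ 2 • Lam ^ 2 := by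
  have h := omega_cube
  have h' : ω ^ 2 * ω = 1 := by rw [← h]; ring
  have h2 := star_om2
  rw [Lam_sq]
  ext i j
  fin_cases i <;> fin_cases j <;>
    simp [Lam, Matrix.star_apply, h']
  all_goals simpa using h2

theorem Lam_cube : Lam ^ 3 = ω • (1 : Matrix (Fin 3) (Fin 3) ℂ) := by
  ext i j
  fin_cases i <;> fin_cases j <;>
    simp [Lam, pow_succ, Matrix.mul_apply, Fin.sum_univ_three]

theorem Lam_mem (i j : Fin 3) : Lam i j ∈ RR := by
  have := omega_memR
  fin_cases i <;> fin_cases j <;> simp [Lam, zero_mem, one_mem, this]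

theorem Lam_cat : Lam *ᵥ (fun i : Fin 3 => ζ ^ (i : ℕ)) = fun i : Fin 3 => ζ * ζ ^ (i : ℕ) := by
  have := zeta_cube
  funext i
  fin_cases i <;> simp [Lam, Matrix.mulVec, dotProduct, Fin.sum_univ_three]
  · ring
  · rw [← this]; ring

variable {Y : Type*} [Fintype Y] [DecidableEq Y]

theorem kron_mulVec (M : Matrix Y Y ℂ) (Q : Matrix (Fin 3) (Fin 3) ℂ) (v : Y → ℂ) (w : Fin 3 → ℂ) :
    (M ⊗ₖ Q) *ᵥ (fun p => v p.1 * w p.2) = fun p => (M *ᵥ v) p.1 * (Q *ᵥ w) p.2 := by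
  funext p
  simp only [Matrix.mulVec, dotProduct, Matrix.kroneckerMap_apply, Fintype.sum_prod_type, Finset.sum_mul_sum]
  refine Finset.sum_congr rfl fun i _ => Finset.sum_congr rfl fun j _ => ?_
  ring

theorem catalytic (U : Matrix Y Y ℂ) (hU : star U * U = 1)
    (hent : ∀ x y, U x y ∈ Subring.closure {(3 : ℂ)⁻¹, ζ}) :
    ∃ A : Matrix (Y × Fin 3) (Y × Fin 3) ℂ, star A * A = 1 ∧ (∀ x y, A x y ∈ RR) ∧
      ∀ v : Y → ℂ, A *ᵥ (fun p => v p.1 * ζ ^ (p.2 : ℕ)) = fun p => (U *ᵥ v) p.1 * ζ ^ (p.2 : ℕ) := by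
  choose a b c ha hb hc h using fun x y => decomp (hent x y)
  set U0 : Matrix Y Y ℂ := Matrix.of a with h0
  set U1 : Matrix Y Y ℂ := Matrix.of b with h1
  set U2 : Matrix Y Y ℂ := Matrix.of c with h2
  have hUd : U = U0 + ζ • U1 + ζ ^ 2 • U2 := by
    ext x y; rw [h x y]; simp [h0, h1, h2]; ring
  have z9 : ζ ^ 9 = 1 := zeta_prim.pow_eq_one
  have sz : star ζ = ω ^ 2 * ζ ^ 2 := by
    rw [star_zeta, zeta_inv, ← zeta_cube]; ring
  have sz2 : star (ζ ^ 2) = ω ^ 2 * ζ := by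
    rw [star_pow, sz, ← zeta_cube]
    linear_combination ζ ^ 7 * z9
  have hC : ∀ x y, (star U0 * U0 + star U1 * U1 + star U2 * U2 - 1 : Matrix Y Y ℂ) x y = 0 ∧
      (star U0 * U1 + star U1 * U2 + ω ^ 2 • (star U2 * U0) : Matrix Y Y ℂ) x y = 0 ∧
      (star U0 * U2 + ω ^ 2 • (star U1 * U0) + ω ^ 2 • (star U2 * U1) : Matrix Y Y ℂ) x y = 0 := by
    intro x y
    have hm : ∀ P Q : Matrix Y Y ℂ, (∀ x y, P x y ∈ RR) → (∀ x y, Q x y ∈ RR) → (star P * Q : Matrix Y Y ℂ) x y ∈ RR := by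
      intro P Q hP hQ
      rw [Matrix.mul_apply]
      exact sum_mem fun i _ => mul_mem (star_memR (hP _ _)) (hQ _ _)
    have hw2 : ω ^ 2 ∈ RR := pow_mem omega_memR 2
    apply indep
    · refine sub_mem (add_mem (add_mem (hm _ _ ha ha) (hm _ _ hb hb)) (hm _ _ hc hc)) ?_
      rw [Matrix.one_apply]; split_ifs
      · exact one_mem _
      · exact zero_mem _
    · exact add_mem (add_mem (hm _ _ ha hb) (hm _ _ hb hc)) (mul_mem hw2 (hm _ _ hc ha))
    · exact add_mem (add_mem (hm _ _ ha hc) (mul_mem hw2 (hm _ _ hb ha))) (mul_mem hw2 (hm _ _ hc hb))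
    · have hh : (star U * U - 1 : Matrix Y Y ℂ) x y = 0 := by rw [hU]; simp
      rw [hUd] at hh
      simp only [star_add, star_smul, sz, sz2, add_mul, mul_add, smul_mul_assoc, mul_smul_comm, smul_smul,
        Matrix.add_apply, Matrix.sub_apply, Matrix.smul_apply, smul_eq_mul] at hh ⊢
      rw [← zeta_cube] at hh ⊢
      linear_combination hh - ((star U1 * U1 : Matrix Y Y ℂ) x y + (star U2 * U2 : Matrix Y Y ℂ) x y
        + ζ * (star U1 * U2 : Matrix Y Y ℂ) x y) * z9
  have C0 : star U0 * U0 + star U1 * U1 + star U2 * U2 = 1 := by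
    rw [← sub_eq_zero]; ext x y; exact (hC x y).1
  have C1 : star U0 * U1 + star U1 * U2 + ω ^ 2 • (star U2 * U0) = 0 := by
    ext x y; exact (hC x y).2.1
  have C2 : star U0 * U2 + ω ^ 2 • (star U1 * U0) + ω ^ 2 • (star U2 * U1) = 0 := by
    ext x y; exact (hC x y).2.2
  refine ⟨U0 ⊗ₖ 1 + U1 ⊗ₖ Lam + U2 ⊗ₖ (Lam ^ 2), ?_, ?_, ?_⟩
  · have w4 : ω ^ 2 * ω = 1 := by rw [← omega_cube]; ring
    have l2 : star (Lam ^ 2) = ω ^ 2 • Lam := by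
      rw [star_pow, Lam_star, smul_pow, ← pow_mul, ← pow_mul, show 2 * 2 = 3 + 1 from rfl, pow_succ Lam 3, Lam_cube]
      simp only [smul_mul_assoc, one_mul, smul_smul]
      congr 1; linear_combination ω ^ 2 * omega_cube
    have m1 : star Lam * Lam = 1 := by
      rw [Lam_star, smul_mul_assoc, ← pow_succ, Lam_cube, smul_smul, w4, one_smul]
    have m2 : star Lam * Lam ^ 2 = Lam := by rw [pow_two, ← mul_assoc, m1, one_mul]
    have m3 : star (Lam ^ 2) * Lam = ω ^ 2 • Lam ^ 2 := by rw [l2, smul_mul_assoc, pow_two Lam]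
    have m4 : star (Lam ^ 2) * Lam ^ 2 = 1 := by
      rw [l2, smul_mul_assoc, ← pow_succ', Lam_cube, smul_smul, w4, one_smul]
    have hk : ∀ (M : Matrix Y Y ℂ) (Q : Matrix (Fin 3) (Fin 3) ℂ), star (M ⊗ₖ Q) = star M ⊗ₖ star Q := by
      intro M Q; simp only [Matrix.star_eq_conjTranspose, Matrix.conjTranspose_kronecker]
    simp only [star_add, hk, add_mul, mul_add, ← Matrix.mul_kronecker_mul, star_one, one_mul, mul_one, m1, m2, m3, m4]
    rw [l2, Lam_star]
    have : (1 : Matrix (Y × Fin 3) (Y × Fin 3) ℂ) =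
       (star U0 * U0 + star U1 * U1 + star U2 * U2) ⊗ₖ (1 : Matrix (Fin 3) (Fin 3) ℂ) +
       (star U0 * U1 + star U1 * U2 + ω ^ 2 • (star U2 * U0)) ⊗ₖ Lam +
       (star U0 * U2 + ω ^ 2 • (star U1 * U0) + ω ^ 2 • (star U2 * U1)) ⊗ₖ (Lam ^ 2) := by
      rw [C0, C1, C2]; simp
    rw [this]
    simp only [Matrix.add_kronecker, Matrix.smul_kronecker, Matrix.kronecker_smul]
    abel
  · intro x y
    simp only [Matrix.add_apply, Matrix.kroneckerMap_apply]
    have hl2 : ∀ i j, (Lam ^ 2) i j ∈ RR := by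
      intro i j
      rw [pow_two, Matrix.mul_apply]
      exact sum_mem fun k _ => mul_mem (Lam_mem _ _) (Lam_mem _ _)
    refine add_mem (add_mem (mul_mem (ha _ _) ?_) (mul_mem (hb _ _) (Lam_mem _ _))) (mul_mem (hc _ _) (hl2 _ _))
    rw [Matrix.one_apply]; split_ifs
    · exact one_mem _
    · exact zero_mem _
  · intro v
    have l2 : Lam ^ 2 *ᵥ (fun i : Fin 3 => ζ ^ (i : ℕ)) = fun i : Fin 3 => ζ ^ 2 * ζ ^ (i : ℕ) := by
      rw [pow_two, ← Matrix.mulVec_mulVec, Lam_cat]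
      have : (fun i : Fin 3 => ζ * ζ ^ (i : ℕ)) = ζ • (fun i : Fin 3 => ζ ^ (i : ℕ)) := rfl
      rw [this, Matrix.mulVec_smul, Lam_cat]
      funext i; simp; ring
    rw [Matrix.add_mulVec, Matrix.add_mulVec, kron_mulVec _ _ v (fun i : Fin 3 => ζ ^ (i : ℕ)),
      kron_mulVec _ _ v (fun i : Fin 3 => ζ ^ (i : ℕ)), kron_mulVec _ _ v (fun i : Fin 3 => ζ ^ (i : ℕ)), Lam_cat, l2]
    funext p
    rw [hUd]
    simp only [Matrix.add_mulVec, Matrix.smul_mulVec, Pi.add_apply, Pi.smul_apply, smul_eq_mul, Matrix.one_mulVec]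
    ring

end catsec

end part10

section part11

section mainsec
open Matrix Function

theorem good_KK {N : ℕ} (hN : 2 ≤ N) (ℓ : Fin N) : Good (KK ℓ) :=
  ⟨KK_phase hN, KK_neg hN, KK_perm hN, tri_mem hN, fun _ h => KK_iso h⟩

def eX (n : ℕ) : XX (Fin.natAdd n (1 : Fin 2)) ≃ (Fin n → Fin 3) × Fin 3 where
  toFun x := (fun i => x.1 (Fin.castAdd 2 i), x.1 (Fin.natAdd n 0))
  invFun y := ⟨Fin.append y.1 ![y.2, 0], by simp⟩
  left_inv x := by
    apply Subtype.ext
    funext i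
    refine Fin.addCases (fun i => ?_) (fun i => ?_) i
    · simp
    · fin_cases i
      · simp
      · simpa using x.2.symm
  right_inv y := by
    ext i
    · simp
    · simp

theorem main_aux (n : ℕ)
    (U : Matrix (Fin n → Fin 3) (Fin n → Fin 3) ℂ)
    (hU : U ∈ Matrix.unitaryGroup (Fin n → Fin 3) ℂ)
    (hent : ∀ x y, U x y ∈ Subring.closure {(3 : ℂ)⁻¹, ζ}) :
    ∃ W ∈ CliffordT (n + 2), ∃ w : (Fin 2 → Fin 3) → ℂ, w ≠ 0 ∧
      ∀ v : (Fin n → Fin 3) → ℂ,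
        (W : Matrix (Fin (n + 2) → Fin 3) (Fin (n + 2) → Fin 3) ℂ).mulVec
            (fun x => v (fun i => x (Fin.castAdd 2 i)) * w (fun i => x (Fin.natAdd n i))) =
          fun x => U.mulVec v (fun i => x (Fin.castAdd 2 i)) *
            w (fun i => x (Fin.natAdd n i)) := by
  obtain ⟨A, hA, hR, hv⟩ := catalytic U (Matrix.mem_unitaryGroup_iff'.1 hU) hent
  set ℓ : Fin (n + 2) := Fin.natAdd n (1 : Fin 2) with hl
  set e := eX n with he
  have hB : star (A.submatrix e e) * A.submatrix e e = 1 := by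
    rw [Matrix.star_eq_conjTranspose, Matrix.conjTranspose_submatrix, Matrix.submatrix_mul_equiv,
      ← Matrix.star_eq_conjTranspose, hA, Matrix.submatrix_one_equiv]
  obtain ⟨L, ⟨V, hV, hVL⟩, hL⟩ := reduce_all (good_KK (by omega) ℓ) (A.submatrix e e) hB (fun x y => hR _ _)
  have hW : ∀ u, star V *ᵥ extv ℓ u = extv ℓ (A.submatrix e e *ᵥ u) := by
    intro u
    have := hVL (A.submatrix e e *ᵥ u)
    rw [hL] at this
    rw [← this, Matrix.mulVec_mulVec, hV.unit, Matrix.one_mulVec]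
  obtain ⟨W, hWm, hWe⟩ := hV.star
  let w : (Fin 2 → Fin 3) → ℂ := fun y => if y 1 = 0 then ζ ^ (y 0 : ℕ) else 0
  have hext : ∀ v : (Fin n → Fin 3) → ℂ, (fun x : Fin (n + 2) → Fin 3 =>
      v (fun i => x (Fin.castAdd 2 i)) * w (fun i => x (Fin.natAdd n i))) =
      extv ℓ ((fun p : (Fin n → Fin 3) × Fin 3 => v p.1 * ζ ^ (p.2 : ℕ)) ∘ e) := by
    intro v
    funext x
    by_cases hx : x ℓ = 0
    · have hx' : x (Fin.natAdd n 1) = 0 := hx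
      simp only [extv, w, hx, hx', if_true, dite_true]
      rfl
    · have hx' : ¬ x (Fin.natAdd n 1) = 0 := hx
      simp [extv, w, hx, hx']
  refine ⟨W, hWm, w, fun h => ?_, fun v => ?_⟩
  · have := congrFun h 0
    simp [w] at this
  · rw [hext, hext (U *ᵥ v), hWe, hW, ← hv, Matrix.submatrix_mulVec_equiv]
    congr 1
    simp [Function.comp_assoc]

end mainsec

end part11

/-- For `n ≥ 1` and a `3^n × 3^n` unitary `U` with entries in `ℤ[1/3, ζ]`
(`ζ = e^{2πi/9}`), there are an element `W` of the `(n+2)`-qutrit Clifford+`T` group and a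
nonzero `w ∈ ℂ⁹` such that `W(v ⊗ w) = (Uv) ⊗ w` for every `v ∈ ℂ^{3^n}`: `U` is exactly
representable over Clifford+`T` with at most two ancillae. -/
theorem multiqutrit_zeta_ring_synthesis
    (n : ℕ) (hn : 1 ≤ n)
    (U : Matrix (Fin n → Fin 3) (Fin n → Fin 3) ℂ)
    (hU : U ∈ Matrix.unitaryGroup (Fin n → Fin 3) ℂ)
    (hent : ∀ x y, U x y ∈ Subring.closure {(3 : ℂ)⁻¹, ζ}) :
    ∃ W ∈ CliffordT (n + 2), ∃ w : (Fin 2 → Fin 3) → ℂ, w ≠ 0 ∧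
      ∀ v : (Fin n → Fin 3) → ℂ,
        (W : Matrix (Fin (n + 2) → Fin 3) (Fin (n + 2) → Fin 3) ℂ).mulVec
            (fun x => v (fun i => x (Fin.castAdd 2 i)) * w (fun i => x (Fin.natAdd n i))) =
          fun x => U.mulVec v (fun i => x (Fin.castAdd 2 i)) *
            w (fun i => x (Fin.natAdd n i)) := by
  exact main_aux n U hU hent
end
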